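/- Let k ≥ 1 and α₁,…,α_k : Fˣ → ℂˣ characters. Let y₁ ∈ GL_{d₁}(F),…,y_s ∈ GL_{d_s}(F) be regular elliptic elements whose characteristic polynomials are pairwise coprime (equivalently, with mutually disjoint eigenvalues over an algebraic closure), let n = d₁+⋯+d_s, and for each j let E_j be a degree-d_j extension of F and η_j ∈ E_j a root of the characteristic polynomial of y_j. Then K(α,ψ,diag(y₁,…,y_s)) = (-1)^{(n+s)(k-1)} · q^{(k-1)·n(n-1)/2} · ∏_{j=1}^s K_{E_j}(α,ψ,η_j), where diag(y₁,…,y_s) ∈ GL_n(F) is the block diagonal matrix with blocks y₁,…,y_s. -/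

import Mathlib

open scoped BigOperators

/-- The twisted matrix Kloosterman sum
`K(α,ψ,x) = Σ_{g₁⋯g_k = x} (∏ αᵢ(det gᵢ)) ψ(tr(g₁+⋯+g_k))`. -/
noncomputable def matrixKloosterman {F : Type} [Field F] [Fintype F] [DecidableEq F]
    {ι : Type} [Fintype ι] [DecidableEq ι] {k : ℕ}
    (α : Fin k → Fˣ →* ℂˣ) (ψ : AddChar F ℂ) (x : Matrix ι ι F) : ℂ :=
  ∑ g : Fin k → (Matrix ι ι F)ˣ,
    if ((List.ofFn g).prod : Matrix ι ι F) = x then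
      (∏ i, (α i (Units.map (Matrix.detMonoidHom) (g i)) : ℂ)) *
        ψ (Matrix.trace (∑ i, ((g i : Matrix ι ι F))))
    else 0

/-- The twisted Kloosterman sum over a finite extension `E` of `F`:
`K_E(α,ψ,ξ) = Σ_{t₁⋯t_k = ξ} (∏ αᵢ(N_{E/F}(tᵢ))) ψ(Tr_{E/F}(t₁+⋯+t_k))`. -/
noncomputable def fieldKloosterman {F : Type} [Field F] [Fintype F] {k : ℕ}
    (α : Fin k → Fˣ →* ℂˣ) (ψ : AddChar F ℂ)
    (E : Type) [Field E] [Fintype E] [DecidableEq E] [Algebra F E] (ξ : E) : ℂ :=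
  ∑ t : Fin k → Eˣ,
    if ((∏ i, t i : Eˣ) : E) = ξ then
      (∏ i, (α i (Units.map (Algebra.norm F : E →* F) (t i)) : ℂ)) *
        ψ (Algebra.trace F E (∑ i, (t i : E)))
    else 0

open scoped BigOperators

namespace KL

lemma trace_idem_nat {ι : Type*} [Fintype ι] [DecidableEq ι] (e : Matrix ι ι ℂ) (he : e * e = e) :
    ∃ r : ℕ, e.trace = r := by
  have h : IsIdempotentElem (Matrix.toLin' e) := by
    unfold IsIdempotentElem
    change Matrix.toLin' e ∘ₗ Matrix.toLin' e = _
    rw [← Matrix.toLin'_mul, he]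
  refine ⟨Module.finrank ℂ (LinearMap.range (Matrix.toLin' e)), ?_⟩
  have := (LinearMap.IsIdempotentElem.isProj_range _ h).trace
  rw [← this, Matrix.trace_toLin'_eq]

/-- spectral decomposition of a finite order matrix -/
lemma finite_order_trace {ι : Type*} [Fintype ι] [DecidableEq ι] (M e : Matrix ι ι ℂ) (m : ℕ)
    (hm : m ≠ 0) (hM : M ^ m = 1) (he : e * e = e) (hc : Commute e M) (ζ : ℂ)
    (hζ : IsPrimitiveRoot ζ m) :
    ∃ r : ℕ → ℕ, ∀ k : ℕ, (e * M ^ k).trace = ∑ j ∈ Finset.range m, (r j : ℂ) * ζ ^ (j * k) := by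
  have hm' : (m : ℂ) ≠ 0 := by exact_mod_cast hm
  have hζ0 : ζ ≠ 0 := hζ.ne_zero hm
  set p : ℕ → Matrix ι ι ℂ := fun j => (m : ℂ)⁻¹ • ∑ k ∈ Finset.range m, (ζ⁻¹ ^ (j * k)) • M ^ k with hp
  have hMp : ∀ j, M * p j = ζ ^ j • p j := by
    intro j
    simp only [hp, mul_smul_comm, Finset.mul_sum]
    rw [smul_comm]
    congr 1
    have h1 : ∀ k, M * M ^ k = M ^ (k+1) := fun k => (pow_succ' M k).symm
    have h2 := Finset.sum_range_succ (fun k => (ζ⁻¹ ^ (j * k)) • M ^ k) m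
    have h3 := Finset.sum_range_succ' (fun k => (ζ⁻¹ ^ (j * k)) • M ^ k) m
    rw [h2] at h3
    have h4 : ζ⁻¹ ^ (j * m) = 1 := by
      rw [mul_comm, pow_mul, inv_pow, hζ.pow_eq_one]; simp
    simp only [h4, hM, mul_zero, pow_zero, add_left_inj] at h3
    rw [h3, Finset.smul_sum]
    refine Finset.sum_congr rfl fun k _ => ?_
    rw [h1, smul_smul]
    congr 1
    rw [mul_add, pow_add, mul_one, inv_pow ζ j, ← mul_assoc, mul_comm (ζ ^ j), mul_assoc,
      mul_inv_cancel₀ (pow_ne_zero _ hζ0), mul_one]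
  have hMkp : ∀ k j, M ^ k * p j = ζ ^ (j * k) • p j := by
    intro k j
    induction k with
    | zero => simp
    | succ k ih =>
      rw [pow_succ, mul_assoc, hMp, mul_smul_comm, ih, smul_smul, ← pow_add]
      congr 2; ring
  have hpp : ∀ j, p j * p j = p j := by
    intro j
    have h0 : p j * p j = ((m : ℂ)⁻¹ • ∑ k ∈ Finset.range m, (ζ⁻¹ ^ (j * k)) • M ^ k) * p j := rfl
    rw [h0, smul_mul_assoc, Finset.sum_mul]
    simp only [smul_mul_assoc, hMkp, smul_smul, ← mul_pow, inv_mul_cancel₀ hζ0, one_pow, one_smul]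
    simp [← Nat.cast_smul_eq_nsmul ℂ, smul_smul, hm']
  have hsum : ∑ j ∈ Finset.range m, p j = 1 := by
    simp only [hp]
    rw [← Finset.smul_sum, Finset.sum_comm]
    have : ∀ k ∈ Finset.range m, ∑ j ∈ Finset.range m, (ζ⁻¹ ^ (j * k)) • M ^ k
        = if k = 0 then (m : ℂ) • (1 : Matrix ι ι ℂ) else 0 := by
      intro k hk
      rw [← Finset.sum_smul]
      split_ifs with h
      · subst h; simp
      · have : ∑ j ∈ Finset.range m, ζ⁻¹ ^ (j * k) = 0 := by
          have hk1 : ζ⁻¹ ^ k ≠ 1 := fun h1 =>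
            h (Nat.eq_zero_of_dvd_of_lt (hζ.inv.dvd_of_pow_eq_one k h1) (Finset.mem_range.1 hk))
          have := geom_sum_eq hk1 m
          simp only [← pow_mul, mul_comm k] at this
          rw [this, mul_comm m k, mul_comm k m, pow_mul, hζ.inv.pow_eq_one]; simp
        rw [this, zero_smul]
    rw [Finset.sum_congr rfl this, Finset.sum_ite_eq' (Finset.range m) 0]
    simp [Nat.pos_of_ne_zero hm, smul_smul, hm']
  have hcp : ∀ j, Commute e (p j) := by
    intro j
    refine Commute.smul_right (Commute.sum_right _ _ _ fun k _ => ?_) _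
    exact ((hc.pow_right k).smul_right _)
  have hidem : ∀ j, (e * p j) * (e * p j) = e * p j := by
    intro j
    rw [mul_assoc, ← mul_assoc (p j), ← (hcp j).eq, mul_assoc e (p j), hpp, ← mul_assoc, he]
  choose r hr using fun j => trace_idem_nat _ (hidem j)
  refine ⟨r, fun k => ?_⟩
  have : e * M ^ k = ∑ j ∈ Finset.range m, ζ ^ (j * k) • (e * p j) := by
    conv_lhs => rw [← mul_one (M ^ k), ← hsum, Finset.mul_sum, Finset.mul_sum]
    refine Finset.sum_congr rfl fun j _ => ?_
    rw [hMkp, mul_smul_comm]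
  rw [this, Matrix.trace_sum]
  refine Finset.sum_congr rfl fun j _ => ?_
  rw [Matrix.trace_smul, hr, smul_eq_mul, mul_comm]

/-- the cyclotomic field as a subfield of `ℂ` -/
noncomputable abbrev cyc (m : ℕ) : IntermediateField ℚ ℂ :=
  IntermediateField.adjoin ℚ {Complex.exp (2 * Real.pi * Complex.I / m)}

lemma cyc_root {m : ℕ} (hm : m ≠ 0) {z : ℂ} (hz : z ^ m = 1) : z ∈ cyc m := by
  have : NeZero m := ⟨hm⟩
  obtain ⟨i, _, rfl⟩ := (Complex.isPrimitiveRoot_exp m hm).eq_pow_of_pow_eq_one hz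
  exact pow_mem (IntermediateField.mem_adjoin_simple_self _ _) _

lemma conj_root {m : ℕ} (hm : m ≠ 0) {z : ℂ} (hz : z ^ m = 1) : (starRingEnd ℂ) z = z⁻¹ := by
  rw [Complex.inv_def, Complex.normSq_eq_norm_sq, Complex.norm_eq_one_of_pow_eq_one hz hm]
  simp

lemma cyc_conj {m : ℕ} (hm : m ≠ 0) (φ : cyc m →+* ℂ) {z : ℂ} (hz : z ∈ cyc m) :
    ∃ h : (starRingEnd ℂ) z ∈ cyc m, φ ⟨_, h⟩ = (starRingEnd ℂ) (φ ⟨z, hz⟩) := by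
  induction hz using IntermediateField.adjoin_induction with
  | mem x hx =>
    have hx1 : x ^ m = 1 := by
      rw [Set.mem_singleton_iff.1 hx]; exact (Complex.isPrimitiveRoot_exp m hm).pow_eq_one
    have hxm := cyc_root hm hx1
    have h : (starRingEnd ℂ) x ∈ cyc m := by
      rw [conj_root hm hx1]; exact inv_mem hxm
    refine ⟨h, ?_⟩
    have h1 : (⟨_, h⟩ : cyc m) = (⟨x, hxm⟩ : cyc m)⁻¹ := by
      ext; simp [conj_root hm hx1]
    have h2 : φ ⟨x, hxm⟩ ^ m = 1 := by
      rw [← map_pow, ← map_one φ]; congr 1; ext; simp [hx1]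
    rw [h1, map_inv₀, conj_root hm h2]
  | algebraMap x =>
    have h : (starRingEnd ℂ) (algebraMap ℚ ℂ x) ∈ cyc m := by
      simpa using (cyc m).algebraMap_mem x
    refine ⟨h, ?_⟩
    have h1 : (⟨_, h⟩ : cyc m) = algebraMap ℚ (cyc m) x := by ext; simp
    have h2 : (⟨_, (cyc m).algebraMap_mem x⟩ : cyc m) = algebraMap ℚ (cyc m) x := by ext; simp
    rw [h1, h2]; simp
  | add x y hx hy ihx ihy =>
    obtain ⟨h1, e1⟩ := ihx
    obtain ⟨h2, e2⟩ := ihy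
    refine ⟨by rw [map_add]; exact add_mem h1 h2, ?_⟩
    have : (⟨x + y, add_mem hx hy⟩ : cyc m) = ⟨x, hx⟩ + ⟨y, hy⟩ := rfl
    rw [this, map_add φ, map_add (starRingEnd ℂ) (φ _), ← e1, ← e2, ← map_add φ]
    congr 1; ext; simp
  | inv x hx ihx =>
    obtain ⟨h1, e1⟩ := ihx
    refine ⟨by rw [map_inv₀]; exact inv_mem h1, ?_⟩
    have : (⟨x⁻¹, inv_mem hx⟩ : cyc m) = ⟨x, hx⟩⁻¹ := rfl
    rw [this, map_inv₀ φ, map_inv₀ (starRingEnd ℂ) (φ _), ← e1, ← map_inv₀ φ]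
    congr 1; ext; simp
  | mul x y hx hy ihx ihy =>
    obtain ⟨h1, e1⟩ := ihx
    obtain ⟨h2, e2⟩ := ihy
    refine ⟨by rw [map_mul]; exact mul_mem h1 h2, ?_⟩
    have : (⟨x * y, mul_mem hx hy⟩ : cyc m) = ⟨x, hx⟩ * ⟨y, hy⟩ := rfl
    rw [this, map_mul φ, map_mul (starRingEnd ℂ) (φ _), ← e1, ← e2, ← map_mul φ]
    congr 1; ext; simp

lemma cyc_unique {m : ℕ} (hm : m ≠ 0) {ι : Type*} [Fintype ι] (b : ι → ℂ) (hb : ∀ i, b i ∈ cyc m)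
    (h_intg : ∀ i, IsIntegral ℤ (b i)) (hs : ∑ i, b i * (starRingEnd ℂ) (b i) = 1) :
    ∃ i, b i ≠ 0 ∧ ∀ j, j ≠ i → b j = 0 := by
  classical
  have hprim := Complex.isPrimitiveRoot_exp m hm
  have : FiniteDimensional ℚ (cyc m) :=
    IntermediateField.adjoin.finiteDimensional ((hprim.isIntegral (Nat.pos_of_ne_zero hm)).tower_top)
  have : NumberField (cyc m) := { to_charZero := inferInstance, to_finiteDimensional := inferInstance }
  have hφ : ∀ (φ : cyc m →+* ℂ), ∑ i, ‖φ ⟨b i, hb i⟩‖ ^ 2 = 1 := by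
    intro φ
    have h1 : ∑ i, φ ⟨b i, hb i⟩ * (starRingEnd ℂ) (φ ⟨b i, hb i⟩) = 1 := by
      choose h e using fun i => cyc_conj hm φ (hb i)
      simp only [← e, ← map_mul, ← map_sum]
      rw [← map_one φ]; congr 1; ext
      simpa using hs
    simp only [Complex.mul_conj, Complex.normSq_eq_norm_sq] at h1
    exact_mod_cast h1
  have hne : ∃ i, b i ≠ 0 := by
    by_contra! h
    simp [h] at hs
  obtain ⟨i, hi⟩ := hne
  refine ⟨i, hi, ?_⟩
  have hle : ∀ φ : cyc m →+* ℂ, ‖φ ⟨b i, hb i⟩‖ ≤ 1 := by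
    intro φ
    have := Finset.single_le_sum (f := fun i => ‖φ ⟨b i, hb i⟩‖ ^ 2) (fun j _ => by positivity)
      (Finset.mem_univ i)
    rw [hφ] at this
    exact (sq_le_one_iff₀ (norm_nonneg _)).1 this
  have h_intg' : IsIntegral ℤ (⟨b i, hb i⟩ : cyc m) := by
    have := h_intg i
    exact (isIntegral_algHom_iff ((cyc m).val.restrictScalars ℤ) Subtype.val_injective).1 this
  obtain ⟨N, hN, hpow⟩ := NumberField.Embeddings.pow_eq_one_of_norm_le_one (K := cyc m) (A := ℂ)
    (x := ⟨b i, hb i⟩) (by simpa [Subtype.ext_iff] using hi) h_intg' hle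
  have hb1 : b i ^ N = 1 := by simpa [Subtype.ext_iff] using hpow
  have hnorm := Complex.norm_eq_one_of_pow_eq_one hb1 hN.ne'
  have h1 := hφ (algebraMap (cyc m) ℂ)
  intro j hj
  have h2 : ∑ i, ‖b i‖ ^ 2 = 1 := by simpa using h1
  rw [← Finset.add_sum_erase _ _ (Finset.mem_univ i), hnorm] at h2
  have h3 : ∑ x ∈ Finset.univ.erase i, ‖b x‖ ^ 2 = 0 := by linarith
  have := (Finset.sum_eq_zero_iff_of_nonneg (fun _ _ => by positivity)).1 h3 j (by simp [hj])
  simpa using this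


lemma integral_trace_avg {A κ : Type*} [Group A] [Fintype A] [Fintype κ] [DecidableEq κ]
    (R : A →* Matrix κ κ ℂ) (U : Matrix κ κ ℂ) (m : ℕ) (hm : m ≠ 0) (hU : U ^ m = 1)
    (hc : ∀ a, Commute (R a) U) :
    IsIntegral ℤ ((Fintype.card A : ℂ)⁻¹ * ∑ a, (R a * U).trace) := by
  have hA : (Fintype.card A : ℂ) ≠ 0 := by simp
  set e : Matrix κ κ ℂ := (Fintype.card A : ℂ)⁻¹ • ∑ a, R a with he
  have h1 : ∀ a, R a * e = e := by
    intro a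
    rw [he, mul_smul_comm, Finset.mul_sum]
    congr 1
    simp only [← map_mul]
    exact Fintype.sum_equiv (Equiv.mulLeft a) _ _ (fun _ => rfl)
  have h2 : e * e = e := by
    conv_lhs => enter [1]; rw [he]
    rw [smul_mul_assoc, Finset.sum_mul]
    simp [h1, ← Nat.cast_smul_eq_nsmul ℂ, smul_smul, hA]
  have h3 : Commute e U := (Commute.sum_left _ _ _ fun a _ => hc a).smul_left _
  have hprim := Complex.isPrimitiveRoot_exp m hm
  obtain ⟨r, hr⟩ := finite_order_trace U e m hm hU h2 h3 _ hprim
  have h4 := hr 1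
  rw [pow_one, he, smul_mul_assoc, Matrix.trace_smul, Finset.sum_mul, Matrix.trace_sum,
    smul_eq_mul] at h4
  rw [h4]
  refine IsIntegral.sum _ fun j _ => IsIntegral.mul ?_ ?_
  · have h5 := isIntegral_algebraMap (R := ℤ) (A := ℂ) (x := (r j : ℤ))
    simpa using h5
  · exact (hprim.isIntegral (Nat.pos_of_ne_zero hm)).pow _

open scoped Kronecker in
lemma integral_fix_avg {A Ω κ : Type*} [Group A] [Fintype A] [Fintype Ω] [DecidableEq Ω]
    [Fintype κ] [DecidableEq κ] [MulAction A Ω]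
    (σ : Equiv.Perm Ω) (hσ : ∀ (a : A) x, σ (a • x) = a • σ x) (ω : A →* ℂ)
    (R : A →* Matrix κ κ ℂ) (U : Matrix κ κ ℂ) (m : ℕ) (hm : m ≠ 0) (hU : U ^ m = 1)
    (hc : ∀ a, Commute (R a) U) :
    IsIntegral ℤ ((Fintype.card A : ℂ)⁻¹ *
      ∑ a, ω a * (Finset.univ.filter fun x : Ω => a • σ x = x).card * (R a * U).trace) := by
  let P : Equiv.Perm Ω → Matrix Ω Ω ℂ := fun f => Matrix.of fun x y => if x = f y then 1 else 0
  have hP : ∀ f g, P (f * g) = P f * P g := by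
    intro f g
    ext x y
    simp [P, Matrix.mul_apply]
    congr
  have hP1 : P 1 = 1 := by
    ext x y; simp [P, Matrix.one_apply]
    congr
  let Ph : Equiv.Perm Ω →* Matrix Ω Ω ℂ := ⟨⟨P, hP1⟩, hP⟩
  let T : A →* Equiv.Perm Ω := MulAction.toPermHom A Ω
  let R' : A →* Matrix (Ω × κ) (Ω × κ) ℂ :=
    { toFun := fun a => ω a • (Ph (T a) ⊗ₖ R a)
      map_one' := by simp
      map_mul' := fun a b => by
        rw [map_mul, map_mul, map_mul, map_mul, Matrix.mul_kronecker_mul, smul_mul_smul_comm] }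
  have hS : ∀ k : ℕ, (Ph σ ⊗ₖ U) ^ k = (Ph (σ ^ k)) ⊗ₖ (U ^ k) := by
    intro k
    induction k with
    | zero => simp
    | succ k ih => rw [pow_succ, ih, ← Matrix.mul_kronecker_mul, ← map_mul, ← pow_succ, ← pow_succ]
  have := integral_trace_avg R' (Ph σ ⊗ₖ U) (orderOf σ * m)
    (mul_ne_zero (orderOf_pos σ).ne' hm)
    (by rw [hS, pow_mul, pow_orderOf_eq_one, one_pow, map_one, mul_comm, pow_mul, hU, one_pow]; simp)
    (by
      intro a
      refine Commute.smul_left ?_ _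
      change _ * _ = _ * _
      rw [← Matrix.mul_kronecker_mul, ← Matrix.mul_kronecker_mul, (hc a).eq, ← map_mul, ← map_mul]
      have h6 : T a * σ = σ * T a := by
        ext x
        simp [T, hσ]
      rw [h6])
  convert this using 2
  refine Finset.sum_congr rfl fun a _ => ?_
  simp only [R', MonoidHom.coe_mk, OneHom.coe_mk, smul_mul_assoc, ← Matrix.mul_kronecker_mul,
    Matrix.trace_smul, Matrix.trace_kronecker, smul_eq_mul, mul_assoc]
  congr 2
  rw [← map_mul]
  simp [Ph, P, Matrix.trace, T, eq_comm]

end KL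

open scoped BigOperators

namespace KL

lemma trace_mulLeft_pi {n : Type*} [Fintype n] [DecidableEq n] {d : n → ℕ}
    (x : (i : n) → Matrix (Fin (d i)) (Fin (d i)) ℂ) :
    LinearMap.trace ℂ _ (LinearMap.mulLeft ℂ x) = ∑ i, (d i : ℂ) * (x i).trace := by
  rw [LinearMap.trace_eq_matrix_trace ℂ
    (Pi.basis fun i => Matrix.stdBasis ℂ (Fin (d i)) (Fin (d i)))]
  simp only [Matrix.trace, Matrix.diag, LinearMap.toMatrix_apply, Fintype.sum_sigma, Pi.basis_repr,
    Pi.basis_apply, LinearMap.mulLeft_apply]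
  refine Finset.sum_congr rfl fun i _ => ?_
  rw [Fintype.sum_prod_type, Finset.mul_sum]
  refine Finset.sum_congr rfl fun a _ => ?_
  have : ∀ b, ((Matrix.stdBasis ℂ (Fin (d i)) (Fin (d i))).repr
      (x i * ((Matrix.stdBasis ℂ (Fin (d i)) (Fin (d i))) (a, b)))) (a, b) = x i a a := by
    intro b
    rw [Matrix.stdBasis_eq_single]
    change (x i * Matrix.single a b (1:ℂ) : Matrix (Fin (d i)) (Fin (d i)) ℂ) a b = _
    simp
  simp [this]

section
variable {G : Type*} [Group G] [Fintype G] [DecidableEq G]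

/-- element of the group algebra with given coefficients -/
noncomputable def Zel (f : G → ℂ) : MonoidAlgebra ℂ G := ∑ g, f g • MonoidAlgebra.of ℂ G g

lemma Zel_coeff (f : G → ℂ) (y : G) : (Zel f).coeff y = f y := by
  simp [Zel, MonoidAlgebra.coeff_sum, Finsupp.finset_sum_apply, MonoidAlgebra.coeff_single,
    Finsupp.single_apply]

lemma Zel_mul_coeff (f h : G → ℂ) (y : G) :
    (Zel f * Zel h).coeff y = ∑ g, f (y * g⁻¹) * h g := by
  have : Zel f * Zel h = ∑ g, ∑ a, (f a * h g) • MonoidAlgebra.of ℂ G (a * g) := by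
    simp only [Zel]
    rw [Finset.sum_mul_sum, Finset.sum_comm]
    refine Finset.sum_congr rfl fun a _ => Finset.sum_congr rfl fun g _ => ?_
    rw [smul_mul_smul_comm, map_mul]
  rw [this]
  simp only [MonoidAlgebra.coeff_sum, Finsupp.finset_sum_apply]
  refine Finset.sum_congr rfl fun g _ => ?_
  rw [Finset.sum_eq_single (y * g⁻¹)]
  · simp [MonoidAlgebra.coeff_single, Finsupp.single_apply]
  · intro a _ ha
    have : a * g ≠ y := fun h => ha (by rw [← h]; group)
    simp [MonoidAlgebra.coeff_single, Finsupp.single_apply, this]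
  · simp

lemma trace_regular (w : MonoidAlgebra ℂ G) :
    LinearMap.trace ℂ _ (LinearMap.mulLeft ℂ w) = Fintype.card G * w.coeff 1 := by
  rw [LinearMap.trace_eq_matrix_trace ℂ (MonoidAlgebra.basis G ℂ)]
  have : ∀ g : G, (MonoidAlgebra.basis G ℂ).repr (w * (MonoidAlgebra.basis G ℂ) g) g = w.coeff 1 := by
    intro g
    change (w * MonoidAlgebra.single g 1).coeff g = _
    rw [MonoidAlgebra.coeff_mul_single_apply]
    simp
  simp only [Matrix.trace, Matrix.diag, LinearMap.toMatrix_apply, LinearMap.mulLeft_apply, this]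
  simp

theorem single_irred (c : G → ℂ) (hcl : ∀ g h, c (h * g * h⁻¹) = c g) (m : ℕ) (hm : m ≠ 0)
    (hG : Fintype.card G ∣ m) (hcm : ∀ g, c g ∈ cyc m)
    (h_intg : ∀ (d : ℕ) (ρ : G →* Matrix (Fin d) (Fin d) ℂ),
      IsIntegral ℤ ((Fintype.card G : ℂ)⁻¹ * ∑ g, c g * (ρ g).trace))
    (hnorm : ∑ g, c g * (starRingEnd ℂ) (c g) = Fintype.card G) :
    (∀ Φ : G → ℂ, (∀ g h, Φ (h * g * h⁻¹) = Φ g) →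
      ∃ μ : ℂ, ∀ y, ∑ g, Φ (y * g⁻¹) * c g = μ * c y) ∧
    (∀ U : Subgroup G, ∀ [Fintype U], ∑ u : U, c u = 0 → ∀ g, ∑ u : U, c (g * u) = 0) := by
  classical
  have hGc : (Fintype.card G : ℂ) ≠ 0 := by simp
  obtain ⟨n, d, hd, ⟨e⟩⟩ := IsSemisimpleRing.exists_algEquiv_pi_matrix_of_isAlgClosed ℂ (MonoidAlgebra ℂ G)
  let ρ : (i : Fin n) → G →* Matrix (Fin (d i)) (Fin (d i)) ℂ := fun i =>
    { toFun := fun g => e (MonoidAlgebra.of ℂ G g) i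
      map_one' := by rw [map_one, map_one]; rfl
      map_mul' := fun a b => by rw [map_mul, map_mul]; rfl }
  have hρ : ∀ i g, ρ i g = e (MonoidAlgebra.of ℂ G g) i := fun i g => rfl
  have htr : ∀ (f : G → ℂ) i, (e (Zel f) i).trace = ∑ g, f g * (ρ i g).trace := by
    intro f i
    simp only [Zel, map_sum, map_smul, Finset.sum_apply, Pi.smul_apply, Matrix.trace_sum,
      Matrix.trace_smul, smul_eq_mul, hρ]
  have hreg : ∀ w, Fintype.card G * w.coeff 1 = ∑ i, (d i : ℂ) * (e w i).trace := by
    intro w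
    rw [← trace_mulLeft_pi, ← trace_regular, ← LinearMap.trace_conj' _ e.toLinearEquiv]
    congr 1
    apply LinearMap.ext
    intro x
    simp [LinearEquiv.conj_apply]
  -- central elements act by scalars
  have hcent : ∀ f : G → ℂ, (∀ g h, f (h * g * h⁻¹) = f g) →
      ∀ i, ∃ μ : ℂ, e (Zel f) i = μ • (1 : Matrix (Fin (d i)) (Fin (d i)) ℂ) := by
    intro f hf i
    have h1 : ∀ h : G, Zel f * MonoidAlgebra.of ℂ G h = MonoidAlgebra.of ℂ G h * Zel f := by
      intro h
      simp only [Zel, Finset.sum_mul, Finset.mul_sum, smul_mul_assoc, mul_smul_comm, ← map_mul]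
      refine Fintype.sum_equiv (MulAut.conj h⁻¹).toEquiv _ _ fun g => ?_
      have h2 := hf g h⁻¹
      simp only [inv_inv] at h2
      rw [mul_assoc] at h2
      simp [h2, mul_assoc]
    have h2 : ∀ w, Zel f * w = w * Zel f := by
      intro w
      induction w using MonoidAlgebra.induction_on with
      | of h => exact h1 h
      | add x y hx hy => rw [mul_add, add_mul, hx, hy]
      | smul r x hx => rw [mul_smul_comm, smul_mul_assoc, hx]
    have h3 : e (Zel f) i ∈ Set.center (Matrix (Fin (d i)) (Fin (d i)) ℂ) := by
      rw [Semigroup.mem_center_iff]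
      intro M
      have := congrArg (fun x => e x i) (h2 (e.symm (Pi.single i M)))
      simpa using this.symm
    rw [Matrix.center_eq_range] at h3
    obtain ⟨μ, h⟩ := h3
    exact ⟨μ, by rw [← h, Matrix.scalar_apply, ← Matrix.smul_one_eq_diagonal]⟩
  choose ω hω using hcent c hcl
  set b : Fin n → ℂ := fun i => (Fintype.card G : ℂ)⁻¹ * ∑ g, c g * (ρ i g).trace with hb
  have hdω : ∀ i, (d i : ℂ) * ω i = Fintype.card G * b i := by
    intro i
    rw [hb]
    simp only
    rw [mul_inv_cancel_left₀ hGc, ← htr, hω]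
    simp [mul_comm]
  have hord : ∀ i g, (ρ i g) ^ (Fintype.card G) = 1 := by
    intro i g; rw [← map_pow, pow_card_eq_one, map_one]
  have hprim := Complex.isPrimitiveRoot_exp (Fintype.card G) Fintype.card_ne_zero
  have hspec : ∀ i g, ∃ r : ℕ → ℕ, ∀ k : ℕ, (ρ i (g ^ k)).trace = ∑ j ∈ Finset.range (Fintype.card G), (r j : ℂ) * Complex.exp (2 * Real.pi * Complex.I / (Fintype.card G : ℕ)) ^ (j * k) := by
    intro i g
    obtain ⟨r, hr⟩ := finite_order_trace (ρ i g) 1 _ Fintype.card_ne_zero (hord i g) (one_mul 1)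
      (Commute.one_left _) _ hprim
    exact ⟨r, fun k => by rw [map_pow, ← hr, one_mul]⟩
  have hconj : ∀ i g, (ρ i g⁻¹).trace = (starRingEnd ℂ) (ρ i g).trace := by
    intro i g
    obtain ⟨r, hr⟩ := hspec i g
    have h1 := hr 1
    have h2 := hr (Fintype.card G - 1)
    have h3 : g ^ (Fintype.card G - 1) = g⁻¹ := by
      rw [eq_inv_iff_mul_eq_one, ← pow_succ, Nat.sub_add_cancel Fintype.card_pos, pow_card_eq_one]
    rw [h3] at h2
    rw [pow_one] at h1
    rw [h1, h2, map_sum]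
    refine Finset.sum_congr rfl fun j _ => ?_
    rw [map_mul, map_pow, conj_root Fintype.card_ne_zero hprim.pow_eq_one, Complex.conj_natCast,
      mul_one, inv_pow]
    congr 1
    rw [← mul_eq_one_iff_eq_inv₀ (pow_ne_zero _ (hprim.ne_zero Fintype.card_ne_zero)), ← pow_add,
      ← Nat.mul_succ, Nat.succ_eq_add_one, Nat.sub_add_cancel Fintype.card_pos, pow_mul',
      hprim.pow_eq_one, one_pow]
  have hmem : ∀ i g, (ρ i g).trace ∈ cyc m := by
    intro i g
    obtain ⟨r, hr⟩ := hspec i g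
    have h1 := hr 1
    rw [pow_one] at h1
    rw [h1]
    refine sum_mem fun j _ => mul_mem (natCast_mem _ _) (pow_mem (cyc_root hm ?_) _)
    obtain ⟨t, rfl⟩ := hG
    rw [pow_mul, hprim.pow_eq_one, one_pow]
  have hbm : ∀ i, b i ∈ cyc m := fun i =>
    mul_mem (inv_mem (natCast_mem _ _)) (sum_mem fun g _ => mul_mem (hcm g) (hmem i g))
  have hbs : ∑ i, b i * (starRingEnd ℂ) (b i) = 1 := by
    have h1 := hreg (Zel c * Zel (fun g => (starRingEnd ℂ) (c g⁻¹)))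
    rw [Zel_mul_coeff] at h1
    have h2 : ∑ g, c (1 * g⁻¹) * (starRingEnd ℂ) (c g⁻¹) = Fintype.card G := by
      rw [← hnorm]
      exact Fintype.sum_equiv (Equiv.inv G) _ _ fun g => by simp
    rw [h2] at h1
    have h3 : ∀ i, (d i : ℂ) * (e (Zel c * Zel (fun g => (starRingEnd ℂ) (c g⁻¹))) i).trace
        = (Fintype.card G : ℂ) * Fintype.card G * (b i * (starRingEnd ℂ) (b i)) := by
      intro i
      rw [map_mul, Pi.mul_apply, hω, smul_mul_assoc, one_mul, Matrix.trace_smul, smul_eq_mul,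
        ← mul_assoc, hdω, htr]
      have : ∑ g, (starRingEnd ℂ) (c g⁻¹) * ((ρ i) g).trace = Fintype.card G * (starRingEnd ℂ) (b i) := by
        rw [hb]
        simp only [map_mul, map_inv₀, Complex.conj_natCast, map_sum]
        rw [mul_inv_cancel_left₀ hGc]
        refine Fintype.sum_equiv (Equiv.inv G) _ _ fun g => ?_
        simp only [Equiv.inv_apply]
        rw [hconj]; simp
      rw [this]; ring
    simp only [h3] at h1
    rw [← Finset.mul_sum] at h1
    exact (mul_left_cancel₀ (mul_ne_zero hGc hGc) (by rw [mul_one]; exact h1)).symm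
  obtain ⟨i₀, hi₀, hother⟩ := cyc_unique hm b hbm (fun i => h_intg _ (ρ i)) hbs
  have hd0 : ∀ i, (d i : ℂ) ≠ 0 := fun i => by exact_mod_cast (hd i).ne
  have hω0 : ∀ i, i ≠ i₀ → ω i = 0 := by
    intro i hi
    have := hdω i
    rw [hother i hi, mul_zero] at this
    exact (mul_eq_zero.1 this).resolve_left (hd0 i)
  have hωi₀ : ω i₀ ≠ 0 := by
    intro h
    have := hdω i₀
    rw [h, mul_zero] at this
    exact (mul_ne_zero hGc hi₀) this.symm
  refine ⟨?_, ?_⟩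
  · intro Φ hΦ
    obtain ⟨μ, hμ⟩ := hcent Φ hΦ i₀
    refine ⟨μ, fun y => ?_⟩
    have : Zel Φ * Zel c = μ • Zel c := by
      apply e.injective
      ext i : 1
      rw [map_mul, map_smul, Pi.mul_apply, Pi.smul_apply, hω]
      by_cases hi : i = i₀
      · subst hi
        rw [hμ]; simp [smul_smul, mul_comm]
      · simp [hω0 i hi]
    rw [← Zel_mul_coeff, this, MonoidAlgebra.coeff_smul]
    simp [Zel_coeff]
  · intro U _ hU g
    set s : MonoidAlgebra ℂ G := ∑ u : U, MonoidAlgebra.of ℂ G (u : G) with hs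
    have hcard : (Fintype.card U : ℂ) ≠ 0 := by simp
    have hss : s * s = (Fintype.card U : ℂ) • s := by
      have : ∀ u : U, MonoidAlgebra.of ℂ G (u : G) * s = s := by
        intro u
        rw [hs, Finset.mul_sum]
        simp only [← map_mul]
        exact Fintype.sum_equiv (Equiv.mulLeft u) _ _ (fun _ => rfl)
      conv_lhs => enter [1]; rw [hs]
      rw [Finset.sum_mul]
      simp only [this]
      simp [← Nat.cast_smul_eq_nsmul ℂ]
    have hcoef : ∀ y, (Zel c * s).coeff y = ∑ u : U, c (y * u) := by
      intro y
      rw [hs, Finset.mul_sum]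
      simp only [MonoidAlgebra.coeff_sum, Finsupp.finset_sum_apply, MonoidAlgebra.of_apply,
        MonoidAlgebra.coeff_mul_single_apply, mul_one, Zel_coeff]
      exact Fintype.sum_equiv (Equiv.inv U) _ _ fun g => by simp
    have h1 := hreg (Zel c * s)
    rw [hcoef] at h1
    simp only [one_mul, hU, mul_zero, map_mul, Pi.mul_apply, hω, smul_mul_assoc,
      Matrix.trace_smul, smul_eq_mul] at h1
    rw [Finset.sum_eq_single i₀ (fun i _ hi => by simp [hω0 i hi]) (by simp)] at h1
    have h2 : (e s i₀).trace = 0 := by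
      have := h1.symm
      simpa [hd0 i₀, hωi₀] using this
    have h3 : e s i₀ = 0 := by
      set E : Matrix (Fin (d i₀)) (Fin (d i₀)) ℂ := (Fintype.card U : ℂ)⁻¹ • e s i₀ with hE
      have hEE : E * E = E := by
        have h0 : e s i₀ * e s i₀ = (Fintype.card U : ℂ) • e s i₀ := by
          rw [← Pi.smul_apply, ← map_smul, ← hss, map_mul, Pi.mul_apply]
        rw [hE, smul_mul_smul_comm, h0, smul_smul, mul_assoc, inv_mul_cancel₀ hcard, mul_one]
      have hE0 : E.trace = 0 := by rw [hE, Matrix.trace_smul, h2, smul_zero]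
      have hid : IsIdempotentElem (Matrix.toLin' E) := by
        change Matrix.toLin' E ∘ₗ Matrix.toLin' E = _
        rw [← Matrix.toLin'_mul, hEE]
      have h4 := (LinearMap.IsIdempotentElem.isProj_range _ hid).trace
      rw [Matrix.trace_toLin'_eq, hE0] at h4
      have h5 : Module.finrank ℂ (LinearMap.range (Matrix.toLin' E)) = 0 := by exact_mod_cast h4.symm
      have h6 : Matrix.toLin' E = 0 := by
        rw [← LinearMap.range_eq_bot]; exact Submodule.finrank_eq_zero.1 h5
      have h7 : E = 0 := by simpa using h6
      rw [hE] at h7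
      exact (smul_eq_zero.1 h7).resolve_left (inv_ne_zero hcard)
    have h8 : Zel c * s = 0 := by
      apply e.injective
      ext i : 1
      rw [map_mul, map_zero, Pi.mul_apply, hω]
      by_cases hi : i = i₀
      · subst hi; simp [h3]
      · simp [hω0 i hi]
    rw [← hcoef, h8]; simp
end

end KL

open scoped BigOperators

namespace KL
section
variable {H : Type*} [Group H] [Fintype H] {V : Type*} [Fintype V] [DecidableEq V] [MulAction H V]

/-- p-elements -/
def pel (p : ℕ) (h : H) : Prop := ∃ k : ℕ, h ^ (p ^ k) = 1

lemma tau_props (p : ℕ) [hp : Fact p.Prime] (P : Sylow p H) [Fintype (H ⧸ (P : Subgroup H))]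
    [DecidableEq (H ⧸ (P : Subgroup H))] (h : H) :
    (pel p h → ¬ p ∣ (Finset.univ.filter fun x : H ⧸ (P : Subgroup H) => h • x = x).card) ∧
    (¬ pel p h → (Finset.univ.filter fun x : H ⧸ (P : Subgroup H) => h • x = x).card = 0) := by
  constructor
  · rintro ⟨k, hk⟩
    have hpg : IsPGroup p (Subgroup.zpowers h) := by
      rintro ⟨x, hx⟩
      obtain ⟨j, rfl⟩ := Subgroup.mem_zpowers_iff.1 hx
      refine ⟨k, ?_⟩
      ext
      simp only [SubmonoidClass.coe_pow, OneMemClass.coe_one]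
      rw [← zpow_natCast, ← zpow_mul, mul_comm, zpow_mul, zpow_natCast, hk, one_zpow]
    have h1 := hpg.card_modEq_card_fixedPoints (H ⧸ (P : Subgroup H))
    have h2 : Nat.card (MulAction.fixedPoints (Subgroup.zpowers h) (H ⧸ (P : Subgroup H)))
        = (Finset.univ.filter fun x : H ⧸ (P : Subgroup H) => h • x = x).card := by
      rw [← Nat.card_eq_finsetCard]
      refine Nat.card_congr (Equiv.subtypeEquivRight fun x => ?_)
      simp only [Finset.mem_filter, Finset.mem_univ, true_and, MulAction.mem_fixedPoints]
      constructor
      · intro H1; exact H1 ⟨h, Subgroup.mem_zpowers h⟩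
      · rintro H1 ⟨y, hy⟩
        obtain ⟨j, rfl⟩ := Subgroup.mem_zpowers_iff.1 hy
        change h ^ j • x = x
        have : h ∈ MulAction.stabilizer H x := H1
        exact (MulAction.stabilizer H x).zpow_mem this j
    rw [h2] at h1
    intro hd
    have h3 : ¬ p ∣ (P : Subgroup H).index := P.not_dvd_index
    apply h3
    rw [Subgroup.index]
    exact (Nat.modEq_zero_iff_dvd.1 (h1.trans (Nat.modEq_zero_iff_dvd.2 hd)))
  · intro hn
    rw [Finset.card_eq_zero, Finset.filter_eq_empty_iff]
    intro x _ hx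
    apply hn
    induction x using QuotientGroup.induction_on with
    | H x =>
      have h1 : ((h * x : H) : H ⧸ (P : Subgroup H)) = x := hx
      rw [eq_comm, QuotientGroup.eq] at h1
      obtain ⟨k, hk⟩ := P.isPGroup' ⟨_, h1⟩
      refine ⟨k, ?_⟩
      have h2 : (x⁻¹ * (h * x)) ^ p ^ k = 1 := by
        simpa using congrArg Subtype.val hk
      have h3 : x⁻¹ * (h * x) = x⁻¹ * h * (x⁻¹)⁻¹ := by group
      rw [h3, conj_pow] at h2
      have h4 := congrArg (fun y => x * y * x⁻¹) h2
      simpa [mul_assoc] using h4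

lemma isIntegral_natCast (n : ℕ) : IsIntegral ℤ (n : ℂ) := by
  simpa using isIntegral_algebraMap (R := ℤ) (A := ℂ) (x := (n : ℤ))

lemma isIntegral_intCast (n : ℤ) : IsIntegral ℤ (n : ℂ) := by
  simpa using isIntegral_algebraMap (R := ℤ) (A := ℂ) (x := n)

theorem p_part (p : ℕ) [hp : Fact p.Prime] {κ : Type*} [Fintype κ] [DecidableEq κ]
    (ρ : H →* Matrix κ κ ℂ) (U : Matrix κ κ ℂ) (m : ℕ) (hm : m ≠ 0) (hU : U ^ m = 1)
    (hc : ∀ h, Commute (ρ h) U) (b : H → ℂ) (hb : ∀ h, IsIntegral ℤ (b h)) (D : ℤ)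
    (hD : IsCoprime D (p : ℤ)) (R : Polynomial ℤ)
    (hR : ∀ h, pel p h → (D : ℂ) * b h =
      ((R.eval ((Finset.univ.filter fun x : V => h • x = x).card : ℤ) : ℤ) : ℂ))
    (htr : ∀ h, IsIntegral ℤ (ρ h * U).trace) [DecidablePred (pel p (H := H))] :
    ∃ z : ℂ, IsIntegral ℤ z ∧ ∑ h ∈ Finset.univ.filter (fun h : H => pel p h), b h * (ρ h * U).trace
      = (p : ℂ) ^ ((Fintype.card H).factorization p) * z := by
  classical
  let P : Sylow p H := default
  set a := (Fintype.card H).factorization p with ha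
  have hPcard : Nat.card P = p ^ a := by
    rw [P.card_eq_multiplicity, Nat.card_eq_fintype_card]
  have hHa : ∃ w : ℕ, (Fintype.card H : ℂ) = (p : ℂ) ^ a * w := by
    obtain ⟨w, hw⟩ := Nat.ordProj_dvd (Fintype.card H) p
    exact ⟨w, by exact_mod_cast hw⟩
  obtain ⟨w, hw⟩ := hHa
  set fx : H → ℕ := fun h => (Finset.univ.filter fun x : V => h • x = x).card with hfx
  set τ : H → ℕ := fun h => (Finset.univ.filter fun x : H ⧸ (P : Subgroup H) => h • x = x).card with hτ
  set K := Nat.totient (p ^ a) with hK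
  have hKpos : 0 < K := Nat.totient_pos.2 (pow_pos hp.out.pos _)
  have hp0 : (p : ℂ) ^ a ≠ 0 := pow_ne_zero _ (by exact_mod_cast hp.out.ne_zero)
  have hH0 : (Fintype.card H : ℂ) ≠ 0 := by simp
  -- each power sum
  have key : ∀ k : ℕ, ∃ z : ℂ, IsIntegral ℤ z ∧
      ∑ h ∈ Finset.univ.filter (fun h : H => pel p h), (fx h : ℂ) ^ k * (ρ h * U).trace = (p : ℂ) ^ a * z := by
    intro k
    have h1 := integral_fix_avg (A := H) (Ω := (Fin k → V) × (Fin K → H ⧸ (P : Subgroup H)))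
      1 (fun _ _ => rfl) 1 ρ U m hm hU hc
    set S := ∑ h : H, ((fx h : ℂ) ^ k * (τ h : ℂ) ^ K) * (ρ h * U).trace with hS
    have h2 : IsIntegral ℤ ((Fintype.card H : ℂ)⁻¹ * S) := by
      convert h1 using 3 with h
      congr 1
      rw [MonoidHom.one_apply, one_mul]
      have : (Finset.univ.filter fun x : (Fin k → V) × (Fin K → H ⧸ (P : Subgroup H)) =>
          h • (1 : Equiv.Perm ((Fin k → V) × (Fin K → H ⧸ (P : Subgroup H)))) x = x) = (Fintype.piFinset fun _ => Finset.univ.filter fun x : V => h • x = x) ×ˢ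
          (Fintype.piFinset fun _ => Finset.univ.filter fun x : H ⧸ (P : Subgroup H) => h • x = x) := by
        ext ⟨x, y⟩
        simp [Prod.ext_iff, funext_iff]
      rw [this, Finset.card_product, Fintype.card_piFinset, Fintype.card_piFinset]
      simp [hfx, hτ]
    have h3 : ∀ h, ∃ v : ℤ, ((τ h : ℂ) ^ K) = (if pel p h then 1 else 0) + (p : ℂ) ^ a * v := by
      intro h
      by_cases hh : pel p h
      · have h4 := (tau_props p P h).1 hh
        have h5 : Nat.Coprime (τ h) (p ^ a) :=
          (((Nat.Prime.coprime_iff_not_dvd hp.out).2 h4).symm).pow_right _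
        have h6 := Nat.ModEq.pow_totient h5
        have h7 : ((p ^ a : ℕ) : ℤ) ∣ ((τ h ^ K : ℕ) : ℤ) - (1 : ℕ) := (Nat.modEq_iff_dvd.1 h6.symm)
        obtain ⟨v, hv⟩ := h7
        refine ⟨v, ?_⟩
        rw [if_pos hh]
        have h8 : (τ h : ℤ) ^ K = 1 + (p : ℤ) ^ a * v := by push_cast at hv; linarith
        exact_mod_cast h8
      · refine ⟨0, ?_⟩
        have h4 : τ h = 0 := (tau_props p P h).2 hh
        rw [if_neg hh, h4]
        simp [hKpos.ne']
    choose v hv using h3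
    refine ⟨w * ((Fintype.card H : ℂ)⁻¹ * S) - ∑ h : H, ((fx h : ℂ) ^ k * (v h : ℂ)) * (ρ h * U).trace, ?_, ?_⟩
    · refine ((isIntegral_natCast _).mul h2).sub (IsIntegral.sum _ fun h _ => ?_)
      exact (((isIntegral_natCast _).pow _).mul (isIntegral_intCast _)).mul (htr h)
    · rw [mul_sub, ← mul_assoc, ← hw, mul_inv_cancel_left₀ hH0, hS, Finset.mul_sum, ← Finset.sum_sub_distrib,
        Finset.sum_filter]
      refine Finset.sum_congr rfl fun h _ => ?_
      rw [hv h]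
      split_ifs <;> ring
  choose z hz1 hz2 using key
  -- combine
  have h4 : (D : ℂ) * ∑ h ∈ Finset.univ.filter (fun h : H => pel p h), b h * (ρ h * U).trace
      = (p : ℂ) ^ a * ∑ k ∈ Finset.range (R.natDegree + 1), (R.coeff k : ℂ) * z k := by
    rw [Finset.mul_sum, Finset.mul_sum]
    have : ∀ k, (p : ℂ) ^ a * ((R.coeff k : ℂ) * z k) = ∑ h ∈ Finset.univ.filter (fun h : H => pel p h),
        (R.coeff k : ℂ) * ((fx h : ℂ) ^ k * (ρ h * U).trace) := by
      intro k
      rw [← Finset.mul_sum, hz2]; ring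
    simp only [this]
    rw [Finset.sum_comm]
    refine Finset.sum_congr rfl fun h hh => ?_
    rw [← mul_assoc, hR h (by simpa using hh), Polynomial.eval_eq_sum_range]
    push_cast
    rw [Finset.sum_mul]
    exact Finset.sum_congr rfl fun k _ => by ring
  obtain ⟨A, B, hAB⟩ := hD.pow_right (n := a)
  have hAB' : (A : ℂ) * D + B * (p : ℂ) ^ a = 1 := by exact_mod_cast hAB
  set T := ∑ h ∈ Finset.univ.filter (fun h : H => pel p h), b h * (ρ h * U).trace with hT
  refine ⟨A * (∑ k ∈ Finset.range (R.natDegree + 1), (R.coeff k : ℂ) * z k) + B * T, ?_, ?_⟩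
  · refine ((isIntegral_intCast _).mul (IsIntegral.sum _ fun k _ => (isIntegral_intCast _).mul (hz1 k))).add
      ((isIntegral_intCast _).mul (IsIntegral.sum _ fun h _ => (hb h).mul (htr h)))
  · calc T = (A * D + B * (p : ℂ) ^ a) * T := by rw [hAB', one_mul]
      _ = A * (D * T) + (p : ℂ) ^ a * (B * T) := by ring
      _ = _ := by rw [h4]; ring
end
end KL

open scoped BigOperators

namespace KL
open Finset
/-- the Green value -/
def kap (Q : ℤ) (r : ℕ) : ℤ := ∏ i ∈ range (r - 1), (1 - Q ^ (i + 1))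

lemma kap_succ (Q : ℤ) (r : ℕ) (hr : 1 ≤ r) : kap Q (r + 1) = (1 - Q ^ r) * kap Q r := by
  obtain ⟨r, rfl⟩ : ∃ s, r = s + 1 := ⟨r - 1, by omega⟩
  simp [kap, prod_range_succ, mul_comm]

lemma kap_one (Q : ℤ) : kap Q 1 = 1 := by simp [kap]

/-- g_j(r) -/
def gj (Q : ℚ) (r j : ℕ) : ℚ := (-1) ^ j * (∏ i ∈ range j, (Q ^ r - Q ^ i)) / ∏ i ∈ range j, (Q ^ (i + 1) - 1)

lemma gj_zero (Q : ℚ) (r : ℕ) : gj Q r 0 = 1 := by simp [gj]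

lemma gj_vanish (Q : ℚ) (r j : ℕ) (h : r < j) : gj Q r j = 0 := by
  have : ∏ i ∈ range j, (Q ^ r - Q ^ i) = 0 := prod_eq_zero (mem_range.2 h) (sub_self _)
  simp [gj, this]

lemma gj_rec (Q : ℚ) (hQ : 1 < Q) (r j : ℕ) : gj Q (r + 1) (j + 1) = gj Q r (j + 1) - Q ^ r * gj Q r j := by
  have hD : ∀ j : ℕ, ∏ i ∈ range j, (Q ^ (i + 1) - 1) ≠ 0 := fun j => prod_ne_zero_iff.2 fun i _ =>
    sub_ne_zero.2 (one_lt_pow₀ hQ (by omega)).ne'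
  have h1 : ∏ i ∈ range (j + 1), (Q ^ (r + 1) - Q ^ i) = (Q ^ (r + 1) - 1) * (Q ^ j * ∏ i ∈ range j, (Q ^ r - Q ^ i)) := by
    rw [prod_range_succ', mul_comm, pow_zero]
    congr 1
    rw [← card_range j, ← prod_const, card_range, ← prod_mul_distrib]
    exact prod_congr rfl fun i _ => by ring
  have h2 := hD j
  have h3 : Q ^ (j + 1) - 1 ≠ 0 := sub_ne_zero.2 (one_lt_pow₀ hQ (by omega)).ne'
  unfold gj
  rw [h1, prod_range_succ (fun i => Q ^ r - Q ^ i), prod_range_succ (fun i => Q ^ (i + 1) - 1)]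
  field_simp
  ring

lemma gj_sums (Q : ℚ) (hQ : 1 < Q) (J : ℕ) : ∀ r, 1 ≤ r → r ≤ J →
    ∑ j ∈ range (J + 1), gj Q r j = 0 ∧
    ∑ j ∈ range (J + 1), (j : ℚ) * gj Q r j = - ∏ i ∈ range (r - 1), (1 - Q ^ (i + 1)) := by
  intro r hr
  induction r, hr using Nat.le_induction with
  | base =>
    intro hJ
    have h1 : gj Q 1 1 = -1 := by
      have : Q - 1 ≠ 0 := by linarith
      simp [gj]; field_simp; ring
    have hz : ∀ j ∈ range (J + 1), j ∉ range 2 → gj Q 1 j = 0 := by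
      intro j _ hj
      exact gj_vanish _ _ _ (by simp at hj; omega)
    have hsub : range 2 ⊆ range (J + 1) := range_subset_range.2 (by omega)
    constructor
    · rw [← sum_subset hsub hz, sum_range_succ, sum_range_one, gj_zero, h1]; norm_num
    · rw [← sum_subset hsub (fun j hj hj' => by rw [hz j hj hj', mul_zero]), sum_range_succ,
        sum_range_one, gj_zero, h1]; norm_num
  | succ r hr ih =>
    intro hJ
    obtain ⟨a1, a2⟩ := ih (by omega)
    have hJr : gj Q r J = 0 := gj_vanish _ _ _ (by omega)
    have e1 : ∑ j ∈ range J, gj Q r j = 0 := by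
      rw [sum_range_succ, hJr, add_zero] at a1; exact a1
    have e2 : ∑ j ∈ range J, (j : ℚ) * gj Q r j = - ∏ i ∈ range (r - 1), (1 - Q ^ (i + 1)) := by
      rw [sum_range_succ, hJr, mul_zero, add_zero] at a2; exact a2
    have s1 : ∑ j ∈ range J, gj Q r (j + 1) = - 1 := by
      rw [sum_range_succ', gj_zero] at a1; linarith
    have s2 : ∑ j ∈ range J, ((j + 1 : ℕ) : ℚ) * gj Q r (j + 1) = - ∏ i ∈ range (r - 1), (1 - Q ^ (i + 1)) := by
      rw [sum_range_succ'] at a2; push_cast at a2 ⊢; linarith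
    have e3 : ∑ j ∈ range J, ((j + 1 : ℕ) : ℚ) * gj Q r j = - ∏ i ∈ range (r - 1), (1 - Q ^ (i + 1)) := by
      push_cast
      simp only [add_mul, one_mul, sum_add_distrib]
      rw [e1, e2, add_zero]
    constructor
    · rw [sum_range_succ', gj_zero]
      simp only [gj_rec Q hQ]
      rw [sum_sub_distrib, ← mul_sum, e1, s1]; norm_num
    · rw [sum_range_succ']
      simp only [gj_rec Q hQ, mul_sub]
      rw [sum_sub_distrib, s2]
      have : ∑ j ∈ range J, ((j + 1 : ℕ) : ℚ) * (Q ^ r * gj Q r j) = Q ^ r * - ∏ i ∈ range (r - 1), (1 - Q ^ (i + 1)) := by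
        rw [← e3, mul_sum]; exact sum_congr rfl fun _ _ => by ring
      rw [this]
      obtain ⟨t, rfl⟩ : ∃ t, r = t + 1 := ⟨r - 1, by omega⟩
      simp only [Nat.add_sub_cancel, prod_range_succ]
      push_cast
      ring

/-- coefficients -/
def coefj (Q : ℚ) (j : ℕ) : ℚ := - (j * (-1) ^ j / ∏ i ∈ range j, (Q ^ (i + 1) - 1))

lemma kap_expand (Q : ℤ) (hQ : 1 < Q) (J r : ℕ) (hr : 1 ≤ r) (hJ : r ≤ J) :
    (kap Q r : ℚ) = ∑ j ∈ range (J + 1), coefj Q j * ((∏ i ∈ range j, (Q ^ r - Q ^ i) : ℤ) : ℚ) := by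
  have := (gj_sums (Q : ℚ) (by exact_mod_cast hQ) J r hr hJ).2
  have h2 : (kap Q r : ℚ) = - ∑ j ∈ range (J + 1), (j : ℚ) * gj Q r j := by
    rw [this, neg_neg]; simp [kap]
  rw [h2, ← sum_neg_distrib]
  refine sum_congr rfl fun j _ => ?_
  simp only [gj, coefj]
  push_cast
  ring

lemma coefj_top (Q : ℤ) (hQ : 1 < Q) (m : ℕ) (hm : 1 ≤ m) :
    coefj Q m * (kap Q m : ℚ) = m / ((Q : ℚ) ^ m - 1) := by
  obtain ⟨t, rfl⟩ : ∃ t, m = t + 1 := ⟨m - 1, by omega⟩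
  have hQ' : (1 : ℚ) < Q := by exact_mod_cast hQ
  have h1 : ∀ i : ℕ, (Q : ℚ) ^ (i + 1) - 1 ≠ 0 := fun i => sub_ne_zero.2 (one_lt_pow₀ hQ' (by omega)).ne'
  have h2 : ∏ i ∈ range t, ((Q : ℚ) ^ (i + 1) - 1) ≠ 0 := prod_ne_zero_iff.2 fun i _ => h1 i
  have h3 : ∏ i ∈ range t, (1 - (Q : ℚ) ^ (i + 1)) = (-1) ^ t * ∏ i ∈ range t, ((Q : ℚ) ^ (i + 1) - 1) := by
    nth_rw 2 [← card_range t]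
    rw [← prod_const, ← prod_mul_distrib]
    exact prod_congr rfl fun i _ => by ring
  have h4 := h1 t
  simp only [coefj, kap, Nat.add_sub_cancel, prod_range_succ]
  push_cast
  rw [h3]
  field_simp
  have : ((-1 : ℚ) ^ t) * (-1) ^ t = 1 := by rw [← mul_pow]; simp
  ring_nf
  rw [show t * 2 = t + t by ring, pow_add, this]

lemma kap_poly (Q : ℤ) (hQ : 1 < Q) (J : ℕ) (p : ℤ) (hp : p ∣ Q) : ∃ (D : ℤ) (R : Polynomial ℤ),
    IsCoprime D p ∧ ∀ r, 1 ≤ r → r ≤ J → D * kap Q r = R.eval (Q ^ r) := by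
  refine ⟨∏ i ∈ range J, (Q ^ (i + 1) - 1), ∑ j ∈ range (J + 1),
    Polynomial.C (- (j * (-1) ^ j) * ∏ i ∈ Ico j J, (Q ^ (i + 1) - 1)) *
      ∏ i ∈ range j, (Polynomial.X - Polynomial.C (Q ^ i)), ?_, ?_⟩
  · refine IsCoprime.prod_left fun i _ => ?_
    obtain ⟨c, rfl⟩ := hp
    exact ⟨-1, c ^ (i + 1) * p ^ i, by ring⟩
  · intro r hr hJ
    have h := kap_expand Q hQ J r hr hJ
    have hQ' : (1 : ℚ) < Q := by exact_mod_cast hQ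
    have h1 : ∀ i : ℕ, (Q : ℚ) ^ (i + 1) - 1 ≠ 0 := fun i => sub_ne_zero.2 (one_lt_pow₀ hQ' (by omega)).ne'
    have : ((∏ i ∈ range J, (Q ^ (i + 1) - 1) * kap Q r : ℤ) : ℚ) = _ := rfl
    rw [← Int.cast_inj (α := ℚ), Int.cast_mul, h, mul_sum, Polynomial.eval_finset_sum, Int.cast_sum]
    refine sum_congr rfl fun j hj => ?_
    have hj' : j ≤ J := by simp at hj; omega
    rw [Polynomial.eval_mul, Polynomial.eval_C, Polynomial.eval_prod]
    simp only [Polynomial.eval_sub, Polynomial.eval_X, Polynomial.eval_C]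
    rw [Int.cast_mul, ← mul_assoc]
    congr 1
    rw [← prod_range_mul_prod_Ico _ hj', coefj]
    have h2 : ∏ i ∈ range j, ((Q : ℚ) ^ (i + 1) - 1) ≠ 0 := prod_ne_zero_iff.2 fun i _ => h1 i
    push_cast
    field_simp
end KL

open scoped BigOperators Polynomial

namespace KL
section
variable {F : Type*} [Field F] {p : F[X]} [hp : Fact (Irreducible p)]

/-- module structure over F[X]/(p) -/
@[reducible] noncomputable def kmod (p : F[X]) {V : Type*} [AddCommGroup V] [Module F V] (f : Module.End F V)
    (hf : Polynomial.aeval f p = 0) : Module (AdjoinRoot p) V :=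
  Module.compHom V (Ideal.Quotient.lift (Ideal.span {p}) (Polynomial.aeval f : F[X] →ₐ[F] Module.End F V).toRingHom
    (by
      intro a ha
      obtain ⟨c, rfl⟩ := Ideal.mem_span_singleton'.1 ha
      change Polynomial.aeval f (c * p) = 0
      rw [map_mul, hf, mul_zero]) : AdjoinRoot p →+* Module.End F V)

lemma kmod_mk {V : Type*} [AddCommGroup V] [Module F V] (f : Module.End F V)
    (hf : Polynomial.aeval f p = 0) (P : F[X]) (v : V) :
    letI := kmod p f hf
    (AdjoinRoot.mk p P) • v = Polynomial.aeval f P v := rfl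

lemma kmod_tower {V : Type*} [AddCommGroup V] [Module F V] (f : Module.End F V)
    (hf : Polynomial.aeval f p = 0) :
    letI := kmod p f hf
    IsScalarTower F (AdjoinRoot p) V := by
  letI := kmod p f hf
  refine ⟨fun a x v => ?_⟩
  obtain ⟨P, rfl⟩ := AdjoinRoot.mk_surjective x
  rw [show a • (AdjoinRoot.mk p P) = AdjoinRoot.mk p (a • P) from rfl, kmod_mk, kmod_mk]
  simp

/-- commuting maps are linear -/
lemma commute_aeval {V L : Type*} [AddCommGroup V] [Module F V] [AddCommGroup L] [Module F L]
    (f : Module.End F V) (f' : Module.End F L) (φ : V →ₗ[F] L) (h : ∀ v, φ (f v) = f' (φ v)) (P : F[X]) (v : V) :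
    φ (Polynomial.aeval f P v) = Polynomial.aeval f' P (φ v) := by
  induction P using Polynomial.induction_on' with
  | add P R hP hR => simp [hP, hR]
  | monomial n a =>
    simp only [Polynomial.aeval_monomial]
    have : ∀ n : ℕ, ∀ v, φ ((f ^ n) v) = (f' ^ n) (φ v) := by
      intro n
      induction n with
      | zero => simp
      | succ n ih => intro v; rw [pow_succ, pow_succ, Module.End.mul_apply, Module.End.mul_apply, ih, h]
    simp [Module.algebraMap_end_eq_smul_id, this]

lemma card_adjoinRoot [Fintype F] : Nat.card (AdjoinRoot p) = Fintype.card F ^ p.natDegree := by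
  haveI : Module.Finite F (AdjoinRoot p) := (AdjoinRoot.powerBasis hp.out.ne_zero).finite
  rw [Module.natCard_eq_pow_finrank (K := F), Nat.card_eq_fintype_card,
    (AdjoinRoot.powerBasis hp.out.ne_zero).finrank, AdjoinRoot.powerBasis_dim]

lemma finrank_tower [Fintype F] {V : Type*} [AddCommGroup V] [Module F V] [Module (AdjoinRoot p) V]
    [IsScalarTower F (AdjoinRoot p) V] :
    Module.finrank F V = p.natDegree * Module.finrank (AdjoinRoot p) V := by
  haveI : Module.Finite F (AdjoinRoot p) := (AdjoinRoot.powerBasis hp.out.ne_zero).finite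
  rw [← Module.finrank_mul_finrank F (AdjoinRoot p) V, (AdjoinRoot.powerBasis hp.out.ne_zero).finrank,
    AdjoinRoot.powerBasis_dim]

/-- counting linear maps injective on a subspace -/
lemma count_inj_on {K : Type*} [Field K] [Finite K] {V L : Type*} [AddCommGroup V] [Module K V] [Finite V]
    [AddCommGroup L] [Module K L] [Finite L] (W : Submodule K V) :
    (Nat.card {φ : V →ₗ[K] L // ∀ w ∈ W, φ w = 0 → w = 0} : ℤ) =
      (Nat.card L : ℤ) ^ (Module.finrank K V - Module.finrank K W) *
      ∏ i ∈ Finset.range (Module.finrank K W), ((Nat.card L : ℤ) - (Nat.card K : ℤ) ^ i) := by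
  classical
  haveI := Fintype.ofFinite K
  haveI := Fintype.ofFinite L
  haveI := Fintype.ofFinite V
  obtain ⟨C, hC⟩ := Submodule.exists_isCompl W
  have hdim : Module.finrank K V - Module.finrank K W = Module.finrank K C := by
    have := Submodule.finrank_add_eq_of_isCompl hC; omega
  set r := Module.finrank K W with hr
  let bW : Module.Basis (Fin r) K W := Module.finBasis K W
  let bC : Module.Basis (Fin (Module.finrank K C)) K C := Module.finBasis K C
  have e1 : (V →ₗ[K] L) ≃ (W →ₗ[K] L) × (C →ₗ[K] L) :=
    ((LinearEquiv.arrowCongr (Submodule.prodEquivOfIsCompl W C hC).symm (LinearEquiv.refl K L)).toEquiv.trans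
      (LinearMap.coprodEquiv K (M := W) (M₂ := C) (M₃ := L)).symm.toEquiv)
  let e : {φ : V →ₗ[K] L // ∀ w ∈ W, φ w = 0 → w = 0} ≃
      {v : Fin r → L // LinearIndependent K v} × (Fin (Module.finrank K C) → L) :=
    { toFun := fun φ => (⟨fun i => φ.1 (bW i), by
          have h1 : LinearMap.ker (φ.1.comp W.subtype) = ⊥ := by
            rw [LinearMap.ker_eq_bot']
            intro w hw
            exact Subtype.ext (φ.2 w w.2 hw)
          exact bW.linearIndependent.map' _ h1⟩, fun i => φ.1 (bC i))
      invFun := fun x => ⟨(LinearMap.coprod (bW.constr K x.1.1) (bC.constr K x.2)).comp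
          (Submodule.prodEquivOfIsCompl W C hC).symm.toLinearMap, by
          intro w hw h
          have h2 : (Submodule.prodEquivOfIsCompl W C hC).symm w = (⟨w, hw⟩, 0) := by
            rw [LinearEquiv.symm_apply_eq]; simp
          simp only [LinearMap.comp_apply, LinearEquiv.coe_coe, h2, LinearMap.coprod_apply, map_zero,
            add_zero] at h
          have h3 : LinearMap.ker (bW.constr K x.1.1) = ⊥ := by
            rw [LinearMap.ker_eq_bot']
            intro z hz
            rw [Module.Basis.constr_apply_fintype] at hz
            have h4 := Fintype.linearIndependent_iff.1 x.1.2 _ hz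
            exact bW.equivFun.map_eq_zero_iff.1 (funext h4)
          have := LinearMap.ker_eq_bot'.1 h3 _ h
          simpa using this⟩
      left_inv := by
        rintro ⟨φ, hφ⟩
        ext v
        obtain ⟨⟨w, c⟩, rfl⟩ := (Submodule.prodEquivOfIsCompl W C hC).surjective v
        simp only [LinearMap.comp_apply, LinearEquiv.coe_coe, LinearEquiv.symm_apply_apply,
          LinearMap.coprod_apply]
        have h1 : (bW.constr K fun i => φ (bW i)) = φ.comp W.subtype := bW.ext fun i => by simp
        have h2 : (bC.constr K fun i => φ (bC i)) = φ.comp C.subtype := bC.ext fun i => by simp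
        rw [h1, h2]; simp
      right_inv := by
        rintro ⟨⟨x, hx⟩, y⟩
        have h2 : ∀ w : W, (Submodule.prodEquivOfIsCompl W C hC).symm (w : V) = (w, 0) := by
          intro w; rw [LinearEquiv.symm_apply_eq]; simp
        have h3 : ∀ w : C, (Submodule.prodEquivOfIsCompl W C hC).symm (w : V) = (0, w) := by
          intro w; rw [LinearEquiv.symm_apply_eq]; simp
        ext i <;> simp [h2, h3] }
  rw [Nat.card_congr e, Nat.card_prod, hdim, mul_comm]
  push_cast
  congr 1
  · simp
  · have hL : Nat.card L = Nat.card K ^ Module.finrank K L := Module.natCard_eq_pow_finrank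
    by_cases hk : r ≤ Module.finrank K L
    · rw [card_linearIndependent hk, ← Finset.prod_range (fun i => Fintype.card K ^ Module.finrank K L - Fintype.card K ^ i)]
      rw [Nat.cast_prod]
      refine Finset.prod_congr rfl fun i hi => ?_
      rw [Nat.cast_sub (Nat.pow_le_pow_right Fintype.card_pos (by simp at hi; omega)), hL]
      simp
    · push_neg at hk
      rw [Finset.prod_eq_zero (Finset.mem_range.2 hk) (by rw [hL]; simp)]
      have : IsEmpty {v : Fin r → L // LinearIndependent K v} := by
        refine ⟨fun v => ?_⟩
        have := v.2.fintype_card_le_finrank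
        simp at this; omega
      simp

lemma count_comm [Fintype F] {V L : Type*} [AddCommGroup V] [Module F V] [Finite V]
    [AddCommGroup L] [Module F L] [Finite L] (f : Module.End F V) (hf : Polynomial.aeval f p = 0)
    (f' : Module.End F L) (hf' : Polynomial.aeval f' p = 0) (W : Submodule F V) (hW : ∀ w ∈ W, f w ∈ W) :
    (Nat.card {φ : V →ₗ[F] L // (∀ v, φ (f v) = f' (φ v)) ∧ ∀ w ∈ W, φ w = 0 → w = 0} : ℤ) =
      (Nat.card L : ℤ) ^ ((Module.finrank F V - Module.finrank F W) / p.natDegree) *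
      ∏ i ∈ Finset.range (Module.finrank F W / p.natDegree),
        ((Nat.card L : ℤ) - ((Fintype.card F : ℤ) ^ p.natDegree) ^ i) := by
  letI := kmod p f hf
  letI := kmod p f' hf'
  haveI := kmod_tower f hf
  haveI := kmod_tower f' hf'
  haveI : Module.Finite F (AdjoinRoot p) := (AdjoinRoot.powerBasis hp.out.ne_zero).finite
  haveI : Finite (AdjoinRoot p) := Module.finite_of_finite F
  have hd : 0 < p.natDegree := hp.out.natDegree_pos
  have hWp : ∀ (P : F[X]) (w : V), w ∈ W → Polynomial.aeval f P w ∈ W := by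
    intro P w hw
    have := commute_aeval (f.restrict hW) f W.subtype (fun _ => rfl) P ⟨w, hw⟩
    rw [Submodule.subtype_apply, Submodule.subtype_apply] at this
    rw [← this]
    exact Subtype.property _
  let W' : Submodule (AdjoinRoot p) V :=
    { carrier := W
      add_mem' := W.add_mem
      zero_mem' := W.zero_mem
      smul_mem' := by
        intro c w hw
        obtain ⟨P, rfl⟩ := AdjoinRoot.mk_surjective c
        exact hWp P w hw }
  have hWW : Module.finrank F W = Module.finrank F W' := rfl
  have h1 : Module.finrank F W / p.natDegree = Module.finrank (AdjoinRoot p) W' := by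
    rw [hWW, finrank_tower (p := p), Nat.mul_div_cancel_left _ hd]
  have h2 : (Module.finrank F V - Module.finrank F W) / p.natDegree
      = Module.finrank (AdjoinRoot p) V - Module.finrank (AdjoinRoot p) W' := by
    rw [hWW, finrank_tower (p := p), finrank_tower (p := p) (V := W'), ← Nat.mul_sub, Nat.mul_div_cancel_left _ hd]
  have h3 := count_inj_on (K := AdjoinRoot p) (L := L) W'
  rw [h1, h2]
  rw [card_adjoinRoot] at h3
  push_cast at h3
  rw [← h3]
  congr 1
  refine Nat.card_congr
    { toFun := fun φ => ⟨{ toFun := φ.1, map_add' := φ.1.map_add, map_smul' := ?_ }, φ.2.2⟩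
      invFun := fun φ => ⟨φ.1.restrictScalars F, ?_, φ.2⟩
      left_inv := fun _ => rfl
      right_inv := fun _ => rfl }
  · intro c v
    obtain ⟨P, rfl⟩ := AdjoinRoot.mk_surjective c
    exact commute_aeval f f' φ.1 φ.2.1 P v
  · intro v
    have := φ.1.map_smul (AdjoinRoot.mk p Polynomial.X) v
    rw [kmod_mk, kmod_mk] at this
    simpa using this
end
end KL

open scoped BigOperators Polynomial

namespace KL
section
variable {F : Type*} [Field F] {V : Type*} [AddCommGroup V] [Module F V] [FiniteDimensional F V]

lemma charpoly_matrix_of_nilp {n : Type*} [Fintype n] [DecidableEq n] (M : Matrix n n F) (P : F[X]) (hP : P.Monic) (hI : Irreducible P)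
    (k : ℕ) (hk : (Polynomial.aeval M P) ^ k = 0) : ∃ i, M.charpoly = P ^ i := by
  classical
  have hfac : ∀ {f : F[X]}, f ∈ UniqueFactorizationMonoid.normalizedFactors M.charpoly → f = P := by
    intro f hf
    have hfi : Irreducible f := UniqueFactorizationMonoid.irreducible_of_normalized_factor _ hf
    have hfd : f ∣ M.charpoly := UniqueFactorizationMonoid.dvd_of_mem_normalizedFactors hf
    have hfm : f.Monic := by
      have := UniqueFactorizationMonoid.normalize_normalized_factor _ hf
      rw [← this]; exact Polynomial.monic_normalize hfi.ne_zero
    let Ω := AlgebraicClosure F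
    obtain ⟨x, hx⟩ := IsAlgClosed.exists_aeval_eq_zero Ω f hfi.degree_pos.ne'
    have h1 : Polynomial.IsRoot (M.map (algebraMap F Ω)).charpoly x := by
      rw [Matrix.charpoly_map, Polynomial.IsRoot, Polynomial.eval_map_algebraMap]
      obtain ⟨c, hc⟩ := hfd
      rw [hc, map_mul, hx, zero_mul]
    have h2 := Matrix.mem_spectrum_of_isRoot_charpoly h1
    have h3 := spectrum.subset_polynomial_aeval (M.map (algebraMap F Ω)) ((P ^ k).map (algebraMap F Ω))
      ⟨x, h2, rfl⟩
    have h4 : Polynomial.aeval (M.map (algebraMap F Ω)) ((P ^ k).map (algebraMap F Ω)) = 0 := by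
      rw [Polynomial.aeval_map_algebraMap]
      have : M.map (algebraMap F Ω) = (Algebra.ofId F Ω).mapMatrix M := rfl
      rw [this, Polynomial.aeval_algHom_apply, map_pow, hk, map_zero]
    rw [h4] at h3
    haveI : Nonempty n := by
      by_contra hne
      rw [not_nonempty_iff] at hne
      have : M.charpoly = 1 := by rw [Matrix.charpoly, Matrix.det_isEmpty]
      rw [this] at hfd
      exact hfi.not_isUnit (isUnit_of_dvd_one hfd)
    rw [spectrum.zero_eq] at h3
    have h5 : Polynomial.aeval x P = 0 := by
      have h6 : Polynomial.eval x ((P ^ k).map (algebraMap F Ω)) = 0 := by simpa using h3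
      rw [Polynomial.eval_map_algebraMap, map_pow] at h6
      exact eq_zero_of_pow_eq_zero h6
    rw [minpoly.eq_of_irreducible_of_monic hfi hx hfm, minpoly.eq_of_irreducible_of_monic hI h5 hP]
  obtain ⟨i, hi⟩ := UniqueFactorizationMonoid.exists_associated_prime_pow_of_unique_normalized_factor
    hfac M.charpoly_monic.ne_zero
  exact ⟨i, (Polynomial.eq_of_monic_of_associated (hP.pow i) M.charpoly_monic hi).symm⟩

lemma charpoly_of_nilp (g : Module.End F V) (P : F[X]) (hP : P.Monic) (hI : Irreducible P)
    (hn : IsNilpotent (Polynomial.aeval g P)) : g.charpoly = P ^ (Module.finrank F V / P.natDegree) := by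
  classical
  obtain ⟨k, hk⟩ := hn
  let b := Module.finBasis F V
  obtain ⟨i, hi⟩ := charpoly_matrix_of_nilp (LinearMap.toMatrixAlgEquiv b g) P hP hI k (by
    rw [Polynomial.aeval_algHom_apply, ← map_pow, hk, map_zero])
  have h1 : (LinearMap.toMatrixAlgEquiv b g).charpoly = g.charpoly := LinearMap.charpoly_toMatrix g b
  rw [h1] at hi
  have h2 : Module.finrank F V = i * P.natDegree := by
    rw [← LinearMap.charpoly_natDegree g, hi, Polynomial.natDegree_pow]
  rw [h2, Nat.mul_div_cancel _ hI.natDegree_pos, hi]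

lemma nilp_of_charpoly (g : Module.End F V) (P : F[X]) (m : ℕ) (h : g.charpoly = P ^ m) :
    IsNilpotent (Polynomial.aeval g P) := ⟨m, by rw [← map_pow, ← h, LinearMap.aeval_self_charpoly]⟩

open Classical in
/-- the kernel function -/
noncomputable def kk [Fintype F] (g : Module.End F V) (P : F[X]) : ℤ :=
  if IsNilpotent (Polynomial.aeval g P) then
    kap ((Fintype.card F : ℤ) ^ P.natDegree)
      (Module.finrank F (LinearMap.ker (Polynomial.aeval g P)) / P.natDegree) else 0

lemma kk_congr [Fintype F] {V' : Type*} [AddCommGroup V'] [Module F V'] [FiniteDimensional F V'] (g : Module.End F V) (g' : Module.End F V') (P P' : F[X]) (h : P.natDegree = P'.natDegree)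
    (hn : IsNilpotent (Polynomial.aeval g P) ↔ IsNilpotent (Polynomial.aeval g' P'))
    (hk : Module.finrank F (LinearMap.ker (Polynomial.aeval g P)) =
      Module.finrank F (LinearMap.ker (Polynomial.aeval g' P'))) : kk g P = kk g' P' := by
  classical
  unfold kk
  rw [h, hk]
  simp only [hn]

/-- kernel dimension is a multiple of the degree -/
lemma ker_dvd [Fintype F] (g : Module.End F V) (P : F[X]) (hI : Irreducible P) :
    P.natDegree ∣ Module.finrank F (LinearMap.ker (Polynomial.aeval g P)) := by
  haveI : Fact (Irreducible P) := ⟨hI⟩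
  have hinv : ∀ v ∈ LinearMap.ker (Polynomial.aeval g P), g v ∈ LinearMap.ker (Polynomial.aeval g P) := by
    intro v hv
    rw [LinearMap.mem_ker] at hv ⊢
    rw [← commute_aeval g g g (fun _ => rfl) P v, hv, map_zero]
  have h0 : Polynomial.aeval (g.restrict hinv) P = 0 := by
    ext v
    have := commute_aeval (g.restrict hinv) g (Submodule.subtype _) (fun _ => rfl) P v
    rw [Submodule.subtype_apply, Submodule.subtype_apply] at this
    rw [this]
    simpa using v.2
  letI := kmod P (g.restrict hinv) h0
  haveI := kmod_tower (g.restrict hinv) h0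
  exact ⟨_, finrank_tower (p := P)⟩

lemma ker_pos (g : Module.End F V) [Nontrivial V] (P : F[X])
    (hn : IsNilpotent (Polynomial.aeval g P)) : 0 < Module.finrank F (LinearMap.ker (Polynomial.aeval g P)) := by
  rw [Nat.pos_iff_ne_zero, Ne, Submodule.finrank_eq_zero]
  intro h
  obtain ⟨k, hk⟩ := hn
  have h2 : LinearMap.ker ((Polynomial.aeval g P) ^ k) = ⊥ := by
    rw [LinearMap.ker_eq_bot] at h ⊢
    rw [Module.End.coe_pow]
    exact h.iterate k
  rw [hk, LinearMap.ker_zero] at h2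
  exact top_ne_bot h2

lemma kk_conj [Fintype F] {V' : Type*} [AddCommGroup V'] [Module F V'] [FiniteDimensional F V'] (e : V ≃ₗ[F] V') (g : Module.End F V) (P : F[X]) :
    kk (e.conj g) P = kk g P := by
  have h : Polynomial.aeval (e.conj g) P = e.conj (Polynomial.aeval g P) := by
    have := Polynomial.aeval_algHom_apply (e.conjAlgEquiv F).toAlgHom g P
    exact this
  apply kk_congr
  · rfl
  · rw [h]
    constructor
    · rintro ⟨k, hk⟩
      refine ⟨k, (e.conjAlgEquiv F).injective ?_⟩
      rw [map_pow, map_zero]; exact hk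
    · rintro ⟨k, hk⟩
      refine ⟨k, ?_⟩
      have : (e.conjAlgEquiv F (Polynomial.aeval g P)) ^ k = 0 := by rw [← map_pow, hk, map_zero]
      exact this
  · rw [h]
    have : LinearMap.ker (e.conj (Polynomial.aeval g P)) = (LinearMap.ker (Polynomial.aeval g P)).map e.toLinearMap := by
      ext v
      simp only [LinearMap.mem_ker, LinearEquiv.conj_apply, LinearMap.comp_apply, LinearEquiv.coe_coe, Submodule.mem_map]
      constructor
      · intro hv
        exact ⟨e.symm v, by simpa using hv, by simp⟩
      · rintro ⟨w, hw, rfl⟩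
        simp [hw]
    rw [this]
    exact LinearEquiv.finrank_map_eq e _

section ext

variable {E : Type*} [Field E] [Algebra F E] [FiniteDimensional F E]

lemma nilp_trace (hV : Module.finrank F V = Module.finrank F E) (g : Module.End F V) (ξ : E)
    (hn : IsNilpotent (Polynomial.aeval g (minpoly F ξ))) :
    g.charpoly = (Algebra.lmul F E ξ).charpoly := by
  have h_intg : IsIntegral F ξ := Algebra.IsIntegral.isIntegral ξ
  rw [charpoly_of_nilp g _ (minpoly.monic h_intg) (minpoly.irreducible h_intg) hn,
    charpoly_of_nilp (Algebra.lmul F E ξ) _ (minpoly.monic h_intg) (minpoly.irreducible h_intg), hV]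
  rw [Polynomial.aeval_algHom_apply, minpoly.aeval, map_zero]
  exact IsNilpotent.zero

lemma kk_trace (hV : Module.finrank F V = Module.finrank F E) (g : Module.End F V) (ξ : E)
    (hn : IsNilpotent (Polynomial.aeval g (minpoly F ξ))) :
    LinearMap.trace F V g = Algebra.trace F E ξ := by
  have h := nilp_trace hV g ξ hn
  classical
  have key : ∀ {W : Type _} [AddCommGroup W] [Module F W] [FiniteDimensional F W] (f : Module.End F W),
      LinearMap.trace F W f = - f.charpoly.nextCoeff := by
    intro W _ _ _ f
    rw [LinearMap.trace_eq_matrix_trace F (Module.finBasis F W), Matrix.trace_eq_neg_charpoly_nextCoeff,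
      LinearMap.charpoly_toMatrix]
  have key2 : ∀ {W : Type _} [AddCommGroup W] [Module F W] [FiniteDimensional F W] (f : Module.End F W),
      LinearMap.trace F W f = - f.charpoly.nextCoeff := by
    intro W _ _ _ f
    rw [LinearMap.trace_eq_matrix_trace F (Module.finBasis F W), Matrix.trace_eq_neg_charpoly_nextCoeff,
      LinearMap.charpoly_toMatrix]
  rw [Algebra.trace_apply, key, key2, h]

lemma kk_det (hV : Module.finrank F V = Module.finrank F E) (g : Module.End F V) (ξ : E)
    (hn : IsNilpotent (Polynomial.aeval g (minpoly F ξ))) :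
    LinearMap.det g = Algebra.norm F ξ := by
  have h := nilp_trace hV g ξ hn
  rw [Algebra.norm_apply, LinearMap.det_eq_sign_charpoly_coeff, LinearMap.det_eq_sign_charpoly_coeff, h, hV]

end ext
end
end KL

open scoped BigOperators Polynomial

namespace KL
section
variable {F : Type*} [Field F] {V : Type*} [AddCommGroup V] [Module F V] [FiniteDimensional F V]
variable {E : Type*} [Field E] [Algebra F E] [FiniteDimensional F E]

lemma aev_comm (g : Module.End F V) (P R : F[X]) : Commute (Polynomial.aeval g P) (Polynomial.aeval g R) := by
  rw [Commute, SemiconjBy, ← map_mul, mul_comm, map_mul]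

lemma kk_poly_aux (g g' : Module.End F V) (ξ ξ' : E) (f : F[X]) (hg : g' = Polynomial.aeval g f)
    (hx : ξ' = Polynomial.aeval ξ f) : ∃ R : F[X], Polynomial.aeval g' (minpoly F ξ') =
      Polynomial.aeval g R * Polynomial.aeval g (minpoly F ξ) := by
  have : minpoly F ξ ∣ (minpoly F ξ').comp f := by
    apply minpoly.dvd
    rw [Polynomial.aeval_comp, ← hx, minpoly.aeval]
  obtain ⟨R, hR⟩ := this
  refine ⟨R, ?_⟩
  rw [hg, ← Polynomial.aeval_comp, hR, mul_comm, map_mul]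

lemma minpoly_degree_le (ξ ξ' : E) (f : F[X]) (hx : ξ' = Polynomial.aeval ξ f) :
    (minpoly F ξ').natDegree ≤ (minpoly F ξ).natDegree := by
  have h_intg : IsIntegral F ξ := Algebra.IsIntegral.isIntegral ξ
  have h_intg' : IsIntegral F ξ' := Algebra.IsIntegral.isIntegral ξ'
  rw [← IntermediateField.adjoin.finrank h_intg, ← IntermediateField.adjoin.finrank h_intg']
  have hle : IntermediateField.adjoin F {ξ'} ≤ IntermediateField.adjoin F {ξ} := by
    rw [IntermediateField.adjoin_simple_le_iff, hx]
    have : Polynomial.aeval ξ f = ((Polynomial.aeval (IntermediateField.AdjoinSimple.gen F ξ) f : IntermediateField.adjoin F {ξ}) : E) := by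
      rw [← IntermediateField.algebraMap_apply, ← Polynomial.aeval_algebraMap_apply]; rfl
    rw [this]
    exact SetLike.coe_mem _
  exact LinearMap.finrank_le_finrank_of_injective (f := (IntermediateField.inclusion hle).toLinearMap)
    (IntermediateField.inclusion hle).injective

lemma kk_poly [Fintype F] (g g' : Module.End F V) (ξ ξ' : E) (f f' : F[X]) (hg : g' = Polynomial.aeval g f)
    (hx : ξ' = Polynomial.aeval ξ f) (hg' : g = Polynomial.aeval g' f')
    (hx' : ξ = Polynomial.aeval ξ' f') : kk g' (minpoly F ξ') = kk g (minpoly F ξ) := by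
  obtain ⟨R, hR⟩ := kk_poly_aux g g' ξ ξ' f hg hx
  obtain ⟨R', hR'⟩ := kk_poly_aux g' g ξ' ξ f' hg' hx'
  apply kk_congr
  · exact le_antisymm (minpoly_degree_le _ _ f hx) (minpoly_degree_le _ _ f' hx')
  · constructor
    · intro h; rw [hR']
      exact (aev_comm g' _ _).isNilpotent_mul_left h
    · intro h; rw [hR]
      exact (aev_comm g _ _).isNilpotent_mul_left h
  · have : LinearMap.ker ((Polynomial.aeval g') (minpoly F ξ')) = LinearMap.ker ((Polynomial.aeval g) (minpoly F ξ)) := ?_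
    · rw [this]
    apply le_antisymm
    · intro v hv
      rw [LinearMap.mem_ker] at hv ⊢
      rw [hR', Module.End.mul_apply, hv, map_zero]
    · intro v hv
      rw [LinearMap.mem_ker] at hv ⊢
      rw [hR, Module.End.mul_apply, hv, map_zero]

lemma kk_add [Fintype F] (g : Module.End F V) (ξ : E) (a : F) :
    kk (g + algebraMap F _ a) (minpoly F (ξ + algebraMap F E a)) = kk g (minpoly F ξ) := by
  apply kk_poly _ _ _ _ (Polynomial.X + Polynomial.C a) (Polynomial.X - Polynomial.C a) <;> simp

lemma kk_inv [Fintype F] [Finite V] [Finite E] (g : (Module.End F V)ˣ) (ξ : Eˣ) :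
    kk (↑g⁻¹ : Module.End F V) (minpoly F (↑ξ⁻¹ : E)) = kk (g : Module.End F V) (minpoly F (ξ : E)) := by
  haveI : Finite (Module.End F V) := Finite.of_injective (fun f : Module.End F V => (f : V → V)) DFunLike.coe_injective
  haveI : Finite (Module.End F V)ˣ := inferInstance
  let o := orderOf g * orderOf ξ
  have ho : 0 < o := Nat.mul_pos (orderOf_pos g) (orderOf_pos ξ)
  have h1 : g⁻¹ = g ^ (o - 1) := by
    rw [inv_eq_iff_mul_eq_one, ← pow_succ', Nat.sub_add_cancel ho, pow_mul, pow_orderOf_eq_one, one_pow]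
  have h2 : ξ⁻¹ = ξ ^ (o - 1) := by
    rw [inv_eq_iff_mul_eq_one, ← pow_succ', Nat.sub_add_cancel ho, show o = orderOf ξ * orderOf g from mul_comm _ _, pow_mul, pow_orderOf_eq_one, one_pow]
  have h3 : g = g⁻¹ ^ (o - 1) := by rw [inv_pow, ← h1, inv_inv]
  have h4 : ξ = ξ⁻¹ ^ (o - 1) := by rw [inv_pow, ← h2, inv_inv]
  apply kk_poly _ _ _ _ (Polynomial.X ^ (o-1)) (Polynomial.X ^ (o-1))
  · rw [map_pow, Polynomial.aeval_X, ← Units.val_pow_eq_pow_val, ← h1]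
  · rw [map_pow, Polynomial.aeval_X, ← Units.val_pow_eq_pow_val, ← h2]
  · rw [map_pow, Polynomial.aeval_X, ← Units.val_pow_eq_pow_val, ← h3]
  · rw [map_pow, Polynomial.aeval_X, ← Units.val_pow_eq_pow_val, ← h4]

lemma kk_ne_zero [Fintype F] {g : Module.End F V} {P : F[X]} (h : kk g P ≠ 0) :
    IsNilpotent (Polynomial.aeval g P) := by
  by_contra hn
  exact h (by unfold kk; rw [if_neg hn])

lemma kk_unit [Fintype F] (hV : Module.finrank F V = Module.finrank F E) (g : Module.End F V) (ξ : E) (hξ : ξ ≠ 0)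
    (h : kk g (minpoly F ξ) ≠ 0) : IsUnit g := by
  rw [LinearMap.isUnit_iff_isUnit_det, kk_det hV g ξ (kk_ne_zero h), isUnit_iff_ne_zero]
  exact Algebra.norm_ne_zero_iff.2 hξ

/-- sums over tuples of vectors -/
lemma sum_tuples {K : Type*} [Field K] [Fintype K] {A : Type*} [AddCommGroup A] [Module K A] [Fintype A]
    [FiniteDimensional K A] (hA : 1 ≤ Module.finrank K A) (b : ℕ) :
    ∑ v : Fin (b+1) → A, kap (Fintype.card K : ℤ) (Module.finrank K A + (b + 1) -
      Module.finrank K (Submodule.span K (Set.range v))) = 0 := by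
  classical
  set Q : ℤ := (Fintype.card K : ℤ) with hQ
  have hrec : ∀ b : ℕ, ∑ v : Fin (b+1) → A, kap Q (Module.finrank K A + (b + 1) -
      Module.finrank K (Submodule.span K (Set.range v))) =
      Q ^ (Module.finrank K A) * (1 - Q ^ b) * ∑ v : Fin b → A, kap Q (Module.finrank K A + b -
      Module.finrank K (Submodule.span K (Set.range v))) := by
    intro b
    rw [← (Fin.consEquiv (fun _ => A)).sum_comp, Fintype.sum_prod_type, Finset.sum_comm, Finset.mul_sum]
    refine Finset.sum_congr rfl fun v _ => ?_
    set S := Submodule.span K (Set.range v) with hS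
    have hSb : Module.finrank K S ≤ b := by
      have := finrank_range_le_card (R := K) v
      simpa [Set.finrank] using this
    have hx : ∀ x : A, kap Q (Module.finrank K A + (b + 1) - Module.finrank K (Submodule.span K (Set.range
        (Fin.consEquiv (fun _ => A) (x, v))))) = if x ∈ S then kap Q (Module.finrank K A + b - Module.finrank K S + 1)
        else kap Q (Module.finrank K A + b - Module.finrank K S) := by
      intro x
      have hr : Set.range (Fin.consEquiv (fun _ : Fin (b+1) => A) (x, v)) = insert x (Set.range v) := by
        simp only [Fin.consEquiv, Equiv.coe_fn_mk, Fin.range_cons]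
      rw [hr]
      split_ifs with h
      · rw [Submodule.span_insert_eq_span h, ← hS]
        congr 1; omega
      · have : Module.finrank K (Submodule.span K (insert x (Set.range v))) = Module.finrank K S + 1 := by
          rw [Submodule.span_insert, sup_comm]
          exact Submodule.finrank_sup_span_singleton h
        rw [this]; congr 1; omega
    rw [Finset.sum_congr rfl fun x _ => hx x, Finset.sum_ite, Finset.sum_const, Finset.sum_const]
    have hc1 : ((Finset.univ.filter fun x : A => x ∈ S).card : ℤ) = Q ^ (Module.finrank K S) := by
      have := Module.card_eq_pow_finrank (K := K) (V := S)
      rw [Fintype.card_subtype] at this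
      simp only [Q]; exact_mod_cast this
    have hc2 : ((Finset.univ.filter fun x : A => ¬ x ∈ S).card : ℤ) = Q ^ (Module.finrank K A) - Q ^ (Module.finrank K S) := by
      have h1 := Finset.card_filter_add_card_filter_not (s := (Finset.univ : Finset A)) (fun x : A => x ∈ S)
      rw [Finset.card_univ, Module.card_eq_pow_finrank (K := K)] at h1
      rw [← hc1]
      have : ((Fintype.card K : ℤ)) ^ (Module.finrank K A) = ((Fintype.card K ^ (Module.finrank K A) : ℕ) : ℤ) := by push_cast; rfl
      simp only [Q, this]
      rw [← h1]; push_cast; ring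
    rw [nsmul_eq_mul, nsmul_eq_mul, hc1, hc2, kap_succ]
    · have : Q ^ (Module.finrank K S) * Q ^ (Module.finrank K A + b - Module.finrank K S) = Q ^ (Module.finrank K A) * Q ^ b := by
        rw [← pow_add, ← pow_add]; congr 1; omega
      linear_combination (- kap Q (Module.finrank K A + b - Module.finrank K S)) * this
    · omega
  induction b with
  | zero => rw [hrec]; simp
  | succ b ih => rw [hrec, ih, mul_zero]

end
end KL

open scoped BigOperators Polynomial

namespace KL
section
variable {F : Type*} [Field F] {A B : Type*} [AddCommGroup A] [Module F A] [AddCommGroup B] [Module F B]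

/-- block triangular map -/
def blk (a : Module.End F A) (β : B →ₗ[F] A) (γ : Module.End F B) : Module.End F (A × B) :=
  (a ∘ₗ LinearMap.fst F A B + β ∘ₗ LinearMap.snd F A B).prod (γ ∘ₗ LinearMap.snd F A B)

lemma blk_apply (a : Module.End F A) (β : B →ₗ[F] A) (γ : Module.End F B) (x : A × B) :
    blk a β γ x = (a x.1 + β x.2, γ x.2) := rfl

lemma blk_poly (a : Module.End F A) (γ : Module.End F B) (P : F[X]) :
    ∃ D : (B →ₗ[F] A) →ₗ[F] (B →ₗ[F] A), (∀ β x, Polynomial.aeval (blk a β γ) P x =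
      (Polynomial.aeval a P x.1 + D β x.2, Polynomial.aeval γ P x.2)) ∧
      ∀ β w, (∀ n : ℕ, β ((γ ^ n) w) = (a ^ n) (β w)) → D β w = Polynomial.aeval a (Polynomial.derivative P) (β w) := by
  induction P using Polynomial.induction_on with
  | C c =>
    refine ⟨0, ?_, ?_⟩
    · intro β x
      simp [Module.algebraMap_end_apply, Prod.ext_iff]
    · intro β w _; simp
  | add P R hP hR =>
    obtain ⟨D1, h1, h2⟩ := hP
    obtain ⟨D2, h3, h4⟩ := hR
    refine ⟨D1 + D2, ?_, ?_⟩
    · intro β x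
      rw [map_add, LinearMap.add_apply, h1, h3]
      simp only [Prod.mk_add_mk, map_add, LinearMap.add_apply]
      congr 1; abel
    · intro β w h
      simp [h2 β w h, h4 β w h]
  | monomial n c ih =>
    obtain ⟨D, h1, h2⟩ := ih
    set P := Polynomial.C c * Polynomial.X ^ n with hP
    have hPX : Polynomial.C c * Polynomial.X ^ (n+1) = P * Polynomial.X := by rw [hP]; ring
    rw [hPX]
    refine ⟨LinearMap.compRight F (Polynomial.aeval a P) + (LinearMap.lcomp F A γ) ∘ₗ D, ?_, ?_⟩
    · intro β x
      rw [map_mul, Polynomial.aeval_X, Module.End.mul_apply, h1, blk_apply]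
      simp [add_assoc]
    · intro β w h
      have h3 := h2 β (γ w) (by
        intro k
        have := h (k+1)
        rw [pow_succ, pow_succ] at this
        rw [Module.End.mul_apply, Module.End.mul_apply] at this
        rw [this]
        have := h 1
        simp only [pow_one] at this
        rw [this])
      have h4 := h 1
      simp only [pow_one] at h4
      simp [h3, h4, add_comm]

lemma blk_nilp (a : Module.End F A) (β : B →ₗ[F] A) (γ : Module.End F B) (P : F[X]) (ha : Polynomial.aeval a P = 0) :
    IsNilpotent (Polynomial.aeval (blk a β γ) P) ↔ IsNilpotent (Polynomial.aeval γ P) := by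
  obtain ⟨D, h1, -⟩ := blk_poly a γ P
  have hpow : ∀ k x, ((Polynomial.aeval (blk a β γ) P ^ k) x).2 = (Polynomial.aeval γ P ^ k) x.2 := by
    intro k
    induction k with
    | zero => intro x; simp
    | succ k ih => intro x; rw [pow_succ, pow_succ, Module.End.mul_apply, Module.End.mul_apply, ih, h1]
  constructor
  · rintro ⟨k, hk⟩
    refine ⟨k, ?_⟩
    ext y
    have := hpow k (0, y)
    rw [hk] at this
    simpa using this.symm
  · rintro ⟨k, hk⟩
    refine ⟨k+1, ?_⟩
    apply LinearMap.ext
    intro x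
    rw [pow_succ', Module.End.mul_apply, h1, hpow, hk, ha]
    simp

lemma sum_surj {X Y : Type*} [AddCommGroup X] [AddCommGroup Y] [Fintype X] [Fintype Y] (φ : X →+ Y)
    (hφ : Function.Surjective φ) (f : Y → ℤ) (hf : ∑ y, f y = 0) : ∑ x, f (φ x) = 0 := by
  classical
  rw [← Finset.sum_fiberwise Finset.univ (fun x => φ x)]
  have : ∀ y, ∑ x ∈ Finset.univ.filter (fun x => φ x = y), f (φ x) = (Finset.univ.filter (fun x => φ x = 0)).card * f y := by
    intro y
    rw [Finset.sum_congr rfl (g := fun _ => f y) (fun x hx => by rw [(Finset.mem_filter.1 hx).2]), Finset.sum_const, nsmul_eq_mul]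
    congr 2
    exact AddMonoidHom.card_fiber_eq_of_mem_range φ (hφ y) (hφ 0)
  simp_rw [this, ← Finset.mul_sum, hf, mul_zero]

lemma sum_hom {K : Type*} [Field K] [Finite K] {W A : Type*} [AddCommGroup A] [Module K A] [Finite A]
    [AddCommGroup W] [Module K W] [Finite W] [Fintype (W →ₗ[K] A)] (hA : 1 ≤ Module.finrank K A) (hW : 1 ≤ Module.finrank K W) :
    ∑ M : W →ₗ[K] A, kap (Nat.card K) (Module.finrank K A + Module.finrank K (LinearMap.ker M)) = 0 := by
  classical
  haveI : Fintype K := Fintype.ofFinite K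
  haveI : Fintype A := Fintype.ofFinite A
  haveI : Module.Finite K W := Module.Finite.of_finite
  haveI : Module.Finite K A := Module.Finite.of_finite
  obtain ⟨b, hb⟩ : ∃ b, Module.finrank K W = b + 1 := ⟨Module.finrank K W - 1, by omega⟩
  let bs := Module.finBasisOfFinrankEq K W hb
  rw [← (bs.constr K (M' := A)).toEquiv.sum_comp]
  rw [← sum_tuples (K := K) (A := A) hA b]
  refine Finset.sum_congr rfl fun v _ => ?_
  rw [Nat.card_eq_fintype_card]
  congr 1
  have h1 := LinearMap.finrank_range_add_finrank_ker (bs.constr K (M' := A) v)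
  rw [hb, bs.constr_range] at h1
  simp only [LinearEquiv.coe_toEquiv]
  omega

lemma cusp_blk [Fintype F] [Finite A] [Finite B] [Nontrivial A] [Nontrivial B] [Fintype (B →ₗ[F] A)]
    [FiniteDimensional F A] [FiniteDimensional F B]
    (P : F[X]) (hI : Irreducible P)
    (a : Module.End F A) (γ : Module.End F B) (ha : Polynomial.aeval a P = 0) :
    ∑ β : B →ₗ[F] A, kk (blk a β γ) P = 0 := by
  classical
  haveI : Fact (Irreducible P) := ⟨hI⟩
  by_cases hn : IsNilpotent (Polynomial.aeval γ P)
  swap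
  · refine Finset.sum_eq_zero fun β _ => ?_
    unfold kk
    rw [if_neg]
    rwa [blk_nilp a β γ P ha]
  obtain ⟨D, hD1, hD2⟩ := blk_poly a γ P
  have hd : 0 < P.natDegree := hI.natDegree_pos
  set W := LinearMap.ker (Polynomial.aeval γ P) with hWdef
  have hinv : ∀ v ∈ W, γ v ∈ W := by
    intro v hv
    rw [hWdef, LinearMap.mem_ker] at hv ⊢
    rw [← commute_aeval γ γ γ (fun _ => rfl) P v, hv, map_zero]
  set γ' := γ.restrict hinv with hγ'
  have h0 : Polynomial.aeval γ' P = 0 := by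
    ext v
    have := commute_aeval γ' γ (Submodule.subtype _) (fun _ => rfl) P v
    rw [Submodule.subtype_apply, Submodule.subtype_apply] at this
    rw [this]
    simpa using v.2
  letI := kmod P a ha
  haveI := kmod_tower a ha
  letI := kmod P γ' h0
  haveI := kmod_tower γ' h0
  haveI : Module.Finite F (AdjoinRoot P) := (AdjoinRoot.powerBasis hI.ne_zero).finite
  haveI : Finite (AdjoinRoot P) := Module.finite_of_finite F
  haveI : Finite (W →ₗ[AdjoinRoot P] A) := Finite.of_injective (fun f => (f : W → A)) DFunLike.coe_injective
  haveI : Fintype (W →ₗ[AdjoinRoot P] A) := Fintype.ofFinite _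
  -- commutation
  have hcomm : ∀ β : B →ₗ[F] A, ∀ w ∈ W, D β (γ w) = a (D β w) := by
    intro β w hw
    have h1 := commute_aeval (blk a β γ) (blk a β γ) (blk a β γ) (fun _ => rfl) P (0, w)
    rw [hD1, hD1, blk_apply, blk_apply] at h1
    have h2 := congrArg Prod.fst h1
    rw [hWdef, LinearMap.mem_ker] at hw
    simp only [ha, hw, LinearMap.zero_apply, map_zero, zero_add, add_zero] at h2
    exact h2.symm
  let Φ : (B →ₗ[F] A) →+ (W →ₗ[AdjoinRoot P] A) :=
    { toFun := fun β =>
        { toFun := fun w => D β w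
          map_add' := fun x y => by simp
          map_smul' := by
            intro c w
            obtain ⟨R, rfl⟩ := AdjoinRoot.mk_surjective c
            rw [kmod_mk, RingHom.id_apply, kmod_mk]
            exact commute_aeval γ' a ((D β) ∘ₗ W.subtype) (fun w => hcomm β w w.2) R w }
      map_zero' := by ext w; simp
      map_add' := fun x y => by ext w; simp }
  have hΦ : ∀ β (w : W), Φ β w = D β w := fun _ _ => rfl
  have hsurj : Function.Surjective Φ := by
    intro M
    have hsep : P.Separable := PerfectField.separable_of_irreducible hI
    obtain ⟨u, v, huv⟩ := hsep
    have hv : ∀ x : A, Polynomial.aeval a (Polynomial.derivative P) (Polynomial.aeval a v x) = x := by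
      intro x
      have := congrArg (fun f => Polynomial.aeval a f x) huv
      simp only [map_add, map_mul, ha, mul_zero, zero_add, map_one] at this
      rw [(aev_comm a _ _).eq] at this
      exact this
    obtain ⟨β, hβ⟩ := ((Polynomial.aeval a v) ∘ₗ (M.restrictScalars F)).exists_extend
    have hβ' : ∀ w : W, β w = Polynomial.aeval a v (M w) := fun w => LinearMap.congr_fun hβ w
    refine ⟨β, ?_⟩
    ext w
    rw [hΦ, hD2, hβ', hv]
    intro n
    have h5 : M ((AdjoinRoot.mk P (Polynomial.X ^ n)) • w) = (AdjoinRoot.mk P (Polynomial.X ^ n)) • M w := map_smul _ _ _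
    rw [kmod_mk, kmod_mk, map_pow, map_pow, Polynomial.aeval_X, Polynomial.aeval_X] at h5
    have h6 : ((γ ^ n) (w : B)) = (((γ' ^ n) w : W) : B) := by
      have := commute_aeval γ' γ (Submodule.subtype _) (fun _ => rfl) (Polynomial.X ^ n) w
      simpa using this.symm
    rw [h6, hβ', hβ', h5]
    have := (aev_comm a v (Polynomial.X ^ n)).eq
    rw [map_pow, Polynomial.aeval_X] at this
    exact LinearMap.congr_fun this (M w)
  have hkk : ∀ β, kk (blk a β γ) P = kap (Nat.card (AdjoinRoot P)) (Module.finrank (AdjoinRoot P) A +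
      Module.finrank (AdjoinRoot P) (LinearMap.ker (Φ β))) := by
    intro β
    unfold kk
    rw [if_pos ((blk_nilp a β γ P ha).2 hn), card_adjoinRoot]
    push_cast
    congr 1
    let e : LinearMap.ker (Polynomial.aeval (blk a β γ) P) ≃ₗ[F] A × (LinearMap.ker (Φ β)) :=
      { toFun := fun x => (x.1.1, ⟨⟨x.1.2, by
            have := x.2
            rw [LinearMap.mem_ker, hD1] at this
            exact congrArg Prod.snd this⟩, by
            have := x.2
            rw [LinearMap.mem_ker, hD1] at this
            have := congrArg Prod.fst this
            rw [ha] at this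
            change D β x.1.2 = 0
            simpa using this⟩)
        map_add' := fun x y => rfl
        map_smul' := fun c x => by
          refine Prod.ext rfl ?_
          apply Subtype.ext
          apply Subtype.ext
          simp
        invFun := fun x => ⟨(x.1, x.2.1.1), by
          rw [LinearMap.mem_ker, hD1, ha]
          have h1 : D β x.2.1.1 = 0 := x.2.2
          have h2 : Polynomial.aeval γ P x.2.1.1 = 0 := x.2.1.2
          simp [h1, h2]⟩
        left_inv := fun x => rfl
        right_inv := fun x => rfl }
    rw [e.finrank_eq, Module.finrank_prod, finrank_tower (p := P) (V := A),
      finrank_tower (p := P) (V := LinearMap.ker (Φ β)), ← mul_add, Nat.mul_div_cancel_left _ hd]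
  rw [Finset.sum_congr rfl fun β _ => hkk β]
  refine sum_surj Φ hsurj (fun M => kap (Nat.card (AdjoinRoot P)) (Module.finrank (AdjoinRoot P) A +
      Module.finrank (AdjoinRoot P) (LinearMap.ker M))) ?_
  haveI : Module.Finite (AdjoinRoot P) A := Module.Finite.of_finite
  haveI : Module.Finite (AdjoinRoot P) W := Module.Finite.of_finite
  apply sum_hom
  · exact Module.finrank_pos
  · have h1 := ker_pos γ P hn
    rw [← hWdef, finrank_tower (p := P) (V := W)] at h1
    exact Nat.pos_of_mul_pos_left h1

end
end KL

open scoped BigOperators Polynomial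

namespace KL
section
variable {F : Type*} [Field F] [Fintype F] {V : Type*} [AddCommGroup V] [Module F V] [FiniteDimensional F V] [Finite V]

lemma cusp_sub {A : Type*} [AddCommGroup A] [Module F A] [Finite A] [Nontrivial A] [FiniteDimensional F A]
    [Fintype (Module.End F V)]
    (P : F[X]) (hI : Irreducible P) (a : Module.End F A) (ha : Polynomial.aeval a P = 0)
    (φ : A →ₗ[F] V) (hφ : Function.Injective φ) (hφ' : ¬ Function.Surjective φ)
    [DecidablePred fun g : Module.End F V => ∀ x, φ (a x) = g (φ x)] :
    ∑ g ∈ Finset.univ.filter (fun g : Module.End F V => ∀ x, φ (a x) = g (φ x)), kk g P = 0 := by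
  classical
  obtain ⟨B, hB⟩ := Submodule.exists_isCompl (LinearMap.range φ)
  let e : (A × B) ≃ₗ[F] V := ((LinearEquiv.ofInjective φ hφ).prodCongr (LinearEquiv.refl F B)).trans
    (Submodule.prodEquivOfIsCompl _ _ hB)
  have he : ∀ x : A, e (x, 0) = φ x := by intro x; simp [e]
  haveI : Nontrivial B := by
    rw [Submodule.nontrivial_iff_ne_bot]
    rintro rfl
    apply hφ'
    rw [← LinearMap.range_eq_top]
    have := hB.codisjoint.eq_top
    simpa using this
  haveI : Finite (Module.End F B) := Finite.of_injective (fun f => (f : B → B)) DFunLike.coe_injective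
  haveI : Fintype (Module.End F B) := Fintype.ofFinite _
  haveI : Finite (B →ₗ[F] A) := Finite.of_injective (fun f => (f : B → A)) DFunLike.coe_injective
  haveI : Fintype (B →ₗ[F] A) := Fintype.ofFinite _
  have h1 : ∑ γ : Module.End F B, ∑ β : B →ₗ[F] A, kk (blk a β γ) P = 0 :=
    Finset.sum_eq_zero fun γ _ => cusp_blk P hI a γ ha
  rw [← Fintype.sum_prod_type'] at h1
  rw [← h1]
  symm
  refine Finset.sum_bij' (fun x _ => e.conj (blk a x.2 x.1))
    (fun g _ => ((LinearMap.snd F A B) ∘ₗ (e.symm.conj g) ∘ₗ LinearMap.inr F A B,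
      (LinearMap.fst F A B) ∘ₗ (e.symm.conj g) ∘ₗ LinearMap.inr F A B)) ?_ ?_ ?_ ?_ ?_
  · intro x _
    rw [Finset.mem_filter]
    refine ⟨Finset.mem_univ _, fun y => ?_⟩
    rw [← he, ← he, LinearEquiv.conj_apply]
    simp [blk_apply]
  · intro g _; exact Finset.mem_univ _
  · rintro ⟨γ, β⟩ _
    refine Prod.ext ?_ ?_
    · ext y; simp [LinearEquiv.conj_apply, blk_apply]
    · ext y; simp [LinearEquiv.conj_apply, blk_apply]
  · intro g hg
    have hg := (Finset.mem_filter.1 hg).2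
    apply LinearMap.ext
    intro v
    obtain ⟨⟨x, y⟩, rfl⟩ := e.surjective v
    have h2 : (x, y) = (x, (0 : B)) + (0, y) := by simp
    have h3 : g (e (x, 0)) = e (a x, 0) := by rw [he, he, hg]
    have h4 : g (e (0, y)) = e (e.symm (g (e (0, y)))) := by simp
    rw [LinearEquiv.conj_apply]
    simp only [LinearMap.comp_apply, LinearEquiv.coe_coe, LinearEquiv.symm_apply_apply]
    rw [h2, map_add e, map_add g, h3, h4, ← map_add e]
    congr 1
    simp only [blk_apply, LinearEquiv.conj_apply]
    refine Prod.ext ?_ ?_ <;> simp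
  · intro x _
    rw [kk_conj]

section norm
variable (P : F[X]) [hp : Fact (Irreducible P)]

/-- multiplication by the root -/
noncomputable def mx (j : ℕ) : Module.End F (Fin j → AdjoinRoot P) := Algebra.lsmul F F _ (AdjoinRoot.root P)

lemma mx_aeval (j : ℕ) : Polynomial.aeval (mx P j) P = 0 := by
  unfold mx
  rw [Polynomial.aeval_algHom_apply, AdjoinRoot.aeval_eq, AdjoinRoot.mk_self, map_zero]

lemma fin_adj : Finite (AdjoinRoot P) := by
  haveI : Module.Finite F (AdjoinRoot P) := (AdjoinRoot.powerBasis hp.out.ne_zero).finite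
  exact Module.finite_of_finite F

lemma finrank_mx (j : ℕ) : Module.finrank F (Fin j → AdjoinRoot P) = j * P.natDegree := by
  rw [finrank_tower (p := P), Module.finrank_fin_fun, mul_comm]

lemma count_emb (g : Module.End F V) (j : ℕ) :
    (Nat.card {φ : (Fin j → AdjoinRoot P) →ₗ[F] V // (∀ v, φ (mx P j v) = g (φ v)) ∧ Function.Injective φ} : ℤ) =
      ∏ i ∈ Finset.range j, ((((Fintype.card F : ℤ) ^ P.natDegree) ^
        (Module.finrank F (LinearMap.ker (Polynomial.aeval g P)) / P.natDegree)) - ((Fintype.card F : ℤ) ^ P.natDegree) ^ i) := by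
  haveI := fin_adj P
  set W := LinearMap.ker (Polynomial.aeval g P) with hWdef
  have hinv : ∀ v ∈ W, g v ∈ W := by
    intro v hv
    rw [hWdef, LinearMap.mem_ker] at hv ⊢
    rw [← commute_aeval g g g (fun _ => rfl) P v, hv, map_zero]
  set g' := g.restrict hinv with hg'
  have h0 : Polynomial.aeval g' P = 0 := by
    ext v
    have := commute_aeval g' g (Submodule.subtype _) (fun _ => rfl) P v
    rw [Submodule.subtype_apply, Submodule.subtype_apply] at this
    rw [this]
    simpa using v.2
  have h := count_comm (p := P) (mx P j) (mx_aeval P j) g' h0 ⊤ (fun _ _ => trivial)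
  have hd : 0 < P.natDegree := hp.out.natDegree_pos
  rw [finrank_top, Nat.sub_self, Nat.zero_div, pow_zero, one_mul, finrank_mx, Nat.mul_div_cancel _ hd] at h
  have hW : (Nat.card W : ℤ) = ((Fintype.card F : ℤ) ^ P.natDegree) ^ (Module.finrank F W / P.natDegree) := by
    rw [Module.natCard_eq_pow_finrank (K := F), Nat.card_eq_fintype_card, ← pow_mul,
      Nat.mul_div_cancel' (ker_dvd g P hp.out)]
    push_cast; rfl
  rw [hW] at h
  rw [← h]
  congr 1
  refine Nat.card_congr
    { toFun := fun φ => ⟨φ.1.codRestrict W fun v => ?_, ?_, ?_⟩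
      invFun := fun φ => ⟨W.subtype ∘ₗ φ.1, ?_, ?_⟩
      left_inv := fun _ => rfl
      right_inv := fun _ => rfl }
  · rw [hWdef, LinearMap.mem_ker, ← commute_aeval (mx P j) g φ.1 φ.2.1 P v, mx_aeval]
    simp
  · intro v; apply Subtype.ext; exact φ.2.1 v
  · intro w _ hw
    apply φ.2.2
    rw [map_zero]
    exact congrArg Subtype.val hw
  · intro v
    exact congrArg Subtype.val (φ.2.1 v)
  · apply Function.Injective.comp W.injective_subtype
    rw [injective_iff_map_eq_zero]
    intro w hw
    exact φ.2.2 w trivial hw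

lemma kk_expand [Nontrivial V] (g : Module.End F V) (hn : IsNilpotent (Polynomial.aeval g P)) :
    (kk g P : ℚ) = ∑ j ∈ Finset.range (Module.finrank F V / P.natDegree + 1),
      coefj (((Fintype.card F : ℤ) ^ P.natDegree : ℤ) : ℚ) j *
      (Nat.card {φ : (Fin j → AdjoinRoot P) →ₗ[F] V // (∀ v, φ (mx P j v) = g (φ v)) ∧ Function.Injective φ} : ℚ) := by
  have hd : 0 < P.natDegree := hp.out.natDegree_pos
  unfold kk
  rw [if_pos hn, kap_expand _ _ (Module.finrank F V / P.natDegree)]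
  · refine Finset.sum_congr rfl fun j _ => ?_
    rw [← count_emb]
    push_cast; rfl
  · obtain ⟨c, hc⟩ := ker_dvd g P hp.out
    have := ker_pos g P hn
    rw [hc] at this ⊢
    rw [Nat.mul_div_cancel_left _ hd]
    exact Nat.pos_of_mul_pos_left this
  · exact Nat.div_le_div_right (Submodule.finrank_le _)
  · exact one_lt_pow₀ (by exact_mod_cast Fintype.one_lt_card) hd.ne'

lemma kk_norm [Nontrivial V] [Fintype (Module.End F V)] (hdvd : P.natDegree ∣ Module.finrank F V) :
    ((Fintype.card F : ℚ) ^ Module.finrank F V - 1) * ∑ g : Module.End F V, (kk g P : ℚ) * kk g P =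
      (Module.finrank F V / P.natDegree : ℕ) * (Nat.card (V ≃ₗ[F] V) : ℚ) := by
  classical
  haveI := fin_adj P
  have hd : 0 < P.natDegree := hp.out.natDegree_pos
  set m := Module.finrank F V / P.natDegree with hm
  have hmd : m * P.natDegree = Module.finrank F V := Nat.div_mul_cancel hdvd
  have hV : 0 < Module.finrank F V := Module.finrank_pos
  have hm1 : 1 ≤ m := by
    rcases Nat.eq_zero_or_pos m with h | h
    · rw [h] at hmd; omega
    · exact h
  haveI hfin : ∀ j, Finite ((Fin j → AdjoinRoot P) →ₗ[F] V) := fun j =>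
    Finite.of_injective (fun f => (f : (Fin j → AdjoinRoot P) → V)) DFunLike.coe_injective
  haveI hft : ∀ j, Fintype ((Fin j → AdjoinRoot P) →ₗ[F] V) := fun j => Fintype.ofFinite _
  set Q : ℤ := (Fintype.card F : ℤ) ^ P.natDegree with hQ
  have hQ1 : 1 < Q := one_lt_pow₀ (by exact_mod_cast Fintype.one_lt_card) hd.ne'
  have h1 : ∀ g : Module.End F V, (kk g P : ℚ) * kk g P = ∑ j ∈ Finset.range (m+1), coefj (Q : ℚ) j *
      ∑ φ : (Fin j → AdjoinRoot P) →ₗ[F] V, if Function.Injective φ then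
        (if ∀ v, φ (mx P j v) = g (φ v) then (kk g P : ℚ) else 0) else 0 := by
    intro g
    by_cases hn : IsNilpotent (Polynomial.aeval g P)
    · nth_rewrite 1 [kk_expand P g hn]
      rw [Finset.sum_mul]
      refine Finset.sum_congr rfl fun j _ => ?_
      rw [mul_assoc]
      congr 1
      rw [Nat.card_eq_fintype_card, Fintype.card_subtype, ← Finset.sum_filter, ← Finset.sum_filter, Finset.sum_const,
        Finset.filter_filter, nsmul_eq_mul]
      congr 3
      ext φ; simp [and_comm]
    · have : kk g P = 0 := by unfold kk; rw [if_neg hn]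
      simp [this]
  simp_rw [h1]
  rw [Finset.sum_comm]
  simp_rw [← Finset.mul_sum]
  have h2 : ∀ j, ∑ g : Module.End F V, ∑ φ : (Fin j → AdjoinRoot P) →ₗ[F] V, (if Function.Injective φ then
        (if ∀ v, φ (mx P j v) = g (φ v) then (kk g P : ℚ) else 0) else 0) =
      ∑ φ : (Fin j → AdjoinRoot P) →ₗ[F] V, if Function.Injective φ then
        ∑ g ∈ Finset.univ.filter (fun g : Module.End F V => ∀ v, φ (mx P j v) = g (φ v)), (kk g P : ℚ) else 0 := by
    intro j
    rw [Finset.sum_comm]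
    refine Finset.sum_congr rfl fun φ _ => ?_
    split_ifs with h
    · rw [Finset.sum_filter]
    · simp
  simp_rw [h2]
  rw [Finset.sum_eq_single_of_mem m (Finset.mem_range.2 (Nat.lt_succ_self m))]
  · have hfr : Module.finrank F (Fin m → AdjoinRoot P) = Module.finrank F V := by rw [finrank_mx, hmd]
    have h3 : ∀ φ : (Fin m → AdjoinRoot P) →ₗ[F] V, (if Function.Injective φ then
        ∑ g ∈ Finset.univ.filter (fun g : Module.End F V => ∀ v, φ (mx P m v) = g (φ v)), (kk g P : ℚ) else 0) =
        if Function.Injective φ then (kap Q m : ℚ) else 0 := by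
      intro φ
      split_ifs with h
      · let e : (Fin m → AdjoinRoot P) ≃ₗ[F] V := LinearEquiv.ofInjectiveOfFinrankEq φ h hfr
        have he : ∀ v, e v = φ v := fun v => rfl
        rw [Finset.sum_eq_single (e.conj (mx P m))]
        · rw [kk_conj]
          unfold kk
          rw [mx_aeval, if_pos IsNilpotent.zero, LinearMap.ker_zero, finrank_top, hfr]
        · intro g hg hne
          exfalso; apply hne
          apply LinearMap.ext
          intro v
          obtain ⟨w, rfl⟩ := e.surjective v
          have := (Finset.mem_filter.1 hg).2 w
          rw [LinearEquiv.conj_apply]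
          simp only [LinearMap.comp_apply, LinearEquiv.coe_coe, LinearEquiv.symm_apply_apply]
          rw [he, he, this]
        · intro hh
          exfalso; apply hh
          rw [Finset.mem_filter]
          refine ⟨Finset.mem_univ _, fun v => ?_⟩
          rw [LinearEquiv.conj_apply, ← he, ← he]
          simp
      · rfl
    rw [Finset.sum_congr rfl fun φ _ => h3 φ, ← Finset.sum_filter, Finset.sum_const, nsmul_eq_mul]
    have h4 : (Finset.univ.filter fun φ : (Fin m → AdjoinRoot P) →ₗ[F] V => Function.Injective φ).card = Nat.card (V ≃ₗ[F] V) := by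
      let e0 : (Fin m → AdjoinRoot P) ≃ₗ[F] V := LinearEquiv.ofFinrankEq _ _ hfr
      rw [← Fintype.card_subtype, ← Nat.card_eq_fintype_card]
      exact Nat.card_congr
        { toFun := fun φ => e0.symm.trans (LinearEquiv.ofInjectiveOfFinrankEq φ.1 φ.2 hfr)
          invFun := fun e => ⟨(e0.trans e).toLinearMap, (e0.trans e).injective⟩
          left_inv := fun φ => by apply Subtype.ext; apply LinearMap.ext; intro v; simp; rfl
          right_inv := fun e => by apply LinearEquiv.ext; intro v; simp; exact congrArg e (e0.apply_symm_apply v) }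
    rw [h4]
    have h5 := coefj_top Q hQ1 m hm1
    have h6 : (Q : ℚ) ^ m = (Fintype.card F : ℚ) ^ Module.finrank F V := by
      rw [hQ, ← hmd, mul_comm m, pow_mul]; push_cast; rfl
    rw [h6] at h5
    have h7 : (Fintype.card F : ℚ) ^ Module.finrank F V - 1 ≠ 0 := by
      have : (1 : ℚ) < (Fintype.card F : ℚ) ^ Module.finrank F V :=
        one_lt_pow₀ (by exact_mod_cast Fintype.one_lt_card) hV.ne'
      linarith
    rw [eq_div_iff h7] at h5
    linear_combination (Nat.card (V ≃ₗ[F] V) : ℚ) * h5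
  · intro j hj hjm
    have hjlt : j < m := by have := Finset.mem_range.1 hj; omega
    rcases Nat.eq_zero_or_pos j with rfl | hj0
    · have : coefj (Q : ℚ) 0 = 0 := by simp [coefj]
      rw [this, zero_mul]
    · rw [Finset.sum_eq_zero, mul_zero]
      intro φ _
      split_ifs with h
      · haveI : Nonempty (Fin j) := ⟨⟨0, hj0⟩⟩
        haveI : Nontrivial (AdjoinRoot P) := inferInstance
        haveI : Module.Finite F (Fin j → AdjoinRoot P) := Module.Finite.of_finite
        have := cusp_sub P hp.out (mx P j) (mx_aeval P j) φ h (by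
          intro hs
          have h8 := (LinearEquiv.ofBijective φ ⟨h, hs⟩).finrank_eq
          rw [finrank_mx, ← hmd] at h8
          exact hjlt.ne (Nat.eq_of_mul_eq_mul_right hd h8))
        exact_mod_cast this
      · rfl
end norm
end
end KL

open scoped BigOperators Polynomial

namespace KL
section
variable {F : Type*} [Field F] [Fintype F] {E : Type*} [Field E] [Algebra F E] [Fintype E] [FiniteDimensional F E]
variable {V : Type*} [AddCommGroup V] [Module F V] [FiniteDimensional F V] [Finite V]

/-- the class function attached to a function on E -/
noncomputable def cc (h : E → ℂ) (g : Module.End F V) : ℂ := ∑ ξ : E, h ξ * (kk g (minpoly F ξ) : ℂ)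

lemma orbit_sum [Fintype (E ≃ₐ[F] E)] (ξ : E) (f : E → ℂ) [DecidableEq F[X]] :
    ((Module.finrank F E / (minpoly F ξ).natDegree : ℕ) : ℂ) *
      ∑ ξ' : E, (if minpoly F ξ = minpoly F ξ' then f ξ' else 0) = ∑ σ : E ≃ₐ[F] E, f (σ ξ) := by
  classical
  haveI : IsGalois F E := inferInstance
  rw [← Finset.sum_fiberwise Finset.univ (fun σ : E ≃ₐ[F] E => σ ξ), Finset.mul_sum]
  refine Finset.sum_congr rfl fun ξ' _ => ?_
  rw [Finset.sum_congr rfl (g := fun _ => f ξ') (fun x hx => by rw [(Finset.mem_filter.1 hx).2]), Finset.sum_const, nsmul_eq_mul]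
  split_ifs with h
  · congr 2
    have h' := (Normal.minpoly_eq_iff_mem_orbit E).1 h
    obtain ⟨τ, hτ⟩ := h'
    have hτ : τ ξ' = ξ := hτ
    have h1 := IsGalois.card_fixingSubgroup_eq_finrank (F := F) (E := E) (IntermediateField.adjoin F {ξ})
    have h2 := Module.finrank_mul_finrank F (IntermediateField.adjoin F {ξ}) E
    have h_intg : IsIntegral F ξ := Algebra.IsIntegral.isIntegral ξ
    rw [IntermediateField.adjoin.finrank h_intg] at h2
    rw [← h2, Nat.mul_div_cancel_left _ (minpoly.natDegree_pos h_intg), ← h1, ← Fintype.card_subtype,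
      ← Nat.card_eq_fintype_card]
    refine Nat.card_congr
      { toFun := fun σ => ⟨τ⁻¹ * σ.1, ?_⟩
        invFun := fun σ => ⟨τ * σ.1, ?_⟩
        left_inv := fun σ => by simp
        right_inv := fun σ => by simp }
    · have h3 : σ.1 ξ = ξ := by
        have := (IntermediateField.forall_mem_adjoin_smul_eq_self_iff F (S := {ξ}) σ.1).1 
          ((IntermediateField.mem_fixingSubgroup_iff _ _).1 σ.2)
        simpa using this
      change τ⁻¹ (σ.1 ξ) = ξ'
      rw [h3, ← hτ]; exact τ.symm_apply_apply ξ'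
    · have h3 : (τ * σ.1) ξ = ξ := by
        change τ (σ.1 ξ) = ξ
        rw [σ.2, hτ]
      rw [IntermediateField.mem_fixingSubgroup_iff]
      refine (IntermediateField.forall_mem_adjoin_smul_eq_self_iff F (S := {ξ}) (τ * σ.1)).2 ?_
      simpa using h3
  · rw [Finset.card_eq_zero.2, mul_zero, Nat.cast_zero, zero_mul]
    rw [Finset.filter_eq_empty_iff]
    intro σ _ hσ
    apply h
    rw [← hσ, minpoly.algEquiv_eq]

lemma kk_cross [Nontrivial V] (hV : Module.finrank F V = Module.finrank F E) (g : Module.End F V) (ξ ξ' : E) (h : minpoly F ξ ≠ minpoly F ξ') :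
    kk g (minpoly F ξ) * kk g (minpoly F ξ') = 0 := by
  by_contra hne
  have h1 := kk_ne_zero (left_ne_zero_of_mul hne)
  have h2 := kk_ne_zero (right_ne_zero_of_mul hne)
  have h_intg : ∀ x : E, IsIntegral F x := fun x => Algebra.IsIntegral.isIntegral x
  apply h
  have h3 := charpoly_of_nilp g _ (minpoly.monic (h_intg ξ)) (minpoly.irreducible (h_intg ξ)) h1
  have h4 := charpoly_of_nilp g _ (minpoly.monic (h_intg ξ')) (minpoly.irreducible (h_intg ξ')) h2
  have h5 : minpoly F ξ ∣ minpoly F ξ' ^ (Module.finrank F V / (minpoly F ξ').natDegree) := by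
    rw [← h4, h3]
    apply dvd_pow_self
    have hd := minpoly.natDegree_le (A := F) ξ
    rw [← hV] at hd
    exact (Nat.div_pos hd (minpoly.natDegree_pos (h_intg ξ))).ne'
  have h6 := (minpoly.irreducible (h_intg ξ)).prime.dvd_of_dvd_pow h5
  exact Polynomial.eq_of_monic_of_associated (minpoly.monic (h_intg ξ)) (minpoly.monic (h_intg ξ'))
    ((minpoly.irreducible (h_intg ξ)).associated_of_dvd (minpoly.irreducible (h_intg ξ')) h6)

lemma minpoly_deg_dvd (ξ : E) : (minpoly F ξ).natDegree ∣ Module.finrank F E :=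
  minpoly.degree_dvd (Algebra.IsIntegral.isIntegral ξ)

lemma cc_norm [Nontrivial V] [Fintype (Module.End F V)] (hV : Module.finrank F V = Module.finrank F E)
    (θ : MulChar E ℂ) (hθ : ∀ σ : E ≃ₐ[F] E, σ ≠ 1 → ∃ x : Eˣ, θ (σ x) ≠ θ x) :
    ∑ g : Module.End F V, cc (F := F) θ g * (starRingEnd ℂ) (cc (F := F) θ g) = Nat.card (V ≃ₗ[F] V) := by
  classical
  haveI : Fintype (E ≃ₐ[F] E) := Fintype.ofFinite _
  set n := Module.finrank F V with hn
  set q : ℂ := (Fintype.card F : ℂ) with hq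
  have hq1 : q ^ n - 1 ≠ 0 := by
    have h1 : 1 < Fintype.card F ^ n := Nat.one_lt_pow (by rw [hn]; exact Module.finrank_pos.ne') Fintype.one_lt_card
    have h2 : ((Fintype.card F ^ n : ℕ) : ℂ) ≠ ((1 : ℕ) : ℂ) := by
      rw [Ne, Nat.cast_inj]; omega
    rw [sub_ne_zero]; push_cast at h2; exact h2
  have hE : (Fintype.card E : ℂ) = q ^ n := by
    rw [Module.card_eq_pow_finrank (K := F) (V := E), ← hV]; push_cast; rfl
  have hinner : ∀ ξ ξ' : E, (q ^ n - 1) * ∑ g : Module.End F V, (kk g (minpoly F ξ) : ℂ) * (kk g (minpoly F ξ') : ℂ) =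
      if minpoly F ξ = minpoly F ξ' then ((n / (minpoly F ξ).natDegree : ℕ) : ℂ) * Nat.card (V ≃ₗ[F] V) else 0 := by
    intro ξ ξ'
    split_ifs with h
    · rw [← h]
      haveI : Fact (Irreducible (minpoly F ξ)) := ⟨minpoly.irreducible (Algebra.IsIntegral.isIntegral ξ)⟩
      have h1 := kk_norm (V := V) (minpoly F ξ) (by rw [← hn, hV]; exact minpoly_deg_dvd ξ)
      have h2 := congrArg (fun x : ℚ => (x : ℂ)) h1
      push_cast at h2
      exact h2
    · rw [Finset.sum_eq_zero, mul_zero]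
      intro g _
      have := kk_cross hV g ξ ξ' h
      exact_mod_cast this
  have key : (q ^ n - 1) * ∑ g : Module.End F V, cc (F := F) θ g * (starRingEnd ℂ) (cc (F := F) θ g) =
      Nat.card (V ≃ₗ[F] V) * ∑ ξ : E, ∑ σ : E ≃ₐ[F] E, θ ξ * θ⁻¹ (σ ξ) := by
    have h1 : ∀ g : Module.End F V, cc (F := F) θ g * (starRingEnd ℂ) (cc (F := F) θ g) = ∑ ξ : E, ∑ ξ' : E,
        θ ξ * θ⁻¹ ξ' * ((kk g (minpoly F ξ) : ℂ) * (kk g (minpoly F ξ') : ℂ)) := by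
      intro g
      unfold cc
      rw [map_sum, Finset.sum_mul_sum]
      refine Finset.sum_congr rfl fun ξ _ => Finset.sum_congr rfl fun ξ' _ => ?_
      have : (starRingEnd ℂ) (θ ξ') = θ⁻¹ ξ' := MulChar.star_apply' θ ξ'
      rw [map_mul, this, map_intCast]; ring
    simp_rw [h1]
    rw [Finset.sum_comm, Finset.mul_sum, Finset.mul_sum]
    refine Finset.sum_congr rfl fun ξ _ => ?_
    rw [Finset.sum_comm, Finset.mul_sum]
    have h2 := orbit_sum (F := F) ξ (fun ξ' => θ ξ * θ⁻¹ ξ')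
    rw [← h2, Finset.mul_sum, Finset.mul_sum]
    refine Finset.sum_congr rfl fun ξ' _ => ?_
    rw [← Finset.mul_sum, mul_left_comm, hinner]
    split_ifs
    · rw [← hV]; ring
    · simp
  rw [Finset.sum_comm, Finset.sum_eq_single (1 : E ≃ₐ[F] E)] at key
  · have h3 : ∑ ξ : E, θ ξ * θ⁻¹ ((1 : E ≃ₐ[F] E) ξ) = q ^ n - 1 := by
      have h4 : ∀ ξ : E, θ ξ * θ⁻¹ ((1 : E ≃ₐ[F] E) ξ) = (1 : MulChar E ℂ) ξ := by
        intro ξ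
        rw [AlgEquiv.one_apply, ← MulChar.mul_apply, mul_inv_cancel]
      rw [Finset.sum_congr rfl fun ξ _ => h4 ξ, MulChar.sum_one_eq_card_units, Fintype.card_units, Nat.cast_sub Fintype.card_pos, hE]
      simp
    rw [h3, mul_comm] at key
    exact mul_right_cancel₀ hq1 key
  · intro σ _ hσ
    obtain ⟨x, hx⟩ := hθ σ hσ
    let χ : MulChar E ℂ := MulChar.ofUnitHom (MulChar.toUnitHom θ * (MulChar.toUnitHom θ⁻¹).comp (Units.map (σ : E →* E)))
    have hχ : ∀ ξ : E, θ ξ * θ⁻¹ (σ ξ) = χ ξ := by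
      intro ξ
      by_cases h0 : ξ = 0
      · subst h0; rw [MulChar.map_zero, MulChar.map_zero, zero_mul]
      · lift ξ to Eˣ using IsUnit.mk0 ξ h0
        simp only [χ, MulChar.ofUnitHom_coe]
        rw [MonoidHom.mul_apply, Units.val_mul, MonoidHom.comp_apply, MulChar.coe_toUnitHom, MulChar.coe_toUnitHom]
        rfl
    rw [Finset.sum_congr rfl fun ξ _ => hχ ξ]
    apply MulChar.sum_eq_zero_of_ne_one
    intro h1
    have h2 := hχ x
    rw [h1, MulChar.one_apply_coe, MulChar.inv_apply_eq_inv'] at h2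
    apply hx
    have h3 : θ (σ x) ≠ 0 := by
      intro h0; rw [h0] at h2; simp at h2
    field_simp at h2
    exact h2.symm
  · intro h; exact absurd (Finset.mem_univ _) h
end
end KL

open scoped BigOperators Polynomial

namespace KL
section
variable {F : Type*} [Field F] [Fintype F]
variable {V : Type*} [AddCommGroup V] [Module F V] [FiniteDimensional F V] [Finite V]
variable {L : Type*} [Field L] [Algebra F L] [Finite L] [FiniteDimensional F L]

lemma aeval_frob (g : Module.End F V) (P : F[X]) (a : ℕ) :
    Polynomial.aeval (g ^ (Fintype.card F ^ a)) P = (Polynomial.aeval g P) ^ (Fintype.card F ^ a) := by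
  induction a with
  | zero => simp
  | succ a ih =>
    rw [pow_succ, pow_mul, pow_mul, ← ih, ← map_pow, ← FiniteField.expand_card, Polynomial.expand_aeval]

open Classical in
lemma count_E (g : Module.End F V) (t : L) (a : ℕ) (ha : Module.finrank F V ≤ Fintype.card F ^ a)
    (ht : t ^ (Fintype.card F ^ a) = t) :
    (Nat.card {φ : V →ₗ[F] L // (∀ v, φ ((g ^ (Fintype.card F ^ a)) v) = t * φ v) ∧
      ∀ v, (∀ k : ℕ, φ ((g ^ k) v) = 0) → v = 0} : ℤ) =
    if IsNilpotent (Polynomial.aeval g (minpoly F t)) then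
      (Nat.card L : ℤ) ^ ((Module.finrank F V - Module.finrank F (LinearMap.ker (Polynomial.aeval g (minpoly F t)))) /
        (minpoly F t).natDegree) *
      ∏ i ∈ Finset.range (Module.finrank F (LinearMap.ker (Polynomial.aeval g (minpoly F t))) / (minpoly F t).natDegree),
        ((Nat.card L : ℤ) - ((Fintype.card F : ℤ) ^ (minpoly F t).natDegree) ^ i) else 0 := by
  have h_intg : IsIntegral F t := Algebra.IsIntegral.isIntegral t
  set P := minpoly F t with hP
  haveI : Fact (Irreducible P) := ⟨minpoly.irreducible h_intg⟩
  set N := Fintype.card F ^ a with hN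
  set s := g ^ N with hs
  have htl : Polynomial.aeval (Algebra.lmul F L t) P = 0 := by
    rw [Polynomial.aeval_algHom_apply, hP, minpoly.aeval, map_zero]
  have hgs : ∀ R : F[X], ∀ v, Polynomial.aeval s R (g v) = g (Polynomial.aeval s R v) := fun R v => by
    rw [commute_aeval s s g (fun v => by rw [hs, ← Module.End.mul_apply, ← Module.End.mul_apply, ← pow_succ, ← pow_succ'])]
  split_ifs with hn
  · have h1 : Polynomial.aeval s P = 0 := by
      rw [hs, hN, aeval_frob]
      have h2 := charpoly_of_nilp g P (minpoly.monic h_intg) (minpoly.irreducible h_intg) hn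
      have h3 := LinearMap.aeval_self_charpoly g
      rw [h2, map_pow] at h3
      exact pow_eq_zero_of_le ((Nat.div_le_self _ _).trans ha) h3
    set W := LinearMap.ker (Polynomial.aeval g P) with hWdef
    have hWg : ∀ w ∈ W, g w ∈ W := by
      intro v hv
      rw [hWdef, LinearMap.mem_ker] at hv ⊢
      rw [← commute_aeval g g g (fun _ => rfl) P v, hv, map_zero]
    have hWs : ∀ w ∈ W, s w = g w := by
      intro w hw
      have : P ∣ Polynomial.X ^ N - Polynomial.X := by
        apply minpoly.dvd
        simp [ht]
      obtain ⟨R, hR⟩ := this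
      have h4 := congrArg (fun f => Polynomial.aeval g f w) hR
      rw [hWdef, LinearMap.mem_ker] at hw
      simp only [map_sub, map_pow, Polynomial.aeval_X, LinearMap.sub_apply] at h4
      rw [mul_comm, map_mul, Module.End.mul_apply, hw, map_zero] at h4
      exact sub_eq_zero.1 h4
    have hc := count_comm (p := P) s h1 (Algebra.lmul F L t) htl W (fun w hw => by rw [hWs w hw]; exact hWg w hw)
    rw [← hc]
    congr 1
    refine Nat.card_congr (Equiv.subtypeEquivRight fun φ => ?_)
    constructor
    · rintro ⟨h5, h6⟩
      refine ⟨h5, fun w hw hφ => h6 w ?_⟩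
      have : ∀ k, (g ^ k) w ∈ W ∧ φ ((g ^ k) w) = 0 := by
        intro k
        induction k with
        | zero => exact ⟨by simpa using hw, by simpa using hφ⟩
        | succ k ih =>
          rw [pow_succ', Module.End.mul_apply]
          refine ⟨hWg _ ih.1, ?_⟩
          rw [← hWs _ ih.1, h5, ih.2, mul_zero]
      exact fun k => (this k).2
    · rintro ⟨h5, h6⟩
      refine ⟨h5, ?_⟩
      obtain ⟨i, hi⟩ := hn
      have hJ : ∀ v, (∀ k : ℕ, φ ((g ^ k) v) = 0) → ∀ R : F[X], φ (Polynomial.aeval g R v) = 0 := by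
        intro v hv R
        rw [Polynomial.aeval_eq_sum_range, LinearMap.sum_apply, map_sum]
        refine Finset.sum_eq_zero fun k _ => ?_
        rw [LinearMap.smul_apply, map_smul, hv, smul_zero]
      have : ∀ i, ∀ v, (∀ k : ℕ, φ ((g ^ k) v) = 0) → (Polynomial.aeval g P ^ i) v = 0 → v = 0 := by
        intro i
        induction i with
        | zero => intro v _ hv; simpa using hv
        | succ i ih =>
          intro v hv hv'
          rw [pow_succ, Module.End.mul_apply] at hv'
          have h7 := ih (Polynomial.aeval g P v) (fun k => by
            have := hJ v hv (Polynomial.X ^ k * P)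
            rwa [map_mul, map_pow, Polynomial.aeval_X, Module.End.mul_apply] at this) hv'
          exact h6 v h7 (by simpa using hv 0)
      intro v hv
      exact this i v hv (by rw [hi]; rfl)
  · rw [Nat.cast_eq_zero, Nat.card_eq_zero]
    left
    refine ⟨fun φ => hn ⟨N, ?_⟩⟩
    obtain ⟨φ, h5, h6⟩ := φ
    rw [hN, ← aeval_frob]
    apply LinearMap.ext
    intro v
    refine h6 _ fun k => ?_
    have hk : ∀ k v, (g ^ k) (Polynomial.aeval s P v) = Polynomial.aeval s P ((g ^ k) v) := by
      intro k
      induction k with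
      | zero => intro v; rfl
      | succ k ih => intro v; rw [pow_succ, Module.End.mul_apply, Module.End.mul_apply, ← hgs, ih]
    rw [← hN, ← hs, hk, commute_aeval s (Algebra.lmul F L t) φ h5, htl]
    rfl

/-- fixed points of a twisted shift -/
lemma cyc_fix {α : Type*} (T : α → α) (N : ℕ) [NeZero N] (p : (ℕ → α) → Prop) :
    Nat.card {X : ZMod N → α // (∀ i, X (i + 1) = T (X i)) ∧ p (fun k => X (k : ZMod N))} =
    Nat.card {x : α // T^[N] x = x ∧ p (fun k => T^[k] x)} := by
  have hX : ∀ X : ZMod N → α, (∀ i, X (i + 1) = T (X i)) → ∀ k : ℕ, X (k : ZMod N) = T^[k] (X 0) := by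
    intro X h k
    induction k with
    | zero => simp
    | succ k ih => rw [Nat.cast_succ, h, ih, Function.iterate_succ_apply']
  have hT : ∀ x, T^[N] x = x → ∀ k : ℕ, T^[((k : ZMod N)).val] x = T^[k] x := by
    intro x hx k
    rw [ZMod.val_natCast]
    exact Function.IsPeriodicPt.iterate_mod_apply hx k
  refine Nat.card_congr
    { toFun := fun X => ⟨X.1 0, ?_, ?_⟩
      invFun := fun x => ⟨fun i => T^[i.val] x.1, ?_, ?_⟩
      left_inv := ?_
      right_inv := ?_ }
  · rw [← hX X.1 X.2.1 N]; simp
  · have := X.2.2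
    simp_rw [hX X.1 X.2.1] at this
    exact this
  · intro i
    have : i + 1 = ((i.val + 1 : ℕ) : ZMod N) := by simp
    change T^[(i + 1).val] x.1 = T (T^[i.val] x.1)
    rw [this, hT x.1 x.2.1, Function.iterate_succ_apply']
  · simp_rw [hT x.1 x.2.1]
    exact x.2.2
  · intro X
    apply Subtype.ext
    funext i
    have := hX X.1 X.2.1 i.val
    simp only
    rw [← this]; simp
  · intro x
    apply Subtype.ext
    simp
end
end KL

open scoped BigOperators Polynomial

namespace KL
section
lemma trace_integral {κ : Type*} [Fintype κ] [DecidableEq κ] (U : Matrix κ κ ℂ) (m : ℕ) (hm : m ≠ 0)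
    (hU : U ^ m = 1) : IsIntegral ℤ U.trace := by
  have hζ := Complex.isPrimitiveRoot_exp m hm
  obtain ⟨r, hr⟩ := finite_order_trace U 1 m hm hU (by simp) (Commute.one_left _) _ hζ
  have h := hr 1
  rw [one_mul, pow_one] at h
  rw [h]
  refine IsIntegral.sum _ fun j _ => IsIntegral.mul ?_ ?_
  · first
    | exact isIntegral_natCast _
    | exact isIntegral_intCast _
  · exact (hζ.isIntegral (Nat.pos_of_ne_zero hm)).pow _

lemma integral_of_pow {z : ℂ} (m : ℕ) (hm : m ≠ 0) (h : z ^ m = 1) : IsIntegral ℤ z :=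
  ⟨Polynomial.X ^ m - 1, Polynomial.monic_X_pow_sub_C 1 hm, by simp [h]⟩

variable {F : Type*} [Field F] [Fintype F]
variable {V : Type*} [AddCommGroup V] [Module F V] [FiniteDimensional F V] [Finite V]
variable {L : Type*} [Field L] [Algebra F L] [Finite L] [FiniteDimensional F L]

/-- the space of configurations -/
def Om (V : Type*) (L : Type*) [AddCommGroup V] [Module F V] [Field L] [Algebra F L] (N : ℕ) : Type _ :=
  {X : ZMod N → (V →ₗ[F] L) // ∀ v, (∀ i, X i v = 0) → v = 0}

noncomputable instance omAct (N : ℕ) : MulAction ((Module.End F V)ˣ × Lˣ) (Om (F := F) V L N) where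
  smul a X := ⟨fun i => (a.2 : L) • (X.1 i ∘ₗ ((a.1⁻¹ : (Module.End F V)ˣ) : Module.End F V)), by
    intro v hv
    have h1 : ((a.1⁻¹ : (Module.End F V)ˣ) : Module.End F V) v = 0 := X.2 _ fun i => by
      have := hv i
      simpa using this
    have h2 : v = ((a.1 * a.1⁻¹ : (Module.End F V)ˣ) : Module.End F V) v := by simp
    rw [h2, Units.val_mul, Module.End.mul_apply, h1, map_zero]⟩
  one_smul X := by
    apply Subtype.ext
    funext i
    ext v
    change (1 : L) • (X.1 i ((((1 : (Module.End F V)ˣ)⁻¹ : (Module.End F V)ˣ) : Module.End F V) v)) = _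
    simp
  mul_smul a b X := by
    apply Subtype.ext
    funext i
    ext v
    change ((a.2 * b.2 : Lˣ) : L) • (X.1 i ((((a.1 * b.1)⁻¹ : (Module.End F V)ˣ) : Module.End F V) v)) =
      (a.2 : L) • ((b.2 : L) • (X.1 i (((b.1⁻¹ : (Module.End F V)ˣ) : Module.End F V) (((a.1⁻¹ : (Module.End F V)ˣ) : Module.End F V) v))))
    rw [mul_inv_rev, Units.val_mul, Units.val_mul, mul_smul, Module.End.mul_apply]

lemma om_smul (N : ℕ) (a : (Module.End F V)ˣ × Lˣ) (X : Om (F := F) V L N) (i : ZMod N) (v : V) :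
    (a • X).1 i v = (a.2 : L) * X.1 i (((a.1⁻¹ : (Module.End F V)ˣ) : Module.End F V) v) := rfl

def omShift (N : ℕ) : Equiv.Perm (Om (F := F) V L N) where
  toFun X := ⟨fun i => X.1 (i + 1), fun v hv => X.2 v fun i => by
    have := hv (i - 1)
    simpa using this⟩
  invFun X := ⟨fun i => X.1 (i - 1), fun v hv => X.2 v fun i => by
    have := hv (i + 1)
    simpa using this⟩
  left_inv X := by apply Subtype.ext; funext i; simp
  right_inv X := by apply Subtype.ext; funext i; simp

lemma om_fix (a : ℕ) (N : ℕ) [NeZero N] (hN : N = Fintype.card F ^ a) (g : (Module.End F V)ˣ) (t : Lˣ)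
    (ht : (t : L) ^ N = t) :
    Nat.card {X : Om (F := F) V L N // (g, t) • omShift N X = X} =
    Nat.card {φ : V →ₗ[F] L // (∀ v, φ (((g : Module.End F V) ^ (Fintype.card F ^ a)) v) = t * φ v) ∧
      ∀ v, (∀ k : ℕ, φ (((g : Module.End F V) ^ k) v) = 0) → v = 0} := by
  let T : (V →ₗ[F] L) → (V →ₗ[F] L) := fun φ => ((t⁻¹ : Lˣ) : L) • (φ ∘ₗ (g : Module.End F V))
  have hT : ∀ (k : ℕ) φ, ∀ v, (T^[k] φ) v = ((t⁻¹ : Lˣ) : L) ^ k * φ (((g : Module.End F V) ^ k) v) := by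
    intro k φ
    induction k with
    | zero => intro v; simp
    | succ k ih =>
      intro v
      rw [Function.iterate_succ_apply']
      change ((t⁻¹ : Lˣ) : L) * (T^[k] φ) ((g : Module.End F V) v) = _
      rw [ih, ← Module.End.mul_apply, ← pow_succ, ← mul_assoc, ← pow_succ']
  have h1 := cyc_fix T N (fun X => ∀ v, (∀ k, X k v = 0) → v = 0)
  have h2 : Nat.card {X : Om (F := F) V L N // (g, t) • omShift N X = X} =
    Nat.card {X : ZMod N → (V →ₗ[F] L) // (∀ i, X (i + 1) = T (X i)) ∧
      ∀ v, (∀ k : ℕ, X (k : ZMod N) v = 0) → v = 0} := by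
    have key : ∀ X : Om (F := F) V L N, (g, t) • omShift N X = X ↔ ∀ i, X.1 (i + 1) = T (X.1 i) := by
      intro X
      constructor
      · intro h i
        ext v
        change _ = ((t⁻¹ : Lˣ) : L) * X.1 i ((g : Module.End F V) v)
        conv_rhs => rw [← h]
        rw [om_smul]
        change _ = ((t⁻¹ : Lˣ) : L) * ((t : L) * X.1 (i + 1) (((g⁻¹ : (Module.End F V)ˣ) : Module.End F V) ((g : Module.End F V) v)))
        rw [← mul_assoc, ← Module.End.mul_apply, Units.inv_mul, Units.inv_mul, one_mul]
        rfl
      · intro h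
        apply Subtype.ext
        funext i
        ext v
        rw [om_smul]
        change (t : L) * X.1 (i + 1) (((g⁻¹ : (Module.End F V)ˣ) : Module.End F V) v) = _
        rw [h]
        change (t : L) * (((t⁻¹ : Lˣ) : L) * X.1 i ((g : Module.End F V) (((g⁻¹ : (Module.End F V)ˣ) : Module.End F V) v))) = _
        rw [← mul_assoc, ← Module.End.mul_apply, Units.mul_inv, Units.mul_inv, one_mul]
        rfl
    refine Nat.card_congr
      { toFun := fun X => ⟨X.1.1, (key X.1).1 X.2, fun v hv => X.1.2 v fun i => by
          have := hv i.val
          simpa using this⟩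
        invFun := fun X => ⟨⟨X.1, fun v hv => X.2.2 v fun k => hv _⟩, (key _).2 X.2.1⟩
        left_inv := fun X => rfl
        right_inv := fun X => rfl }
  rw [h2, h1]
  refine Nat.card_congr (Equiv.subtypeEquivRight fun φ => ?_)
  refine and_congr ?_ ?_
  · rw [LinearMap.ext_iff]
    refine forall_congr' fun v => ?_
    rw [hT, ← hN]
    have h3 : ((t⁻¹ : Lˣ) : L) ^ N = ((t⁻¹ : Lˣ) : L) := by
      rw [Units.val_inv_eq_inv_val, inv_pow, ht]
    rw [h3, Units.inv_mul_eq_iff_eq_mul]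
  · refine forall_congr' fun v => ?_
    simp only [hT]
    simp

/-- congruence for the fixed point count -/
lemma om_count [Nontrivial V] (hV : Module.finrank F V ≤ Module.finrank F L) (N : ℕ) [NeZero N] (hN : N = Nat.card L)
    (g : (Module.End F V)ˣ) (t : Lˣ) :
    ∃ z : ℤ, (Nat.card {X : Om (F := F) V L N // (g, t) • omShift N X = X} : ℤ) =
      ((Nat.card L : ℤ) - 1) * (kk (g : Module.End F V) (minpoly F (t : L)) + ((Nat.card L : ℤ) - 1) * z) := by
  classical
  have hL : Nat.card L = Fintype.card F ^ Module.finrank F L := by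
    rw [← Nat.card_eq_fintype_card]; exact Module.natCard_eq_pow_finrank
  haveI := Fintype.ofFinite L
  have ht : (t : L) ^ Nat.card L = t := by rw [Nat.card_eq_fintype_card]; exact FiniteField.pow_card _
  rw [om_fix (Module.finrank F L) N (hN.trans hL) g t (by rw [hN, ht]),
    count_E (g : Module.End F V) (t : L) _
      (hV.trans (Nat.lt_pow_self Fintype.one_lt_card).le) (by rw [← hL, ht])]
  rw [kk]
  split_ifs with hn
  · have h_intg : IsIntegral F (t : L) := Algebra.IsIntegral.isIntegral _
    have hd := ker_dvd (g : Module.End F V) (minpoly F (t : L)) (minpoly.irreducible h_intg)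
    have hp := ker_pos (g : Module.End F V) (minpoly F (t : L)) hn
    have hr : 1 ≤ Module.finrank F (LinearMap.ker (Polynomial.aeval (g : Module.End F V) (minpoly F (t : L)))) / (minpoly F (t : L)).natDegree :=
      Nat.div_pos (Nat.le_of_dvd hp hd) (minpoly.natDegree_pos h_intg)
    generalize Module.finrank F (LinearMap.ker (Polynomial.aeval (g : Module.End F V) (minpoly F (t : L)))) / (minpoly F (t : L)).natDegree = r at hr ⊢
    generalize ((Module.finrank F V - Module.finrank F (LinearMap.ker (Polynomial.aeval (g : Module.End F V) (minpoly F (t : L))))) / (minpoly F (t : L)).natDegree) = e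
    generalize (Fintype.card F : ℤ) ^ (minpoly F (t : L)).natDegree = Q
    generalize (Nat.card L : ℤ) = x
    obtain ⟨r, rfl⟩ : ∃ s, r = s + 1 := ⟨r - 1, by omega⟩
    rw [Finset.prod_range_succ']
    have h1 : x ^ e ≡ 1 [ZMOD (x - 1)] := by
      have : x ≡ 1 [ZMOD (x - 1)] := (Int.modEq_sub x 1)
      simpa using this.pow e
    have h2 : ∏ i ∈ Finset.range r, (x - Q ^ (i + 1)) ≡ kap Q (r + 1) [ZMOD (x - 1)] := by
      rw [kap, Nat.add_sub_cancel]
      induction r with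
      | zero => simp
      | succ r ih =>
        rw [Finset.prod_range_succ, Finset.prod_range_succ]
        exact (ih (by omega)).mul ((Int.modEq_sub x 1).sub_right _)
    have h3 := (h1.mul h2).symm.dvd
    obtain ⟨z, hz⟩ := h3
    refine ⟨z, ?_⟩
    rw [← hz]
    ring
  · exact ⟨0, by simp⟩
end
end KL

open scoped BigOperators Polynomial

namespace KL
section
variable {F : Type*} [Field F] [Fintype F]
variable {V : Type*} [AddCommGroup V] [Module F V] [FiniteDimensional F V] [Finite V]
variable {E : Type*} [Field E] [Algebra F E] [Fintype E] [FiniteDimensional F E]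
variable {L : Type*} [Field L] [Algebra F L] [Finite L] [FiniteDimensional F L]

lemma mem_E_of_dvd [Algebra E L] [IsScalarTower F E L] (t : L)
    (h : (minpoly F t).natDegree ∣ Module.finrank F E) : ∃ ξ : E, algebraMap E L ξ = t := by
  have h_intg : IsIntegral F t := Algebra.IsIntegral.isIntegral t
  haveI : Finite (IntermediateField.adjoin F {t}) := Module.finite_of_finite F
  haveI : Fintype (IntermediateField.adjoin F {t}) := Fintype.ofFinite _
  have h1 : Fintype.card (IntermediateField.adjoin F {t}) = Fintype.card F ^ (minpoly F t).natDegree := by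
    rw [← Nat.card_eq_fintype_card, ← Nat.card_eq_fintype_card, ← IntermediateField.adjoin.finrank h_intg]
    exact Module.natCard_eq_pow_finrank
  obtain ⟨c, hc⟩ := h
  have h2 : t ^ Fintype.card E = t := by
    have h3 : (⟨t, IntermediateField.mem_adjoin_simple_self F t⟩ : IntermediateField.adjoin F {t}) ^ Fintype.card E =
      ⟨t, IntermediateField.mem_adjoin_simple_self F t⟩ := by
      have : Fintype.card E = Fintype.card (IntermediateField.adjoin F {t}) ^ c := by
        rw [h1, ← pow_mul, ← hc, ← Nat.card_eq_fintype_card, ← Nat.card_eq_fintype_card]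
        exact Module.natCard_eq_pow_finrank
      rw [this, FiniteField.pow_card_pow]
    exact congrArg Subtype.val h3
  classical
  have hq : 1 < Fintype.card E := Fintype.one_lt_card
  have hne : (Polynomial.X ^ Fintype.card E - Polynomial.X : L[X]) ≠ 0 := FiniteField.X_pow_card_sub_X_ne_zero L hq
  have h5 : Finset.univ.image (algebraMap E L) = (Polynomial.X ^ Fintype.card E - Polynomial.X : L[X]).roots.toFinset := by
    apply Finset.eq_of_subset_of_card_le
    · intro x hx
      obtain ⟨ξ, -, rfl⟩ := Finset.mem_image.1 hx
      rw [Multiset.mem_toFinset, Polynomial.mem_roots hne]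
      simp [← map_pow, FiniteField.pow_card]
    · rw [Finset.card_image_of_injective _ (algebraMap E L).injective, Finset.card_univ]
      refine (Multiset.toFinset_card_le _).trans ((Polynomial.card_roots' _).trans ?_)
      rw [FiniteField.X_pow_card_sub_X_natDegree_eq L hq]
  have h6 : t ∈ Finset.univ.image (algebraMap E L) := by
    rw [h5, Multiset.mem_toFinset, Polynomial.mem_roots hne]
    simp [h2]
  obtain ⟨ξ, -, h⟩ := Finset.mem_image.1 h6
  exact ⟨ξ, h⟩

lemma kk_sum_L [Fintype Lˣ] [Algebra E L] [IsScalarTower F E L] (hV : Module.finrank F V = Module.finrank F E)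
    (θ : MulChar E ℂ) (θL : Lˣ →* ℂˣ) (hθ : ∀ ξ : Eˣ, (θL (Units.map (algebraMap E L : E →* L) ξ) : ℂ) = θ ξ)
    (g : Module.End F V) :
    ∑ t : Lˣ, (θL t : ℂ) * (kk g (minpoly F (t : L)) : ℂ) = cc (F := F) θ g := by
  classical
  have h1 : cc (F := F) θ g = ∑ ξ : Eˣ, θ ξ * (kk g (minpoly F (ξ : E)) : ℂ) := by
    rw [cc]
    symm
    refine Finset.sum_of_injOn (fun ξ : Eˣ => (ξ : E)) (fun a _ b _ h => Units.ext h) (fun _ _ => Finset.mem_coe.2 (Finset.mem_univ _)) ?_ (fun _ _ => rfl)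
    intro ξ _ hξ
    have : ¬ IsUnit ξ := fun hu => hξ ⟨hu.unit, by simp, rfl⟩
    rw [MulChar.map_nonunit θ this, zero_mul]
  rw [h1]
  symm
  refine Finset.sum_of_injOn (fun ξ : Eˣ => Units.map (algebraMap E L : E →* L) ξ)
    (fun a _ b _ h => Units.ext ((algebraMap E L).injective (congrArg Units.val h))) (fun _ _ => Finset.mem_coe.2 (Finset.mem_univ _)) ?_ ?_
  · intro t _ ht
    by_contra hne
    have hk : kk g (minpoly F (t : L)) ≠ 0 := by
      intro h0; apply hne; rw [h0]; simp
    have h_intg : IsIntegral F (t : L) := Algebra.IsIntegral.isIntegral _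
    have hc := charpoly_of_nilp g _ (minpoly.monic h_intg) (minpoly.irreducible h_intg) (kk_ne_zero hk)
    have hd : (minpoly F (t : L)).natDegree ∣ Module.finrank F E := by
      rw [← hV, ← LinearMap.charpoly_natDegree g, hc, Polynomial.natDegree_pow]
      exact dvd_mul_left _ _
    obtain ⟨ξ, hξ⟩ := mem_E_of_dvd (E := E) (t : L) hd
    have hξ0 : ξ ≠ 0 := by
      rintro rfl
      rw [map_zero] at hξ
      exact t.ne_zero hξ.symm
    exact ht ⟨Units.mk0 ξ hξ0, by simp, Units.ext hξ⟩
  · intro ξ _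
    rw [hθ]
    congr 3
    exact (minpoly.algebraMap_eq (algebraMap E L).injective (ξ : E)).symm

lemma pprime_part [Nontrivial V] [Fintype (Module.End F V)ˣ] [Algebra E L] [IsScalarTower F E L]
    (hV : Module.finrank F V = Module.finrank F E)
    (θ : MulChar E ℂ) (θL : Lˣ →* ℂˣ) (hθ : ∀ ξ : Eˣ, (θL (Units.map (algebraMap E L : E →* L) ξ) : ℂ) = θ ξ)
    (M : ℤ) (hM : M ∣ (Nat.card L : ℤ) - 1) (hM' : M ∣ (Fintype.card (Module.End F V)ˣ : ℤ))
    {d : ℕ} (ρ : (Module.End F V)ˣ →* Matrix (Fin d) (Fin d) ℂ) :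
    ∃ z : ℂ, IsIntegral ℤ z ∧ ∑ g : (Module.End F V)ˣ, cc (F := F) θ (g : Module.End F V) * (ρ g).trace = M * z := by
  classical
  haveI : Fintype L := Fintype.ofFinite L
  set N := Nat.card L with hN
  haveI : NeZero N := ⟨Nat.card_pos.ne'⟩
  haveI : Finite (V →ₗ[F] L) := Module.finite_of_finite F
  haveI : Finite (Om (F := F) V L N) := Subtype.finite
  haveI : Fintype (Om (F := F) V L N) := Fintype.ofFinite _
  have hVL : Module.finrank F V ≤ Module.finrank F L := by
    rw [hV]
    exact LinearMap.finrank_le_finrank_of_injective (f := (IsScalarTower.toAlgHom F E L).toLinearMap) (algebraMap E L).injective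
  have hI := integral_fix_avg (A := (Module.End F V)ˣ × Lˣ) (omShift (F := F) (V := V) (L := L) N) (fun a X => rfl)
    (((Units.coeHom ℂ).comp θL).comp (MonoidHom.snd (Module.End F V)ˣ Lˣ)) (ρ.comp (MonoidHom.fst (Module.End F V)ˣ Lˣ)) 1 1 one_ne_zero (by simp) (fun _ => Commute.one_right _)
  choose z hz using fun g t => om_count (F := F) (V := V) (L := L) hVL N hN g t
  have hfix : ∀ a : (Module.End F V)ˣ × Lˣ,
      (((Finset.univ.filter fun X : Om (F := F) V L N => a • omShift N X = X).card : ℕ) : ℂ) =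
      ((N : ℂ) - 1) * ((kk (a.1 : Module.End F V) (minpoly F (a.2 : L)) : ℂ) + ((N : ℂ) - 1) * (z a.1 a.2 : ℂ)) := by
    intro a
    have h := hz a.1 a.2
    rw [← Fintype.card_subtype, ← Nat.card_eq_fintype_card]
    have h' := congrArg (fun x : ℤ => (x : ℂ)) h
    push_cast at h'
    exact h'
  simp_rw [hfix] at hI
  set Z : ℂ := ∑ a : (Module.End F V)ˣ × Lˣ, (θL a.2 : ℂ) * (z a.1 a.2 : ℂ) * (ρ a.1).trace with hZ
  set S : ℂ := ∑ g : (Module.End F V)ˣ, cc (F := F) θ (g : Module.End F V) * (ρ g).trace with hS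
  have hZi : IsIntegral ℤ Z := by
    refine IsIntegral.sum _ fun a _ => IsIntegral.mul (IsIntegral.mul ?_ (isIntegral_intCast _)) ?_
    · refine integral_of_pow (Fintype.card Lˣ) Fintype.card_ne_zero ?_
      rw [← Units.val_pow_eq_pow_val, ← map_pow, pow_card_eq_one, map_one, Units.val_one]
    · refine trace_integral _ (Fintype.card (Module.End F V)ˣ) Fintype.card_ne_zero ?_
      rw [← map_pow, pow_card_eq_one, map_one]
  have hsum : ∑ a : (Module.End F V)ˣ × Lˣ, (((Units.coeHom ℂ).comp θL).comp (MonoidHom.snd (Module.End F V)ˣ Lˣ)) a *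
      (((N : ℂ) - 1) * ((kk (a.1 : Module.End F V) (minpoly F (a.2 : L)) : ℂ) + ((N : ℂ) - 1) * (z a.1 a.2 : ℂ))) *
      ((ρ.comp (MonoidHom.fst (Module.End F V)ˣ Lˣ)) a * 1).trace = ((N : ℂ) - 1) * (S + ((N : ℂ) - 1) * Z) := by
    rw [hS, hZ]
    have : ∀ g : (Module.End F V)ˣ, cc (F := F) θ (g : Module.End F V) * (ρ g).trace =
      ∑ t : Lˣ, (θL t : ℂ) * (kk (g : Module.End F V) (minpoly F (t : L)) : ℂ) * (ρ g).trace := by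
      intro g
      rw [← kk_sum_L hV θ θL hθ, Finset.sum_mul]
    rw [Finset.sum_congr rfl (fun g _ => this g), ← Fintype.sum_prod_type' (f := fun (g : (Module.End F V)ˣ) (t : Lˣ) => (θL t : ℂ) * (kk (g : Module.End F V) (minpoly F (t : L)) : ℂ) * (ρ g).trace),
      Finset.mul_sum, ← Finset.sum_add_distrib, Finset.mul_sum]
    refine Finset.sum_congr rfl fun a _ => ?_
    simp only [MonoidHom.comp_apply, Units.coeHom_apply, MonoidHom.coe_snd, MonoidHom.coe_fst, mul_one]
    ring
  rw [hsum, Fintype.card_prod, Fintype.card_units, ← Nat.card_eq_fintype_card (α := L), ← hN] at hI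
  have hN1 : 1 < N := by rw [hN, Nat.card_eq_fintype_card]; exact Fintype.one_lt_card
  have hx : ((N : ℂ) - 1) ≠ 0 := by
    rw [sub_ne_zero]; exact_mod_cast hN1.ne'
  have hG : (Fintype.card (Module.End F V)ˣ : ℂ) ≠ 0 := by exact_mod_cast Fintype.card_ne_zero
  obtain ⟨a, ha⟩ := hM
  obtain ⟨b, hb⟩ := hM'
  refine ⟨(b : ℂ) * _ - (a : ℂ) * Z, ((isIntegral_intCast b).mul hI).sub ((isIntegral_intCast a).mul hZi), ?_⟩
  have ha' : ((N : ℂ) - 1) = M * a := by exact_mod_cast congrArg (fun x : ℤ => (x : ℂ)) ha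
  have hb' : (Fintype.card (Module.End F V)ˣ : ℂ) = M * b := by exact_mod_cast congrArg (fun x : ℤ => (x : ℂ)) hb
  rw [mul_sub, ← mul_assoc, ← mul_assoc (M : ℂ) (a : ℂ) Z, ← hb', ← ha', Nat.cast_mul, Nat.cast_sub hN1.le, Nat.cast_one]
  field_simp
  ring
end
end KL

open scoped BigOperators Polynomial

namespace KL
section
lemma class_sum {G : Type*} [Group G] [Fintype G] (X : G → ℂ) (hX : ∀ g h, X (h * g * h⁻¹) = X g) (p : ℕ)
    [hp : Fact p.Prime]
    (hz : ∀ s, ∃ z, IsIntegral ℤ z ∧ X s = (p : ℂ) ^ ((Nat.card (Subgroup.centralizer {s})).factorization p) * z) :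
    ∃ z, IsIntegral ℤ z ∧ ∑ s, X s = (p : ℂ) ^ ((Fintype.card G).factorization p) * z := by
  classical
  haveI : Fintype (ConjClasses G) := Fintype.ofFinite _
  have h1 : ∀ c : ConjClasses G, ∃ z, IsIntegral ℤ z ∧
      ∑ s ∈ Finset.univ.filter (fun s => ConjClasses.mk s = c), X s = (p : ℂ) ^ ((Fintype.card G).factorization p) * z := by
    intro c
    obtain ⟨s, rfl⟩ := ConjClasses.exists_rep c
    obtain ⟨z, hz, hzs⟩ := hz s
    have h2 : ∀ t ∈ Finset.univ.filter (fun t => ConjClasses.mk t = ConjClasses.mk s), X t = X s := by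
      intro t ht
      rw [Finset.mem_filter] at ht
      obtain ⟨h, hh⟩ := isConj_iff.1 (ConjClasses.mk_eq_mk_iff_isConj.1 ht.2)
      rw [← hh, hX]
    have h3 : (Finset.univ.filter (fun t => ConjClasses.mk t = ConjClasses.mk s)).card * Nat.card (Subgroup.centralizer {s}) = Fintype.card G := by
      have h4 := MulAction.card_orbit_mul_card_stabilizer_eq_card_group (ConjAct G) s
      rw [← Nat.card_eq_fintype_card (α := MulAction.stabilizer (ConjAct G) s), ← Subgroup.nat_card_centralizer_nat_card_stabilizer,
        ConjAct.card] at h4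
      rw [← h4]
      congr 1
      rw [← Set.toFinset_card]
      congr 1
      ext t
      rw [Finset.mem_filter, Set.mem_toFinset, ConjAct.orbit_eq_carrier_conjClasses, ConjClasses.mem_carrier_iff_mk_eq]
      simp
    have hne : (Finset.univ.filter (fun t => ConjClasses.mk t = ConjClasses.mk s)).card ≠ 0 := by
      intro h0; rw [h0, zero_mul] at h3; exact Fintype.card_ne_zero h3.symm
    have hne' : Nat.card (Subgroup.centralizer {s}) ≠ 0 := Nat.card_pos.ne'
    have h5 := Nat.ordProj_mul_ordCompl_eq_self (Finset.univ.filter (fun t => ConjClasses.mk t = ConjClasses.mk s)).card p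
    refine ⟨((Finset.univ.filter (fun t => ConjClasses.mk t = ConjClasses.mk s)).card / p ^ ((Finset.univ.filter (fun t => ConjClasses.mk t = ConjClasses.mk s)).card.factorization p) : ℕ) * z, (isIntegral_natCast _).mul hz, ?_⟩
    rw [Finset.sum_congr rfl h2, Finset.sum_const, nsmul_eq_mul, hzs, ← h3, Nat.factorization_mul hne hne',
      Finsupp.add_apply, pow_add]
    conv_lhs => rw [← h5]
    push_cast
    ring
  choose z hz hzs using h1
  refine ⟨∑ c, z c, IsIntegral.sum _ fun c _ => hz c, ?_⟩
  rw [← Finset.sum_fiberwise Finset.univ (fun s => ConjClasses.mk s), Finset.mul_sum]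
  exact Finset.sum_congr rfl fun c _ => hzs c

variable {F : Type*} [Field F] [Fintype F]
variable {V : Type*} [AddCommGroup V] [Module F V] [FiniteDimensional F V] [Finite V]
variable {E : Type*} [Field E] [Algebra F E] [Fintype E] [FiniteDimensional F E]

lemma ker_sh (s h : Module.End F V) (hs0 : Function.Injective s) (hc : Commute s h) (N a : ℕ) (hN : N = Fintype.card F ^ a)
    (hs : s ^ N = s) (hh : h ^ N = 1) (ξ : E) (hξ : ξ ^ N = ξ) (h0 : Polynomial.aeval s (minpoly F ξ) = 0) (v : V) :
    Polynomial.aeval (s * h) (minpoly F ξ) v = 0 ↔ h v = v := by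
  constructor
  · intro hv
    have : minpoly F ξ ∣ Polynomial.X ^ N - Polynomial.X := by
      apply minpoly.dvd
      simp [hξ]
    obtain ⟨R, hR⟩ := this
    have h4 := congrArg (fun f => Polynomial.aeval (s * h) f v) hR
    simp only [map_sub, map_pow, Polynomial.aeval_X, LinearMap.sub_apply] at h4
    rw [mul_comm (minpoly F ξ), map_mul, Module.End.mul_apply (Polynomial.aeval (s * h) R), hv, map_zero, hc.mul_pow, hs, hh, mul_one, sub_eq_zero, Module.End.mul_apply] at h4
    exact (hs0 h4).symm
  · intro hv
    have h1 : ∀ k : ℕ, ((s * h) ^ k) v = (s ^ k) v := by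
      intro k
      rw [hc.mul_pow, Module.End.mul_apply]
      congr 1
      induction k with
      | zero => simp
      | succ k ih => rw [pow_succ, Module.End.mul_apply, hv, ih]
    have h2 : Polynomial.aeval (s * h) (minpoly F ξ) v = Polynomial.aeval s (minpoly F ξ) v := by
      rw [Polynomial.aeval_eq_sum_range, Polynomial.aeval_eq_sum_range, LinearMap.sum_apply, LinearMap.sum_apply]
      refine Finset.sum_congr rfl fun k _ => ?_
      rw [LinearMap.smul_apply, LinearMap.smul_apply, h1]
    rw [h2, h0]; rfl

lemma kk_sh [Nontrivial V] (s h : Module.End F V) (hs0 : Function.Injective s) (hc : Commute s h) (N a : ℕ) (hN : N = Fintype.card F ^ a)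
    (hn : Module.finrank F V ≤ N) (hs : s ^ N = s) (hh : h ^ N = 1) (ξ : E) (hξ : ξ ^ N = ξ) :
    (Polynomial.aeval s (minpoly F ξ) = 0 → ∃ r, 1 ≤ r ∧ r ≤ Module.finrank F V ∧
      kk (s * h) (minpoly F ξ) = kap ((Fintype.card F : ℤ) ^ (minpoly F ξ).natDegree) r ∧
      Nat.card {v // h v = v} = (Fintype.card F ^ (minpoly F ξ).natDegree) ^ r) ∧
    (Polynomial.aeval s (minpoly F ξ) ≠ 0 → kk (s * h) (minpoly F ξ) = 0) := by
  have h_intg : IsIntegral F ξ := Algebra.IsIntegral.isIntegral _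
  have hfr : Polynomial.aeval s (minpoly F ξ) = (Polynomial.aeval (s * h) (minpoly F ξ)) ^ N := by
    rw [hN, ← aeval_frob, ← hN, hc.mul_pow, hs, hh, mul_one]
  constructor
  · intro h0
    have hnil : IsNilpotent (Polynomial.aeval (s * h) (minpoly F ξ)) := ⟨N, by rw [← hfr, h0]⟩
    have hd := ker_dvd (s * h) (minpoly F ξ) (minpoly.irreducible h_intg)
    have hp := ker_pos (s * h) (minpoly F ξ) hnil
    refine ⟨Module.finrank F (LinearMap.ker (Polynomial.aeval (s * h) (minpoly F ξ))) / (minpoly F ξ).natDegree,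
      Nat.div_pos (Nat.le_of_dvd hp hd) (minpoly.natDegree_pos h_intg),
      (Nat.div_le_self _ _).trans (Submodule.finrank_le _), ?_, ?_⟩
    · rw [kk, if_pos hnil]
    · rw [← pow_mul, Nat.mul_div_cancel' hd, ← Nat.card_eq_fintype_card, ← Module.natCard_eq_pow_finrank]
      exact Nat.card_congr (Equiv.subtypeEquivRight fun v => by
        rw [LinearMap.mem_ker]
        exact (ker_sh s h hs0 hc N a hN hs hh ξ hξ h0 v).symm)
  · intro h0
    by_contra hne
    apply h0
    have h2 := charpoly_of_nilp _ _ (minpoly.monic h_intg) (minpoly.irreducible h_intg) (kk_ne_zero hne)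
    have h3 := LinearMap.aeval_self_charpoly (s * h)
    rw [h2, map_pow] at h3
    rw [hfr]
    exact pow_eq_zero_of_le ((Nat.div_le_self _ _).trans hn) h3
end
end KL

open scoped BigOperators Polynomial

namespace KL
section
variable {F : Type*} [Field F] [Fintype F]
variable {V : Type*} [AddCommGroup V] [Module F V] [FiniteDimensional F V] [Finite V]
variable {E : Type*} [Field E] [Algebra F E] [Fintype E] [FiniteDimensional F E]

lemma exists_N (p : ℕ) [hp : Fact p.Prime] [CharP F p] (g n : ℕ) (hg : g ≠ 0) :
    ∃ a N : ℕ, N = Fintype.card F ^ a ∧ n ≤ N ∧ (∀ ξ : E, ξ ^ N = ξ) ∧ p ^ (g.factorization p) ∣ N ∧ g ∣ N * (N - 1) ∧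
      ∃ j, N = p ^ j := by
  obtain ⟨f, _, hf⟩ := FiniteField.card F p
  have hfp := f.pos
  have hord := Nat.ordProj_mul_ordCompl_eq_self g p
  have hcop : Nat.Coprime p (g / p ^ g.factorization p) := Nat.coprime_ordCompl hp.out hg
  set e := g.factorization p
  set M := g / p ^ e
  have hMpos : 0 < M := Nat.pos_of_ne_zero (by
    intro h0; rw [h0, mul_zero] at hord; exact hg hord.symm)
  have hφ : 0 < M.totient := Nat.totient_pos.2 hMpos
  have hfin : 0 < Module.finrank F E := Module.finrank_pos
  set a := Module.finrank F E * M.totient * (e + n + 1) with ha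
  have hae : e + n ≤ a := by
    rw [ha]
    calc e + n ≤ 1 * (e + n + 1) := by omega
      _ ≤ _ := Nat.mul_le_mul_right _ (Nat.mul_pos hfin hφ)
  have hpe : p ^ e ∣ Fintype.card F ^ a := by
    rw [hf, ← pow_mul]
    exact pow_dvd_pow _ (by nlinarith)
  refine ⟨a, _, rfl, ?_, ?_, hpe, ?_, ⟨f * a, by rw [hf, pow_mul p]⟩⟩
  · have := Nat.lt_pow_self (n := a) (Fintype.one_lt_card (α := F))
    omega
  · intro ξ
    have : Fintype.card F ^ a = Fintype.card E ^ (M.totient * (e + n + 1)) := by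
      rw [ha, mul_assoc, pow_mul]
      congr 1
      rw [← Nat.card_eq_fintype_card, ← Nat.card_eq_fintype_card]
      exact Module.natCard_eq_pow_finrank.symm
    rw [this, FiniteField.pow_card_pow]
  · have h1 : M ∣ Fintype.card F ^ a - 1 := by
      have h2 : Nat.Coprime (Fintype.card F) M := by rw [hf]; exact Nat.Coprime.pow_left _ hcop
      have h3 := (Nat.ModEq.pow_totient h2).pow (Module.finrank F E * (e + n + 1))
      rw [one_pow, ← pow_mul] at h3
      have h4 : M.totient * (Module.finrank F E * (e + n + 1)) = a := by rw [ha]; ring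
      rw [h4] at h3
      exact (Nat.modEq_iff_dvd' (Nat.one_le_pow _ _ Fintype.card_pos)).1 h3.symm
    rw [← hord]
    exact mul_dvd_mul hpe h1

lemma p_total_xi [Nontrivial V] [Fintype (Module.End F V)ˣ] (p : ℕ) [hp : Fact p.Prime] [CharP F p] (ξ : E)
    {d : ℕ} (ρ : (Module.End F V)ˣ →* Matrix (Fin d) (Fin d) ℂ) :
    ∃ z : ℂ, IsIntegral ℤ z ∧ ∑ g : (Module.End F V)ˣ, (kk (g : Module.End F V) (minpoly F ξ) : ℂ) * (ρ g).trace =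
      (p : ℂ) ^ ((Fintype.card (Module.End F V)ˣ).factorization p) * z := by
  classical
  haveI : Fintype V := Fintype.ofFinite V
  obtain ⟨a, N, hN, hnN, hξN, hpN, hGN, j, hj⟩ := exists_N (F := F) (E := E) p (Fintype.card (Module.End F V)ˣ) (Module.finrank F V)
    Fintype.card_ne_zero
  have hN1 : 1 ≤ N := by rw [hN]; exact Nat.one_le_pow _ _ Fintype.card_pos
  have hNN : ∀ g : (Module.End F V)ˣ, (g ^ N) ^ N = g ^ N := by
    intro g
    rw [← pow_mul]
    have h1 : N * N = N * (N - 1) + N := by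
      obtain ⟨k, rfl⟩ := Nat.exists_eq_add_of_le' hN1
      simp; ring
    obtain ⟨c, hc⟩ := hGN
    rw [h1, pow_add, hc, pow_mul, pow_card_eq_one, one_pow, one_mul]
  set c : (Module.End F V)ˣ → ℂ := fun g => (kk (g : Module.End F V) (minpoly F ξ) : ℂ) with hc
  have hcc : ∀ g h, c (h * g * h⁻¹) = c g := by
    intro g h
    simp only [hc]
    congr 1
    rw [← kk_conj (LinearMap.GeneralLinearGroup.generalLinearEquiv F V h) (g : Module.End F V)]
    congr 1
  have htr : ∀ g h, (ρ (h * g * h⁻¹)).trace = (ρ g).trace := by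
    intro g h
    rw [map_mul, map_mul, Matrix.trace_mul_comm, ← mul_assoc, ← map_mul, inv_mul_cancel, map_one, one_mul]
  set X : (Module.End F V)ˣ → ℂ := fun s => ∑ g ∈ Finset.univ.filter (fun g => g ^ N = s), c g * (ρ g).trace with hX
  have hkey := class_sum X (by
    intro s h
    simp only [hX]
    refine Finset.sum_bij' (fun g _ => h⁻¹ * g * h) (fun g _ => h * g * h⁻¹) ?_ ?_ ?_ ?_ ?_
    · intro g hg
      rw [Finset.mem_filter] at hg ⊢
      refine ⟨Finset.mem_univ _, ?_⟩
      have := conj_pow (i := N) (a := h⁻¹) (b := g)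
      rw [inv_inv] at this
      rw [this, hg.2]; group
    · intro g hg
      rw [Finset.mem_filter] at hg ⊢
      refine ⟨Finset.mem_univ _, ?_⟩
      rw [conj_pow, hg.2]
    · intro g _; group
    · intro g _; group
    · intro g _
      have h1 := hcc g h⁻¹
      have h2 := htr g h⁻¹
      rw [inv_inv] at h1 h2
      rw [h1, h2]) p (by
    intro s
    by_cases hs : s ^ N = s
    swap
    · refine ⟨0, isIntegral_zero, ?_⟩
      rw [mul_zero]
      simp only [hX]
      rw [Finset.filter_eq_empty_iff.2, Finset.sum_empty]
      intro g _ hg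
      exact hs (by rw [← hg, hNN])
    have hcm : ∀ h : Subgroup.centralizer {s}, Commute s (h : (Module.End F V)ˣ) := fun h =>
      Subgroup.mem_centralizer_singleton_iff.1 h.2 |>.symm
    have hpel : ∀ h : Subgroup.centralizer {s}, pel p h → (h : (Module.End F V)ˣ) ^ N = 1 := by
      rintro h ⟨k, hk⟩
      have h1 : orderOf (h : (Module.End F V)ˣ) ∣ p ^ k := orderOf_dvd_of_pow_eq_one (by
        have := congrArg Subtype.val hk
        simpa using this)
      obtain ⟨i, -, hi⟩ := (Nat.dvd_prime_pow hp.out).1 h1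
      rw [← orderOf_dvd_iff_pow_eq_one, hi]
      refine dvd_trans (pow_dvd_pow _ ?_) hpN
      rw [← hp.out.pow_dvd_iff_le_factorization Fintype.card_ne_zero, ← hi]
      exact orderOf_dvd_card
    have hsh : ∀ h : Subgroup.centralizer {s}, pel p h → _ := fun h hh => kk_sh (E := E) (s : Module.End F V) ((h : (Module.End F V)ˣ) : Module.End F V)
      (fun x y hxy => by
        have := congrArg (((s⁻¹ : (Module.End F V)ˣ) : Module.End F V)) hxy
        rwa [← Module.End.mul_apply, ← Module.End.mul_apply, Units.inv_mul] at this)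
      (congrArg Units.val (hcm h)) N a hN hnN (congrArg Units.val hs) (congrArg Units.val (hpel h hh)) ξ (hξN ξ)
    have hQ : (1 : ℤ) < (Fintype.card F : ℤ) ^ (minpoly F ξ).natDegree := by
      exact_mod_cast Nat.one_lt_pow (minpoly.natDegree_pos (Algebra.IsIntegral.isIntegral ξ)).ne' Fintype.one_lt_card
    have hpQ : (p : ℤ) ∣ (Fintype.card F : ℤ) ^ (minpoly F ξ).natDegree := by
      obtain ⟨f, _, hf⟩ := FiniteField.card F p
      refine dvd_pow ?_ (minpoly.natDegree_pos (Algebra.IsIntegral.isIntegral ξ)).ne'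
      rw [hf]; push_cast
      exact dvd_pow_self _ f.ne_zero
    have hDR : ∃ (D : ℤ) (R : Polynomial ℤ), IsCoprime D (p : ℤ) ∧ ∀ h : Subgroup.centralizer {s}, pel p h →
        (D : ℂ) * c (s * h) = ((Polynomial.eval (((Finset.univ.filter fun x : V => h • x = x).card : ℕ) : ℤ) R : ℤ) : ℂ) := by
      by_cases h0 : Polynomial.aeval (s : Module.End F V) (minpoly F ξ) = 0
      · obtain ⟨D, R, hD, hR⟩ := kap_poly _ hQ (Module.finrank F V) p hpQ
        refine ⟨D, R, hD, fun h hh => ?_⟩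
        obtain ⟨r, hr1, hr2, hr3, hr4⟩ := (hsh h hh).1 h0
        have h5 : (Finset.univ.filter fun x : V => h • x = x).card = (Fintype.card F ^ (minpoly F ξ).natDegree) ^ r := by
          rw [← hr4, Nat.card_eq_fintype_card, Fintype.card_subtype]
          rfl
        rw [h5]
        simp only [hc, Units.val_mul]
        rw [hr3]
        push_cast
        exact_mod_cast congrArg (fun x : ℤ => (x : ℂ)) (hR r hr1 hr2)
      · refine ⟨1, 0, isCoprime_one_left, fun h hh => ?_⟩
        simp only [hc, Units.val_mul]
        rw [(hsh h hh).2 h0]; simp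
    obtain ⟨D, R, hD, hR⟩ := hDR
    haveI : Fintype (Subgroup.centralizer {s}) := Fintype.ofFinite _
    have hcard : Fintype.card (Module.End F V)ˣ ≠ 0 := Fintype.card_ne_zero
    obtain ⟨z, hz, hzs⟩ := p_part (H := Subgroup.centralizer {s}) (V := V) p (ρ.comp (Subgroup.subtype _)) (ρ s) _ hcard
      (by rw [← map_pow, pow_card_eq_one, map_one]) (fun h => by
        rw [MonoidHom.comp_apply]
        exact ((hcm h).map ρ).symm) (fun h => c (s * h)) (fun h => isIntegral_intCast _) D hD R hR (fun h => by
        refine trace_integral _ _ hcard ?_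
        rw [MonoidHom.comp_apply, ← map_mul, ← map_pow, pow_card_eq_one, map_one])
    refine ⟨z, hz, ?_⟩
    rw [Nat.card_eq_fintype_card, ← hzs]
    simp only [hX]
    have hpow : ∀ h : (Module.End F V)ˣ, h ^ N = 1 → ∀ hh : h ∈ Subgroup.centralizer {s}, pel p (⟨h, hh⟩ : Subgroup.centralizer {s}) := by
      intro h h1 hh
      exact ⟨j, Subtype.ext (by rw [← hj]; exact h1)⟩
    have hsc : ∀ g : (Module.End F V)ˣ, g ^ N = s → Commute s g := fun g hg => by
      rw [← hg]; exact (Commute.refl g).pow_left N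
    have hmem : ∀ g : (Module.End F V)ˣ, g ^ N = s → s⁻¹ * g ∈ Subgroup.centralizer {s} := fun g hg => by
      rw [Subgroup.mem_centralizer_singleton_iff]
      have : Commute s (s⁻¹ * g) := ((Commute.refl s).inv_right).mul_right (hsc g hg)
      exact this.symm
    refine Finset.sum_bij' (fun g hg => ⟨s⁻¹ * g, hmem g (Finset.mem_filter.1 hg).2⟩) (fun h _ => s * h) ?_ ?_ ?_ ?_ ?_
    · intro g hg
      rw [Finset.mem_filter] at hg ⊢
      refine ⟨Finset.mem_univ _, hpow _ ?_ _⟩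
      rw [((hsc g hg.2).inv_left).mul_pow, inv_pow, hs, hg.2, inv_mul_cancel]
    · intro h hh
      rw [Finset.mem_filter] at hh ⊢
      refine ⟨Finset.mem_univ _, ?_⟩
      rw [(hcm h).mul_pow, hs, hpel h hh.2, mul_one]
    · intro g _; simp
    · intro h _; simp
    · intro g hg
      rw [MonoidHom.comp_apply, ← map_mul]
      have h1 := (hsc g (Finset.mem_filter.1 hg).2)
      have h2 : s⁻¹ * g * s = g := by rw [mul_assoc, ← h1.eq, inv_mul_cancel_left]
      simp only [Subgroup.coe_subtype, mul_inv_cancel_left, h2])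
  obtain ⟨z, hz, hzs⟩ := hkey
  refine ⟨z, hz, ?_⟩
  rw [← hzs]
  simp only [hX]
  rw [Finset.sum_fiberwise]

lemma p_total [Nontrivial V] [Fintype (Module.End F V)ˣ] (p : ℕ) [hp : Fact p.Prime] [CharP F p] (θ : MulChar E ℂ)
    {d : ℕ} (ρ : (Module.End F V)ˣ →* Matrix (Fin d) (Fin d) ℂ) :
    ∃ z : ℂ, IsIntegral ℤ z ∧ ∑ g : (Module.End F V)ˣ, cc (F := F) θ (g : Module.End F V) * (ρ g).trace =
      (p : ℂ) ^ ((Fintype.card (Module.End F V)ˣ).factorization p) * z := by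
  classical
  choose z hz hzs using fun ξ : E => p_total_xi (F := F) (V := V) p ξ ρ
  refine ⟨∑ ξ, θ ξ * z ξ, IsIntegral.sum _ fun ξ _ => IsIntegral.mul ?_ (hz ξ), ?_⟩
  · by_cases hu : IsUnit ξ
    · refine integral_of_pow (Fintype.card Eˣ) Fintype.card_ne_zero ?_
      obtain ⟨u, rfl⟩ := hu
      rw [← map_pow, ← Units.val_pow_eq_pow_val, pow_card_eq_one, Units.val_one, map_one]
    · rw [MulChar.map_nonunit θ hu]; exact isIntegral_zero
  · rw [Finset.mul_sum]
    simp_rw [mul_left_comm _ (θ _) _, ← hzs, Finset.mul_sum]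
    rw [Finset.sum_comm]
    refine Finset.sum_congr rfl fun g _ => ?_
    rw [cc, Finset.sum_mul]
    exact Finset.sum_congr rfl fun ξ _ => by ring
end
end KL

open scoped BigOperators Polynomial

namespace KL
section
variable {F : Type*} [Field F] [Fintype F]
variable {V : Type*} [AddCommGroup V] [Module F V] [FiniteDimensional F V] [Finite V]
variable {E : Type*} [Field E] [Algebra F E] [Fintype E] [FiniteDimensional F E]

lemma exists_ext (θ : MulChar E ℂ) (p : ℕ) [hp : Fact p.Prime] [CharP F p] (M : ℕ) (hM : Nat.Coprime p M) (hM0 : M ≠ 0) :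
    ∃ (L : Type) (_ : Field L) (_ : Algebra F L) (_ : Finite L) (_ : FiniteDimensional F L) (_ : Algebra E L) (_ : IsScalarTower F E L)
      (θL : Lˣ →* ℂˣ), (∀ ξ : Eˣ, (θL (Units.map (algebraMap E L : E →* L) ξ) : ℂ) = θ ξ) ∧ (M : ℤ) ∣ (Nat.card L : ℤ) - 1 := by
  haveI : CharP E p := charP_of_injective_algebraMap (algebraMap F E).injective p
  haveI : NeZero M.totient := ⟨(Nat.totient_pos.2 (Nat.pos_of_ne_zero hM0)).ne'⟩
  let L := FiniteField.Extension E p M.totient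
  letI : Algebra F L := ((algebraMap E L).comp (algebraMap F E)).toAlgebra
  haveI : IsScalarTower F E L := IsScalarTower.of_algebraMap_eq fun _ => rfl
  have hcard : Nat.card L = Nat.card E ^ M.totient := FiniteField.natCard_extension E p M.totient
  haveI : Finite L := Nat.finite_of_card_ne_zero (by rw [hcard]; exact pow_ne_zero _ Nat.card_pos.ne')
  haveI : FiniteDimensional F L := inferInstance
  have hinj : Function.Injective (Units.map (algebraMap E L : E →* L)) :=
    fun a b h => Units.ext ((algebraMap E L).injective (congrArg Units.val h))
  let e := MonoidHom.ofInjective hinj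
  obtain ⟨θL, hθ⟩ := MonoidHom.domRestrict_surjective (M := ℂ) (Units.map (algebraMap E L : E →* L)).range (θ.toUnitHom.comp e.symm.toMonoidHom)
  refine ⟨L, inferInstance, inferInstance, inferInstance, inferInstance, inferInstance, inferInstance, θL, ?_, ?_⟩
  · intro ξ
    have h1 := DFunLike.congr_fun hθ (e ξ)
    have h2 : (θ.toUnitHom.comp e.symm.toMonoidHom) (e ξ) = θ.toUnitHom ξ := by simp
    rw [h2] at h1
    rw [← MulChar.coe_toUnitHom, ← h1]
    rfl
  · rw [hcard]
    obtain ⟨f, _, hf⟩ := FiniteField.card E p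
    have h2 : Nat.Coprime (Nat.card E) M := by rw [Nat.card_eq_fintype_card, hf]; exact Nat.Coprime.pow_left _ hM
    have h3 := (Nat.ModEq.pow_totient h2).symm
    have := (Nat.modEq_iff_dvd).1 h3
    exact_mod_cast this

lemma cc_integral [Nontrivial V] [Fintype (Module.End F V)ˣ] (hV : Module.finrank F V = Module.finrank F E) (θ : MulChar E ℂ)
    {d : ℕ} (ρ : (Module.End F V)ˣ →* Matrix (Fin d) (Fin d) ℂ) :
    IsIntegral ℤ ((Fintype.card (Module.End F V)ˣ : ℂ)⁻¹ *
      ∑ g : (Module.End F V)ˣ, cc (F := F) θ (g : Module.End F V) * (ρ g).trace) := by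
  obtain ⟨p, hp⟩ := CharP.exists F
  haveI : Fact p.Prime := ⟨CharP.char_is_prime F p⟩
  have hG0 : Fintype.card (Module.End F V)ˣ ≠ 0 := Fintype.card_ne_zero
  obtain ⟨z1, hz1, hS1⟩ := p_total (F := F) (V := V) p θ ρ
  have hord := Nat.ordProj_mul_ordCompl_eq_self (Fintype.card (Module.End F V)ˣ) p
  have hcop : Nat.Coprime p _ := Nat.coprime_ordCompl (Fact.out : p.Prime) hG0
  set G := Fintype.card (Module.End F V)ˣ
  set e := G.factorization p
  set M := G / p ^ e
  have hM0 : M ≠ 0 := by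
    intro h0; rw [h0, mul_zero] at hord; exact hG0 hord.symm
  obtain ⟨L, _, _, _, _, _, _, θL, hθ, hML⟩ := exists_ext (F := F) θ p M hcop hM0
  obtain ⟨z2, hz2, hS2⟩ := pprime_part (F := F) (V := V) (L := L) hV θ θL hθ M hML
    (by exact_mod_cast (⟨p ^ e, by rw [mul_comm]; exact hord.symm⟩ : M ∣ G)) ρ
  obtain ⟨u, v, huv⟩ : IsCoprime ((p ^ e : ℕ) : ℤ) (M : ℤ) := Nat.isCoprime_iff_coprime.2 (Nat.Coprime.pow_left _ hcop)
  have huv' : (u : ℂ) * (p : ℂ) ^ e + v * M = 1 := by exact_mod_cast congrArg (fun x : ℤ => (x : ℂ)) huv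
  have hG : (G : ℂ) = (p : ℂ) ^ e * M := by rw [← hord]; push_cast; rfl
  have hGC : (G : ℂ) ≠ 0 := by exact_mod_cast hG0
  set S := ∑ g : (Module.End F V)ˣ, cc (F := F) θ (g : Module.End F V) * (ρ g).trace
  have : (G : ℂ)⁻¹ * S = u * z2 + v * z1 := by
    rw [inv_mul_eq_iff_eq_mul₀ hGC]
    calc S = u * (p : ℂ) ^ e * S + v * M * S := by rw [← add_mul, huv', one_mul]
      _ = u * (p : ℂ) ^ e * ((M : ℤ) * z2) + v * M * ((p : ℂ) ^ e * z1) := by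
        conv_lhs => rw [hS1]
        congr 1
        rw [← hS1, hS2]
      _ = _ := by rw [hG]; push_cast; ring
  rw [this]
  exact ((isIntegral_intCast u).mul hz2).add ((isIntegral_intCast v).mul hz1)

/-- regularity -/
def Reg (F : Type*) [Field F] {E : Type*} [Field E] [Algebra F E] (θ : MulChar E ℂ) : Prop :=
  ∀ σ : E ≃ₐ[F] E, σ ≠ 1 → ∃ x : Eˣ, θ (σ x) ≠ θ x

lemma cc_nonunit (hV : Module.finrank F V = Module.finrank F E) (θ : MulChar E ℂ) (g : Module.End F V) (hg : ¬ IsUnit g) :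
    cc (F := F) θ g = 0 := by
  rw [cc]
  refine Finset.sum_eq_zero fun ξ _ => ?_
  by_cases h0 : ξ = 0
  · rw [h0, MulChar.map_zero, zero_mul]
  · by_cases hk : kk g (minpoly F ξ) = 0
    · rw [hk]; simp
    · exact absurd (kk_unit hV g ξ h0 hk) hg

lemma cc_conj (θ : E → ℂ) (g h : (Module.End F V)ˣ) :
    cc (F := F) θ ((h * g * h⁻¹ : (Module.End F V)ˣ) : Module.End F V) = cc (F := F) θ (g : Module.End F V) := by
  rw [cc, cc]
  refine Finset.sum_congr rfl fun ξ _ => ?_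
  congr 2
  rw [← kk_conj (LinearMap.GeneralLinearGroup.generalLinearEquiv F V h) (g : Module.End F V)]
  congr 1

lemma sum_units {R A : Type*} [Monoid R] [Fintype R] [Fintype Rˣ] [AddCommMonoid A] (f : R → A) (hf : ∀ x, ¬ IsUnit x → f x = 0) :
    ∑ u : Rˣ, f u = ∑ x, f x := by
  classical
  refine Finset.sum_of_injOn (fun ξ : Rˣ => (ξ : R)) (fun a _ b _ h => Units.ext h) (fun _ _ => Finset.mem_coe.2 (Finset.mem_univ _)) ?_ (fun _ _ => rfl)
  intro ξ _ hξ
  exact hf ξ fun hu => hξ ⟨hu.unit, by simp, rfl⟩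

lemma cc_irred [Nontrivial V] [Fintype (Module.End F V)ˣ] (hV : Module.finrank F V = Module.finrank F E) (θ : MulChar E ℂ)
    (hθ : Reg F θ) :
    (∀ Φ : (Module.End F V)ˣ → ℂ, (∀ g h, Φ (h * g * h⁻¹) = Φ g) →
      ∃ μ, ∀ y, ∑ g, Φ (y * g⁻¹) * cc (F := F) θ (g : Module.End F V) = μ * cc (F := F) θ (y : Module.End F V)) ∧
    ∀ (U : Subgroup (Module.End F V)ˣ) [Fintype U], ∑ u : U, cc (F := F) θ ((u : (Module.End F V)ˣ) : Module.End F V) = 0 →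
      ∀ g : (Module.End F V)ˣ, ∑ u : U, cc (F := F) θ ((g * u : (Module.End F V)ˣ) : Module.End F V) = 0 := by
  classical
  haveI : Finite (Module.End F V) := Module.finite_of_finite F
  haveI : Fintype (Module.End F V) := Fintype.ofFinite _
  refine single_irred (fun g : (Module.End F V)ˣ => cc (F := F) θ (g : Module.End F V)) (fun g h => cc_conj θ g h)
    (Fintype.card (Module.End F V)ˣ * Fintype.card Eˣ) (mul_ne_zero Fintype.card_ne_zero Fintype.card_ne_zero) (dvd_mul_right _ _) ?_
    (fun d ρ => cc_integral hV θ ρ) ?_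
  · intro g
    refine sum_mem fun ξ _ => mul_mem ?_ (intCast_mem _ _)
    by_cases hu : IsUnit ξ
    · refine cyc_root (mul_ne_zero Fintype.card_ne_zero Fintype.card_ne_zero) ?_
      obtain ⟨u, rfl⟩ := hu
      rw [← map_pow, ← Units.val_pow_eq_pow_val, mul_comm, pow_mul, pow_card_eq_one, one_pow, Units.val_one, map_one]
    · rw [MulChar.map_nonunit θ hu]; exact zero_mem _
  · rw [sum_units (fun g : Module.End F V => cc (F := F) θ g * (starRingEnd ℂ) (cc (F := F) θ g))
      (fun x hx => by rw [cc_nonunit hV θ x hx, zero_mul])]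
    rw [cc_norm hV θ hθ, ← Nat.card_eq_fintype_card]
    congr 1
    exact Nat.card_congr (LinearMap.GeneralLinearGroup.generalLinearEquiv F V).symm.toEquiv
end
end KL

open scoped BigOperators Polynomial

namespace KL
section
variable {F : Type*} [Field F] [Fintype F]
variable {V : Type*} [AddCommGroup V] [Module F V] [FiniteDimensional F V] [Finite V]
variable {E : Type*} [Field E] [Algebra F E] [Fintype E] [FiniteDimensional F E]

lemma cc_inv (θ : MulChar E ℂ) (g : (Module.End F V)ˣ) :
    cc (F := F) θ ((g⁻¹ : (Module.End F V)ˣ) : Module.End F V) = cc (F := F) (θ⁻¹ : MulChar E ℂ) (g : Module.End F V) := by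
  rw [cc, cc]
  refine Fintype.sum_equiv (Equiv.inv E) _ _ fun ξ => ?_
  rw [Equiv.inv_apply, MulChar.inv_apply', inv_inv]
  by_cases h0 : ξ = 0
  · rw [h0, MulChar.map_zero, zero_mul, zero_mul]
  · congr 2
    have := kk_inv g⁻¹ (Units.mk0 ξ h0)
    rw [inv_inv] at this
    simpa using this.symm

lemma Reg.inv {θ : MulChar E ℂ} (h : Reg F θ) : Reg F θ⁻¹ := by
  intro σ hσ
  obtain ⟨x, hx⟩ := h σ hσ
  refine ⟨x⁻¹, ?_⟩
  rw [MulChar.inv_apply', MulChar.inv_apply']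
  simpa using hx

/-- the subgroup fixing W pointwise -/
def fixW (W : Submodule F V) : Subgroup (Module.End F V)ˣ where
  carrier := {u | ∀ w ∈ W, (u : Module.End F V) w = w}
  mul_mem' := by
    intro a b ha hb w hw
    rw [Units.val_mul, Module.End.mul_apply, hb w hw, ha w hw]
  one_mem' := by intro w _; rfl
  inv_mem' := by
    intro a ha w hw
    conv_lhs => rw [← ha w hw]
    rw [← Module.End.mul_apply, Units.inv_mul]; rfl

lemma kk_fix (g : Module.End F V) (w : V) (hw : w ≠ 0) (c : F) (hg : g w = c • w) (ξ : E) (hk : kk g (minpoly F ξ) ≠ 0) : ξ = algebraMap F E c := by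
  have h_intg : IsIntegral F ξ := Algebra.IsIntegral.isIntegral ξ
  obtain ⟨k, hk⟩ := kk_ne_zero hk
  have h1 : ∀ P : F[X], Polynomial.aeval g P w = P.eval c • w := fun P =>
    Module.End.aeval_apply_of_hasEigenvector ⟨Module.End.mem_eigenspace_iff.2 hg, hw⟩
  have h2 := h1 (minpoly F ξ ^ k)
  rw [map_pow, hk, Polynomial.eval_pow] at h2
  have h3 : Polynomial.eval c (minpoly F ξ) = 0 := by
    have := (smul_eq_zero.1 h2.symm).resolve_right hw
    exact eq_zero_of_pow_eq_zero this
  have h4 : (minpoly F ξ).natDegree = 1 := by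
    have := Polynomial.degree_eq_one_of_irreducible_of_root (minpoly.irreducible h_intg) h3
    exact Polynomial.natDegree_eq_of_degree_eq_some this
  have h5 : minpoly F ξ = Polynomial.X - Polynomial.C c := by
    have hd : (Polynomial.X - Polynomial.C c) ∣ minpoly F ξ := Polynomial.dvd_iff_isRoot.2 h3
    exact (Polynomial.eq_of_monic_of_dvd_of_natDegree_le (Polynomial.monic_X_sub_C c) (minpoly.monic h_intg) hd (by rw [h4]; simp))
  have h6 := minpoly.aeval F ξ
  rw [h5] at h6
  simpa [sub_eq_zero] using h6

lemma sum_fixW [Fintype (Module.End F V)ˣ] (hV : Module.finrank F V = Module.finrank F E) (θ : MulChar E ℂ)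
    (W : Submodule F V) (hW : W ≠ ⊤) (hW' : W ≠ ⊥) [Fintype (fixW W)] :
    ∑ u : fixW W, cc (F := F) θ ((u : (Module.End F V)ˣ) : Module.End F V) = 0 := by
  classical
  haveI : Finite (Module.End F V) := Module.finite_of_finite F
  haveI : Fintype (Module.End F V) := Fintype.ofFinite _
  haveI : Nontrivial W := (Submodule.nontrivial_iff_ne_bot).2 hW'
  obtain ⟨w, hwW, hw0⟩ := Submodule.exists_mem_ne_zero_of_ne_bot hW'
  have h1 : ∀ u : fixW W, cc (F := F) θ ((u : (Module.End F V)ˣ) : Module.End F V) = (kk ((u : (Module.End F V)ˣ) : Module.End F V) (minpoly F (1 : E)) : ℂ) := by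
    intro u
    rw [cc, Finset.sum_eq_single (1 : E)]
    · rw [map_one, one_mul]
    · intro ξ _ hξ
      by_cases hk : kk ((u : (Module.End F V)ˣ) : Module.End F V) (minpoly F ξ) = 0
      · rw [hk]; simp
      · exact absurd (by simpa using kk_fix _ w hw0 1 (by rw [one_smul]; exact u.2 w hwW) ξ hk) hξ
    · intro h; exact absurd (Finset.mem_univ _) h
  rw [Finset.sum_congr rfl fun u _ => h1 u]
  have h2 := cusp_sub (V := V) (minpoly F (1 : E)) (minpoly.irreducible (Algebra.IsIntegral.isIntegral _)) (1 : Module.End F W)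
    (by rw [minpoly.one]; simp) W.subtype (Submodule.injective_subtype W) (fun hs => hW (by
      rw [← LinearMap.range_eq_top, Submodule.range_subtype] at hs; exact hs))
  have h3 := congrArg (fun x : ℤ => (x : ℂ)) h2
  simp only [Int.cast_sum, Int.cast_zero] at h3
  rw [← h3]
  refine Finset.sum_of_injOn (fun u : fixW W => ((u : (Module.End F V)ˣ) : Module.End F V)) (fun a _ b _ h => Subtype.ext (Units.ext h)) ?_ ?_ (fun _ _ => rfl)
  · intro u _
    rw [Finset.mem_coe, Finset.mem_filter]
    exact ⟨Finset.mem_univ _, fun x => (u.2 x x.2).symm⟩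
  · intro g hg hn
    rw [Finset.mem_filter] at hg
    by_contra hne
    have hk : kk g (minpoly F (1 : E)) ≠ 0 := fun h => hne (by rw [h]; simp)
    have hu := kk_unit hV g 1 one_ne_zero hk
    exact hn ⟨⟨hu.unit, fun x hx => (hg.2 ⟨x, hx⟩).symm⟩, by simp, rfl⟩

lemma sing_sum [Fintype (Module.End F V)] [Fintype (Module.End F V)ˣ] (hV : Module.finrank F V = Module.finrank F E) (hn : 2 ≤ Module.finrank F V)
    (θ : MulChar E ℂ) (hθ : Reg F θ) (ψ : AddChar F ℂ) (y : Module.End F V) (hy : ¬ IsUnit y) :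
    ∑ g : Module.End F V, cc (F := F) θ g * ψ (LinearMap.trace F V (y * g)) = 0 := by
  classical
  haveI : Nontrivial V := Module.nontrivial_of_finrank_pos (R := F) (by omega)
  obtain ⟨W, hWt, hWb, hyW⟩ : ∃ W : Submodule F V, W ≠ ⊤ ∧ W ≠ ⊥ ∧ LinearMap.range y ≤ W := by
    by_cases h0 : y = 0
    · obtain ⟨v, hv⟩ := exists_ne (0 : V)
      refine ⟨F ∙ v, ?_, ?_, ?_⟩
      · intro h
        have h1 := finrank_span_singleton (K := F) hv
        rw [h, finrank_top] at h1
        omega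
      · rwa [Ne, Submodule.span_singleton_eq_bot]
      · rw [h0, LinearMap.range_zero]; exact bot_le
    · refine ⟨LinearMap.range y, ?_, ?_, le_refl _⟩
      · intro h
        exact hy ((LinearMap.isUnit_iff_range_eq_top y).2 h)
      · rwa [Ne, LinearMap.range_eq_bot]
  have h1 := (cc_irred hV θ hθ).2 (fixW W) (sum_fixW hV θ W hWt hWb)
  rw [← sum_units (fun g : Module.End F V => cc (F := F) θ g * ψ (LinearMap.trace F V (y * g)))
    (fun g hg => by rw [cc_nonunit hV θ g hg, zero_mul])]
  have h2 : ∀ u : fixW W, ∑ g : (Module.End F V)ˣ, cc (F := F) θ (g : Module.End F V) * ψ (LinearMap.trace F V (y * g)) =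
      ∑ g : (Module.End F V)ˣ, cc (F := F) θ ((g * u : (Module.End F V)ˣ) : Module.End F V) * ψ (LinearMap.trace F V (y * g)) := by
    intro u
    rw [← Equiv.sum_comp (Equiv.mulRight (u : (Module.End F V)ˣ))]
    refine Finset.sum_congr rfl fun g _ => ?_
    rw [Equiv.coe_mulRight]
    congr 2
    rw [Units.val_mul, ← mul_assoc, LinearMap.trace_mul_comm, ← mul_assoc]
    congr 2
    apply LinearMap.ext
    intro v
    exact u.2 _ (hyW ⟨v, rfl⟩)
  have h3 : (Fintype.card (fixW W) : ℂ) * ∑ g : (Module.End F V)ˣ, cc (F := F) θ (g : Module.End F V) * ψ (LinearMap.trace F V (y * g)) = 0 := by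
    rw [← nsmul_eq_mul, ← Finset.card_univ, ← Finset.sum_const, Finset.sum_congr rfl (fun u _ => h2 u), Finset.sum_comm]
    refine Finset.sum_eq_zero fun g _ => ?_
    rw [← Finset.sum_mul, h1, zero_mul]
  exact (mul_eq_zero.1 h3).resolve_left (by exact_mod_cast Fintype.card_ne_zero)

/-- Claim A -/
lemma claimA [Fintype (Module.End F V)] (hV : Module.finrank F V = Module.finrank F E) (hn : 2 ≤ Module.finrank F V)
    (θ : MulChar E ℂ) (hθ : Reg F θ) (ψ : AddChar F ℂ) : ∃ l : ℂ, ∀ y : Module.End F V,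
    ∑ g : Module.End F V, cc (F := F) θ g * ψ (LinearMap.trace F V (y * g)) = l * cc (F := F) (θ⁻¹ : MulChar E ℂ) y := by
  classical
  haveI : Nontrivial V := Module.nontrivial_of_finrank_pos (R := F) (by omega)
  haveI : Fintype (Module.End F V)ˣ := inferInstance
  obtain ⟨l, hl⟩ := (cc_irred hV θ⁻¹ hθ.inv).1 (fun h => ψ (LinearMap.trace F V (h : Module.End F V))) (by
    intro g h
    rw [Units.val_mul, LinearMap.trace_mul_comm, ← Units.val_mul, ← mul_assoc, inv_mul_cancel, one_mul])
  refine ⟨l, fun y => ?_⟩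
  by_cases hy : IsUnit y
  · obtain ⟨y, rfl⟩ := hy
    rw [← hl, ← sum_units (fun g : Module.End F V => cc (F := F) θ g * ψ (LinearMap.trace F V (y * g)))
      (fun g hg => by rw [cc_nonunit hV θ g hg, zero_mul]), ← Equiv.sum_comp (Equiv.inv _)]
    refine Finset.sum_congr rfl fun g _ => ?_
    rw [Equiv.inv_apply, cc_inv, Units.val_mul, mul_comm]
  · rw [sing_sum hV hn θ hθ ψ y hy, cc_nonunit hV _ y hy, mul_zero]
end
end KL

open scoped BigOperators Polynomial

namespace KL
section
variable {F : Type*} [Field F] [Fintype F]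
variable {V : Type*} [AddCommGroup V] [Module F V] [FiniteDimensional F V] [Finite V]
variable (P : F[X]) [hp : Fact (Irreducible P)]

/-- coefficients of the relation -/
noncomputable def gco (Q : ℚ) (j : ℕ) : ℚ := (-1) ^ j / ∏ i ∈ Finset.range j, (Q ^ (i + 1) - 1)

lemma gco_top (Q : ℤ) (hQ : 1 < Q) (m : ℕ) (hm : 1 ≤ m) :
    gco Q m * (kap Q m : ℚ) = - 1 / ((Q : ℚ) ^ m - 1) := by
  have h := coefj_top Q hQ m hm
  have hm0 : (m : ℚ) ≠ 0 := by exact_mod_cast (by omega : m ≠ 0)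
  have h2 : coefj Q m = - (m * gco Q m) := by rw [coefj, gco, mul_div_assoc]
  rw [h2] at h
  apply mul_left_cancel₀ hm0
  rw [mul_div_assoc'] 
  linear_combination -h

lemma gco_expand [Nontrivial V] (g : Module.End F V) (hn : IsNilpotent (Polynomial.aeval g P)) :
    (0 : ℚ) = ∑ j ∈ Finset.range (Module.finrank F V / P.natDegree + 1),
      gco (((Fintype.card F : ℤ) ^ P.natDegree : ℤ) : ℚ) j *
      (Nat.card {φ : (Fin j → AdjoinRoot P) →ₗ[F] V // (∀ v, φ (mx P j v) = g (φ v)) ∧ Function.Injective φ} : ℚ) := by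
  have hd : 0 < P.natDegree := hp.out.natDegree_pos
  have hQ1 : (1 : ℤ) < (Fintype.card F : ℤ) ^ P.natDegree := one_lt_pow₀ (by exact_mod_cast Fintype.one_lt_card) hd.ne'
  have hs := (gj_sums ((((Fintype.card F : ℤ) ^ P.natDegree : ℤ)) : ℚ) (by exact_mod_cast hQ1) (Module.finrank F V / P.natDegree)
    (Module.finrank F (LinearMap.ker (Polynomial.aeval g P)) / P.natDegree) (by
      obtain ⟨c, hc⟩ := ker_dvd g P hp.out
      have := ker_pos g P hn
      rw [hc] at this ⊢
      rw [Nat.mul_div_cancel_left _ hd]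
      exact Nat.pos_of_mul_pos_left this) (Nat.div_le_div_right (Submodule.finrank_le _))).1
  rw [← hs]
  refine Finset.sum_congr rfl fun j _ => ?_
  have := count_emb P g j
  have h2 := congrArg (fun x : ℤ => (x : ℚ)) this
  simp only [Int.cast_natCast] at h2
  rw [h2, gj, gco]
  push_cast
  ring

lemma kk_total [Nontrivial V] [Fintype (Module.End F V)] (hdvd : P.natDegree ∣ Module.finrank F V) :
    ((Fintype.card F : ℚ) ^ Module.finrank F V - 1) * ∑ g : Module.End F V, (kk g P : ℚ) = (Nat.card (V ≃ₗ[F] V) : ℚ) := by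
  classical
  haveI := fin_adj P
  have hd : 0 < P.natDegree := hp.out.natDegree_pos
  set m := Module.finrank F V / P.natDegree with hm
  have hmd : m * P.natDegree = Module.finrank F V := Nat.div_mul_cancel hdvd
  have hV : 0 < Module.finrank F V := Module.finrank_pos
  have hm1 : 1 ≤ m := by
    rcases Nat.eq_zero_or_pos m with h | h
    · rw [h] at hmd; omega
    · exact h
  haveI hfin : ∀ j, Finite ((Fin j → AdjoinRoot P) →ₗ[F] V) := fun j =>
    Finite.of_injective (fun f => (f : (Fin j → AdjoinRoot P) → V)) DFunLike.coe_injective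
  haveI hft : ∀ j, Fintype ((Fin j → AdjoinRoot P) →ₗ[F] V) := fun j => Fintype.ofFinite _
  set Q : ℤ := (Fintype.card F : ℤ) ^ P.natDegree with hQ
  have hQ1 : 1 < Q := one_lt_pow₀ (by exact_mod_cast Fintype.one_lt_card) hd.ne'
  have h1 : ∀ g : Module.End F V, (0 : ℚ) = ∑ j ∈ Finset.range (m+1), gco (Q : ℚ) j *
      ∑ φ : (Fin j → AdjoinRoot P) →ₗ[F] V, if Function.Injective φ then
        (if ∀ v, φ (mx P j v) = g (φ v) then (kk g P : ℚ) else 0) else 0 := by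
    intro g
    by_cases hn : IsNilpotent (Polynomial.aeval g P)
    · have hex := gco_expand P g hn
      refine (zero_mul (kk g P : ℚ)).symm.trans ?_
      conv_lhs => rw [hex]
      rw [Finset.sum_mul]
      refine Finset.sum_congr rfl fun j _ => ?_
      rw [mul_assoc]
      congr 1
      rw [Nat.card_eq_fintype_card, Fintype.card_subtype, ← Finset.sum_filter, ← Finset.sum_filter, Finset.sum_const,
        Finset.filter_filter, nsmul_eq_mul]
      congr 3
      ext φ; simp [and_comm]
    · have : kk g P = 0 := by unfold kk; rw [if_neg hn]
      simp [this]
  have h1' : (0 : ℚ) = ∑ g : Module.End F V, ∑ j ∈ Finset.range (m+1), gco (Q : ℚ) j *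
      ∑ φ : (Fin j → AdjoinRoot P) →ₗ[F] V, if Function.Injective φ then
        (if ∀ v, φ (mx P j v) = g (φ v) then (kk g P : ℚ) else 0) else 0 := by
    rw [← Finset.sum_congr rfl (fun g _ => h1 g)]; simp
  rw [Finset.sum_comm] at h1'
  simp_rw [← Finset.mul_sum] at h1'
  have h2 : ∀ j, ∑ g : Module.End F V, ∑ φ : (Fin j → AdjoinRoot P) →ₗ[F] V, (if Function.Injective φ then
        (if ∀ v, φ (mx P j v) = g (φ v) then (kk g P : ℚ) else 0) else 0) =
      ∑ φ : (Fin j → AdjoinRoot P) →ₗ[F] V, if Function.Injective φ then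
        ∑ g ∈ Finset.univ.filter (fun g : Module.End F V => ∀ v, φ (mx P j v) = g (φ v)), (kk g P : ℚ) else 0 := by
    intro j
    rw [Finset.sum_comm]
    refine Finset.sum_congr rfl fun φ _ => ?_
    split_ifs with h
    · rw [Finset.sum_filter]
    · simp
  rw [Finset.sum_range_succ, Finset.sum_eq_single_of_mem 0 (Finset.mem_range.2 hm1)] at h1'
  · have hT : gco (Q : ℚ) 0 * (∑ g : Module.End F V, ∑ φ : (Fin 0 → AdjoinRoot P) →ₗ[F] V, (if Function.Injective φ then
        (if ∀ v, φ (mx P 0 v) = g (φ v) then (kk g P : ℚ) else 0) else 0)) = ∑ g : Module.End F V, (kk g P : ℚ) := by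
      have : gco (Q : ℚ) 0 = 1 := by simp [gco]
      rw [this, one_mul]
      refine Finset.sum_congr rfl fun g _ => ?_
      have huniq : ∀ φ : (Fin 0 → AdjoinRoot P) →ₗ[F] V, (if Function.Injective φ then
        (if ∀ v, φ (mx P 0 v) = g (φ v) then (kk g P : ℚ) else 0) else 0) = kk g P := by
        intro φ
        rw [if_pos (Function.injective_of_subsingleton _), if_pos]
        intro v
        rw [Subsingleton.elim v 0, map_zero, map_zero, map_zero]
      rw [Finset.sum_congr rfl (fun φ _ => huniq φ), Finset.sum_const, Finset.card_univ]
      have : Fintype.card ((Fin 0 → AdjoinRoot P) →ₗ[F] V) = 1 := Fintype.card_eq_one_iff.2 ⟨0, fun φ => by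
        apply LinearMap.ext; intro v; rw [Subsingleton.elim v 0, map_zero, map_zero]⟩
      rw [this, one_smul]
    rw [h2 m] at h1'
    have h1'' := h1'.trans (congrArg (· + _) (Eq.trans (by congr!) hT))
    clear h1'
    have h1' := h1''
    clear h1''
    beta_reduce at h1'
    have hfr : Module.finrank F (Fin m → AdjoinRoot P) = Module.finrank F V := by rw [finrank_mx, hmd]
    have h3 : ∀ φ : (Fin m → AdjoinRoot P) →ₗ[F] V, (if Function.Injective φ then
        ∑ g ∈ Finset.univ.filter (fun g : Module.End F V => ∀ v, φ (mx P m v) = g (φ v)), (kk g P : ℚ) else 0) =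
        if Function.Injective φ then (kap Q m : ℚ) else 0 := by
      intro φ
      split_ifs with h
      · let e : (Fin m → AdjoinRoot P) ≃ₗ[F] V := LinearEquiv.ofInjectiveOfFinrankEq φ h hfr
        have he : ∀ v, e v = φ v := fun v => rfl
        rw [Finset.sum_eq_single (e.conj (mx P m))]
        · rw [kk_conj]
          unfold kk
          rw [mx_aeval, if_pos IsNilpotent.zero, LinearMap.ker_zero, finrank_top, hfr]
        · intro g hg hne
          exfalso; apply hne
          apply LinearMap.ext
          intro v
          obtain ⟨w, rfl⟩ := e.surjective v
          have := (Finset.mem_filter.1 hg).2 w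
          rw [LinearEquiv.conj_apply]
          simp only [LinearMap.comp_apply, LinearEquiv.coe_coe, LinearEquiv.symm_apply_apply]
          rw [he, he, this]
        · intro hh
          exfalso; apply hh
          rw [Finset.mem_filter]
          refine ⟨Finset.mem_univ _, fun v => ?_⟩
          rw [LinearEquiv.conj_apply, ← he, ← he]
          simp
      · rfl
    rw [Finset.sum_congr rfl fun φ _ => h3 φ, ← Finset.sum_filter, Finset.sum_const, nsmul_eq_mul] at h1'
    have h4 : (Finset.univ.filter fun φ : (Fin m → AdjoinRoot P) →ₗ[F] V => Function.Injective φ).card = Nat.card (V ≃ₗ[F] V) := by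
      let e0 : (Fin m → AdjoinRoot P) ≃ₗ[F] V := LinearEquiv.ofFinrankEq _ _ hfr
      rw [← Fintype.card_subtype, ← Nat.card_eq_fintype_card]
      exact Nat.card_congr
        { toFun := fun φ => e0.symm.trans (LinearEquiv.ofInjectiveOfFinrankEq φ.1 φ.2 hfr)
          invFun := fun e => ⟨(e0.trans e).toLinearMap, (e0.trans e).injective⟩
          left_inv := fun φ => by apply Subtype.ext; apply LinearMap.ext; intro v; simp; rfl
          right_inv := fun e => by apply LinearEquiv.ext; intro v; simp; exact congrArg e (e0.apply_symm_apply v) }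
    rw [h4] at h1'
    have h5 := gco_top Q hQ1 m hm1
    have h6 : (Q : ℚ) ^ m = (Fintype.card F : ℚ) ^ Module.finrank F V := by
      rw [hQ, ← hmd, mul_comm m, pow_mul]; push_cast; rfl
    rw [h6] at h5
    have h7 : (Fintype.card F : ℚ) ^ Module.finrank F V - 1 ≠ 0 := by
      have : (1 : ℚ) < (Fintype.card F : ℚ) ^ Module.finrank F V :=
        one_lt_pow₀ (by exact_mod_cast Fintype.one_lt_card) hV.ne'
      linarith
    rw [eq_div_iff h7] at h5
    linear_combination (-((Fintype.card F : ℚ) ^ Module.finrank F V - 1)) * h1' - (Nat.card (V ≃ₗ[F] V) : ℚ) * h5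
  · intro j hj hj0
    have hjlt : j < m := Finset.mem_range.1 hj
    rw [h2 j, Finset.sum_eq_zero, mul_zero]
    intro φ _
    split_ifs with h
    · haveI : Nonempty (Fin j) := ⟨⟨0, Nat.pos_of_ne_zero hj0⟩⟩
      haveI : Nontrivial (AdjoinRoot P) := inferInstance
      haveI : Module.Finite F (Fin j → AdjoinRoot P) := Module.Finite.of_finite
      have := cusp_sub P hp.out (mx P j) (mx_aeval P j) φ h (by
        intro hs
        have h8 := (LinearEquiv.ofBijective φ ⟨h, hs⟩).finrank_eq
        rw [finrank_mx, ← hmd] at h8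
        exact hjlt.ne (Nat.eq_of_mul_eq_mul_right hd h8))
      exact_mod_cast this
    · rfl
end
end KL

open scoped BigOperators Polynomial

namespace KL
section
variable {F : Type*} [Field F] [Fintype F]
variable {V : Type*} [AddCommGroup V] [Module F V] [FiniteDimensional F V] [Finite V]
variable {E : Type*} [Field E] [Algebra F E] [Fintype E] [FiniteDimensional F E]

/-- total mass -/
noncomputable def TT (F V : Type*) [Field F] [Fintype F] [AddCommGroup V] [Module F V] : ℂ :=
  (Nat.card (V ≃ₗ[F] V) : ℂ) / ((Fintype.card F : ℂ) ^ Module.finrank F V - 1)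

/-- the constant -/
noncomputable def CC (F V : Type*) [Field F] [Fintype F] [AddCommGroup V] [Module F V] : ℂ :=
  TT F V / (kap (Fintype.card F : ℤ) (Module.finrank F V) : ℂ)

/-- Fourier transform on E -/
noncomputable def hat (ψ : AddChar F ℂ) (h : E → ℂ) (η : E) : ℂ := ∑ ξ : E, h ξ * ψ (Algebra.trace F E (ξ * η))

lemma qn_ne (n : ℕ) (hn : 0 < n) : (Fintype.card F : ℂ) ^ n - 1 ≠ 0 := by
  have : (1 : ℤ) < (Fintype.card F : ℤ) ^ n :=
    one_lt_pow₀ (by exact_mod_cast Fintype.one_lt_card) hn.ne'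
  have h2 : ((Fintype.card F : ℤ) ^ n - 1 : ℤ) ≠ 0 := by omega
  exact_mod_cast h2

lemma kap_ne (n : ℕ) : (kap (Fintype.card F : ℤ) n : ℂ) ≠ 0 := by
  have : kap (Fintype.card F : ℤ) n ≠ 0 := by
    unfold kap
    rw [Finset.prod_ne_zero_iff]
    intro i _
    have : (1 : ℤ) < (Fintype.card F : ℤ) ^ (i+1) :=
      one_lt_pow₀ (by exact_mod_cast Fintype.one_lt_card) (by omega)
    omega
  exact_mod_cast this

lemma TT_eq [Fintype (Module.End F V)] (hV : Module.finrank F V = Module.finrank F E) (ξ : E) :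
    ∑ g : Module.End F V, (kk g (minpoly F ξ) : ℂ) = TT F V := by
  have hpos : 0 < Module.finrank F V := by rw [hV]; exact Module.finrank_pos
  haveI : Nontrivial V := Module.nontrivial_of_finrank_pos hpos
  haveI : Fact (Irreducible (minpoly F ξ)) := ⟨minpoly.irreducible (Algebra.IsIntegral.isIntegral ξ)⟩
  have := kk_total (V := V) (minpoly F ξ) (by rw [hV]; exact minpoly_deg_dvd ξ)
  have h2 := congrArg (fun x : ℚ => (x : ℂ)) this
  push_cast at h2
  rw [TT, eq_div_iff (qn_ne _ hpos), mul_comm]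
  exact h2

lemma TT_ne : TT F V ≠ 0 ∨ Module.finrank F V = 0 := by
  rcases Nat.eq_zero_or_pos (Module.finrank F V) with h | h
  · exact Or.inr h
  · left
    unfold TT
    apply div_ne_zero _ (qn_ne _ h)
    haveI : Finite (V ≃ₗ[F] V) := Finite.of_injective (fun e => (e : V → V)) DFunLike.coe_injective
    exact_mod_cast Nat.card_pos.ne'

lemma kk_psi (hV : Module.finrank F V = Module.finrank F E) (ψ : AddChar F ℂ) (g : Module.End F V) (ξ : E) :
    (kk g (minpoly F ξ) : ℂ) * ψ (LinearMap.trace F V g) = (kk g (minpoly F ξ) : ℂ) * ψ (Algebra.trace F E ξ) := by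
  by_cases h : kk g (minpoly F ξ) = 0
  · simp [h]
  · rw [kk_trace hV g ξ (kk_ne_zero h)]

lemma sum_cc_psi [Fintype (Module.End F V)] (hV : Module.finrank F V = Module.finrank F E) (ψ : AddChar F ℂ) (h : E → ℂ) :
    ∑ g : Module.End F V, cc (F := F) h g * ψ (LinearMap.trace F V g) = TT F V * ∑ ξ : E, h ξ * ψ (Algebra.trace F E ξ) := by
  simp_rw [cc, Finset.sum_mul]
  rw [Finset.sum_comm, Finset.mul_sum]
  refine Finset.sum_congr rfl fun ξ _ => ?_
  simp_rw [mul_assoc, kk_psi hV, ← mul_assoc]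
  rw [← Finset.sum_mul, ← Finset.mul_sum, TT_eq hV]
  ring

lemma cc_one (hV : Module.finrank F V = Module.finrank F E) (h : E → ℂ) :
    cc (F := F) h (1 : Module.End F V) = h 1 * (kap (Fintype.card F : ℤ) (Module.finrank F V) : ℂ) := by
  classical
  have hpos : 0 < Module.finrank F V := by rw [hV]; exact Module.finrank_pos
  haveI : Nontrivial V := Module.nontrivial_of_finrank_pos hpos
  obtain ⟨w, hw⟩ := exists_ne (0 : V)
  rw [cc, Finset.sum_eq_single (1 : E)]
  · congr 2
    have h1 : minpoly F (1 : E) = Polynomial.X - Polynomial.C 1 := by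
      rw [minpoly.one]; simp
    have h2 : Polynomial.aeval (1 : Module.End F V) (minpoly F (1 : E)) = 0 := by rw [h1]; simp
    rw [kk, h2, if_pos IsNilpotent.zero, LinearMap.ker_zero, finrank_top, h1, Polynomial.natDegree_X_sub_C, pow_one, Nat.div_one]
  · intro ξ _ hξ
    by_cases hk : kk (1 : Module.End F V) (minpoly F ξ) = 0
    · rw [hk]; simp
    · exfalso; apply hξ
      have := kk_fix (1 : Module.End F V) w hw 1 (by simp) ξ hk
      simpa using this
  · intro hh; exact absurd (Finset.mem_univ _) hh

lemma hat_char (ψ : AddChar F ℂ) (θ : MulChar E ℂ) (hθ : θ ≠ 1) (η : E) :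
    hat ψ θ η = (∑ ξ : E, θ ξ * ψ (Algebra.trace F E ξ)) * (θ⁻¹ : MulChar E ℂ) η := by
  unfold hat
  by_cases h0 : η = 0
  · rw [h0, MulChar.map_zero, mul_zero]
    simp [MulChar.sum_eq_zero_of_ne_one hθ]
  · rw [Finset.sum_mul]
    refine Fintype.sum_equiv (Equiv.mulRight₀ η h0) _ _ fun ξ => ?_
    rw [Equiv.mulRight₀_apply, map_mul θ, MulChar.inv_apply']
    have : θ η * θ η⁻¹ = 1 := by rw [← map_mul, mul_inv_cancel₀ h0, map_one]
    linear_combination (-(θ ξ * ψ (Algebra.trace F E (ξ * η)))) * this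

/-- the identity of claim C -/
def ClaimC (F V : Type*) {E : Type*} [Field F] [Fintype F] [AddCommGroup V] [Module F V] [FiniteDimensional F V] [Field E] [Algebra F E] [Fintype E]
    [Fintype (Module.End F V)] (ψ : AddChar F ℂ) (h : E → ℂ) : Prop :=
  ∀ y : Module.End F V, ∑ g : Module.End F V, cc (F := F) h g * ψ (LinearMap.trace F V (y * g)) = CC F V * cc (F := F) (hat ψ h) y

lemma claimB [Fintype (Module.End F V)] (hV : Module.finrank F V = Module.finrank F E) (hn : 2 ≤ Module.finrank F V)
    (θ : MulChar E ℂ) (hθ1 : θ ≠ 1) (hθ : Reg F θ) (ψ : AddChar F ℂ) : ClaimC F V ψ θ := by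
  obtain ⟨l, hl⟩ := claimA hV hn θ hθ ψ
  intro y
  rw [hl y]
  have h1 := hl 1
  simp_rw [one_mul] at h1
  rw [sum_cc_psi hV, cc_one hV] at h1
  have h2 : cc (F := F) (hat ψ θ) y = (∑ ξ : E, θ ξ * ψ (Algebra.trace F E ξ)) * cc (F := F) (θ⁻¹ : MulChar E ℂ) y := by
    rw [cc, cc, Finset.mul_sum]
    refine Finset.sum_congr rfl fun ξ _ => ?_
    rw [hat_char ψ θ hθ1]; ring
  rw [h2, CC]
  have h3 := kap_ne (F := F) (Module.finrank F V)
  field_simp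
  simp only [map_one, one_mul] at h1
  linear_combination (-cc (F := F) (θ⁻¹ : MulChar E ℂ) y) * h1
end
end KL

open scoped BigOperators Polynomial

namespace KL
section
variable {F : Type*} [Field F] [Fintype F]
variable {V : Type*} [AddCommGroup V] [Module F V] [FiniteDimensional F V] [Finite V]
variable {E : Type*} [Field E] [Algebra F E] [Fintype E] [FiniteDimensional F E]

lemma exists_k0 (hn : 2 ≤ Module.finrank F E) : ∃ k0 : E, k0 ≠ 0 ∧ k0 ≠ 1 ∧
    ∀ d ∈ (Module.finrank F E).properDivisors, ∃ y : Eˣ, k0 = (y : E) ^ (Fintype.card F ^ d - 1) := by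
  classical
  set n := Module.finrank F E with hnn
  set q := Fintype.card F with hq
  have hq1 : 1 < q := Fintype.one_lt_card
  obtain ⟨γ, hγ⟩ := IsCyclic.exists_generator (α := Eˣ)
  have hord : orderOf γ = q ^ n - 1 := by
    rw [orderOf_eq_card_of_forall_mem_zpowers hγ, Nat.card_eq_fintype_card, Fintype.card_units, Module.card_eq_pow_finrank (K := F) (V := E)]
  have hdz : ((Polynomial.cyclotomic n ℤ).eval (q : ℤ)) ∣ (q : ℤ) ^ n - 1 := by
    have := Polynomial.eval_dvd (x := (q : ℤ)) (Polynomial.cyclotomic.dvd_X_pow_sub_one n ℤ)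
    simpa using this
  set Φ := ((Polynomial.cyclotomic n ℤ).eval (q : ℤ)).natAbs with hΦ
  have hN : ((q ^ n - 1 : ℕ) : ℤ) = (q : ℤ) ^ n - 1 := by
    rw [Nat.cast_sub (Nat.one_le_pow _ _ (by omega))]; push_cast; rfl
  have hd : Φ ∣ q ^ n - 1 := by
    rw [← hN] at hdz
    exact Int.natAbs_dvd_natAbs.2 hdz
  obtain ⟨M, hM⟩ := hd
  have hΦ1 : 1 < Φ := by
    have := Polynomial.sub_one_lt_natAbs_cyclotomic_eval (n := n) (q := q) (by omega) (by omega)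
    omega
  have hpos : 0 < q ^ n - 1 := by
    have : 1 < q ^ n := Nat.one_lt_pow (by omega) hq1
    omega
  have hM0 : 0 < M := by
    rcases Nat.eq_zero_or_pos M with h | h
    · rw [h] at hM; omega
    · exact h
  refine ⟨((γ ^ M : Eˣ) : E), Units.ne_zero _, ?_, ?_⟩
  · intro h
    have h1 : γ ^ M = 1 := Units.ext h
    have h2 := orderOf_dvd_of_pow_eq_one h1
    rw [hord, hM] at h2
    have h3 := Nat.le_of_dvd hM0 h2
    nlinarith
  · intro d hd
    have hdd := Polynomial.X_pow_sub_one_mul_cyclotomic_dvd_X_pow_sub_one_of_dvd ℤ hd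
    have h4 := Polynomial.eval_dvd (x := (q : ℤ)) hdd
    simp only [Polynomial.eval_mul, Polynomial.eval_sub, Polynomial.eval_pow, Polynomial.eval_X, Polynomial.eval_one] at h4
    have h5 : (q ^ d - 1) * Φ ∣ q ^ n - 1 := by
      have h6 := Int.natAbs_dvd_natAbs.2 h4
      rw [Int.natAbs_mul, ← hN, Int.natAbs_natCast] at h6
      have h7 : ((q ^ d - 1 : ℕ) : ℤ) = (q : ℤ) ^ d - 1 := by
        rw [Nat.cast_sub (Nat.one_le_pow _ _ (by omega))]; push_cast; rfl
      rw [← h7, Int.natAbs_natCast] at h6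
      exact h6
    rw [hM, mul_comm Φ M] at h5
    obtain ⟨c, hc⟩ := Nat.dvd_of_mul_dvd_mul_right (by omega) h5
    refine ⟨γ ^ c, ?_⟩
    rw [hc, mul_comm, pow_mul]
    simp

lemma reg_of_k0 (k0 : E)
    (hk : ∀ d ∈ (Module.finrank F E).properDivisors, ∃ y : Eˣ, k0 = (y : E) ^ (Fintype.card F ^ d - 1))
    (θ : MulChar E ℂ) (hθ : θ k0 ≠ 1) : Reg F θ := by
  intro σ hσ
  by_contra hcon
  push Not at hcon
  obtain ⟨⟨i, hi⟩, rfl⟩ := (FiniteField.bijective_frobeniusAlgEquivOfAlgebraic_pow F E).2 σ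
  have hi0 : i ≠ 0 := by rintro rfl; exact hσ (by simp)
  have hs : ∀ x : E, (FiniteField.frobeniusAlgEquivOfAlgebraic F E ^ i) x = x ^ (Fintype.card F ^ i) := by
    intro x
    have := congrFun (FiniteField.coe_frobeniusAlgEquivOfAlgebraic_iterate F E i) x
    rw [AlgEquiv.coe_pow]
    exact this
  have hq1 : 1 < Fintype.card F := Fintype.one_lt_card
  set n := Module.finrank F E
  obtain ⟨y, hy⟩ := hk (Nat.gcd i n) (by
    rw [Nat.mem_properDivisors]
    exact ⟨Nat.gcd_dvd_right _ _, lt_of_le_of_lt (Nat.gcd_le_left _ (Nat.pos_of_ne_zero hi0)) hi⟩)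
  apply hθ
  rw [hy, map_pow, ← Nat.pow_sub_one_gcd_pow_sub_one, pow_gcd_eq_one]
  have hne : θ y ≠ 0 := by
    have := (y.isUnit.map θ).ne_zero
    exact this
  constructor
  · have h1 := hcon y
    simp only [hs] at h1
    rw [map_pow] at h1
    have h2 : Fintype.card F ^ i = (Fintype.card F ^ i - 1) + 1 := by
      have := Nat.one_le_pow i (Fintype.card F) (by omega)
      omega
    rw [h2, pow_succ] at h1
    exact mul_right_cancel₀ hne (by rw [one_mul]; exact h1)
  · rw [← map_pow, ← Module.card_eq_pow_finrank (K := F) (V := E), FiniteField.pow_card_sub_one_eq_one _ y.ne_zero, map_one]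

variable [Fintype (Module.End F V)]

lemma cc_add (h h' : E → ℂ) (g : Module.End F V) : cc (F := F) (h + h') g = cc (F := F) h g + cc (F := F) h' g := by
  simp only [cc, Pi.add_apply, add_mul, Finset.sum_add_distrib]

lemma cc_smul (c : ℂ) (h : E → ℂ) (g : Module.End F V) : cc (F := F) (c • h) g = c * cc (F := F) h g := by
  simp only [cc, Pi.smul_apply, smul_eq_mul, mul_assoc, Finset.mul_sum]

lemma hat_add (ψ : AddChar F ℂ) (h h' : E → ℂ) : hat ψ (h + h') = hat ψ h + hat ψ h' := by
  funext η
  simp only [hat, Pi.add_apply, add_mul, Finset.sum_add_distrib]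

lemma hat_smul (ψ : AddChar F ℂ) (c : ℂ) (h : E → ℂ) : hat ψ (c • h) = c • hat ψ h := by
  funext η
  simp only [hat, Pi.smul_apply, smul_eq_mul, mul_assoc, Finset.mul_sum]

/-- functions satisfying claim C -/
def LL (F V E : Type*) [Field F] [Fintype F] [AddCommGroup V] [Module F V] [FiniteDimensional F V] [Finite V] [Field E] [Algebra F E] [Fintype E]
    [FiniteDimensional F E] [Fintype (Module.End F V)] (ψ : AddChar F ℂ) : Submodule ℂ (E → ℂ) where
  carrier := {h | ClaimC F V ψ h}
  add_mem' := by
    intro a b ha hb y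
    simp only [cc_add, add_mul, Finset.sum_add_distrib, hat_add]
    rw [ha y, hb y]; ring
  zero_mem' := by
    intro y
    simp [cc, hat]
  smul_mem' := by
    intro c a ha y
    simp only [cc_smul, hat_smul, mul_assoc]
    rw [← Finset.mul_sum, ha y]; ring

lemma claimC_shift (hV : Module.finrank F V = Module.finrank F E) (ψ : AddChar F ℂ) (h : E → ℂ) (hc : ClaimC F V ψ h) (a : F) :
    ClaimC F V ψ (fun x => h (x - algebraMap F E a)) := by
  intro y
  have h1 : ∀ g : Module.End F V, cc (F := F) (fun x => h (x - algebraMap F E a)) (g + algebraMap F _ a) = cc (F := F) h g := by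
    intro g
    rw [cc, cc]
    symm
    refine Fintype.sum_equiv (Equiv.addRight (algebraMap F E a)) _ _ fun ξ => ?_
    rw [Equiv.coe_addRight, kk_add, add_sub_cancel_right]
  have h2 : hat ψ (fun x => h (x - algebraMap F E a)) = fun η => ψ (a * Algebra.trace F E η) * hat ψ h η := by
    funext η
    rw [hat, hat, Finset.mul_sum]
    symm
    refine Fintype.sum_equiv (Equiv.addRight (algebraMap F E a)) _ _ fun ξ => ?_
    rw [Equiv.coe_addRight, add_sub_cancel_right, add_mul, map_add, AddChar.map_add_eq_mul, ← Algebra.smul_def, map_smul, smul_eq_mul]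
    ring
  have h3 : cc (F := F) (fun η => ψ (a * Algebra.trace F E η) * hat ψ h η) y = ψ (a * LinearMap.trace F V y) * cc (F := F) (hat ψ h) y := by
    rw [cc, cc, Finset.mul_sum]
    refine Finset.sum_congr rfl fun ξ _ => ?_
    by_cases h0 : kk y (minpoly F ξ) = 0
    · simp [h0]
    · rw [kk_trace hV y ξ (kk_ne_zero h0)]; ring
  rw [h2, h3]
  have h4 := hc y
  rw [← mul_assoc, mul_comm (CC F V), mul_assoc, ← h4, Finset.mul_sum]
  symm
  refine Fintype.sum_equiv (Equiv.addRight (algebraMap F (Module.End F V) a)) _ _ fun g => ?_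
  rw [Equiv.coe_addRight, h1, mul_add, map_add, AddChar.map_add_eq_mul, ← Algebra.commutes, ← Algebra.smul_def, map_smul, smul_eq_mul]
  ring

lemma claimC_twist (hV : Module.finrank F V = Module.finrank F E) (ψ : AddChar F ℂ) (h : E → ℂ) (hc : ClaimC F V ψ h) (b : F) :
    ClaimC F V ψ (fun x => h x * ψ (b * Algebra.trace F E x)) := by
  intro y
  have h1 : ∀ g : Module.End F V, cc (F := F) (fun x => h x * ψ (b * Algebra.trace F E x)) g = ψ (b * LinearMap.trace F V g) * cc (F := F) h g := by
    intro g
    rw [cc, cc, Finset.mul_sum]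
    refine Finset.sum_congr rfl fun ξ _ => ?_
    by_cases h0 : kk g (minpoly F ξ) = 0
    · simp [h0]
    · rw [kk_trace hV g ξ (kk_ne_zero h0)]; ring
  have h2 : hat ψ (fun x => h x * ψ (b * Algebra.trace F E x)) = fun η => hat ψ h (η + algebraMap F E b) := by
    funext η
    rw [hat, hat]
    refine Finset.sum_congr rfl fun ξ _ => ?_
    rw [mul_add, map_add, AddChar.map_add_eq_mul, ← Algebra.commutes, ← Algebra.smul_def, map_smul, smul_eq_mul]
    ring
  have h3 : cc (F := F) (fun η => hat ψ h (η + algebraMap F E b)) y = cc (F := F) (hat ψ h) (y + algebraMap F _ b) := by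
    rw [cc, cc]
    refine Fintype.sum_equiv (Equiv.addRight (algebraMap F E b)) _ _ fun ξ => ?_
    rw [Equiv.coe_addRight, kk_add]
  rw [h2, h3, ← hc]
  refine Finset.sum_congr rfl fun g _ => ?_
  rw [h1, add_mul, map_add, AddChar.map_add_eq_mul, ← Algebra.smul_def, map_smul, smul_eq_mul]
  ring
end
end KL

open scoped BigOperators Polynomial

namespace KL
section
variable {F : Type*} [Field F] [Fintype F]
variable {V : Type*} [AddCommGroup V] [Module F V] [FiniteDimensional F V] [Finite V]
variable {E : Type*} [Field E] [Algebra F E] [Fintype E] [FiniteDimensional F E]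

lemma mulchar_complete (u : E → ℂ) (hu : ∀ θ : MulChar E ℂ, ∑ x, θ x * u x = 0) (x0 : E) (hx0 : x0 ≠ 0) : u x0 = 0 := by
  classical
  haveI : Fintype (MulChar E ℂ) := Fintype.ofFinite _
  have horth : ∀ z : E, z ≠ 1 → ∑ θ : MulChar E ℂ, θ z = 0 := by
    intro z hz
    obtain ⟨χ, hχ⟩ := MulChar.exists_apply_ne_one_of_hasEnoughRootsOfUnity E ℂ hz
    have h1 : ∑ θ : MulChar E ℂ, θ z = χ z * ∑ θ : MulChar E ℂ, θ z := by
      rw [Finset.mul_sum]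
      symm
      refine Fintype.sum_equiv (Equiv.mulLeft χ) _ _ fun θ => ?_
      rw [Equiv.coe_mulLeft, MulChar.mul_apply]
    by_contra h0
    apply hχ
    exact mul_right_cancel₀ h0 (by rw [one_mul]; exact h1.symm)
  have h2 : ∑ θ : MulChar E ℂ, θ x0⁻¹ * ∑ x, θ x * u x = 0 := by simp [hu]
  simp_rw [Finset.mul_sum] at h2
  rw [Finset.sum_comm, Finset.sum_eq_single x0] at h2
  · have h3 : ∀ θ : MulChar E ℂ, θ x0⁻¹ * (θ x0 * u x0) = u x0 := by
      intro θ
      rw [← mul_assoc, ← map_mul, inv_mul_cancel₀ hx0, map_one, one_mul]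
    rw [Finset.sum_congr rfl fun θ _ => h3 θ, Finset.sum_const, nsmul_eq_mul] at h2
    rcases mul_eq_zero.1 h2 with h | h
    · exfalso
      rw [Nat.cast_eq_zero, Finset.card_eq_zero] at h
      exact Finset.univ_nonempty.ne_empty h
    · exact h
  · intro x _ hx
    simp_rw [← mul_assoc, ← map_mul]
    rw [← Finset.sum_mul, horth, zero_mul]
    intro h
    apply hx
    field_simp at h
    exact h
  · intro h; exact absurd (Finset.mem_univ _) h

lemma inv_of_orth (k0 : E) (hk0 : k0 ≠ 0) (f : E → ℂ) (hf : ∀ θ : MulChar E ℂ, θ k0 ≠ 1 → ∑ x, θ x * f x = 0) (x : E) (hx : x ≠ 0) :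
    f (k0 * x) = f x := by
  have := mulchar_complete (fun x => f (k0 * x) - f x) (fun θ => by
    by_cases hθ : θ k0 = 1
    · simp_rw [mul_sub]
      rw [Finset.sum_sub_distrib, sub_eq_zero]
      refine Fintype.sum_equiv (Equiv.mulLeft₀ k0 hk0) _ _ fun x => ?_
      rw [Equiv.mulLeft₀_apply, map_mul, hθ, one_mul]
    · simp_rw [mul_sub]
      rw [Finset.sum_sub_distrib, hf θ hθ, sub_zero]
      have hne : θ k0 ≠ 0 := ((Units.mk0 k0 hk0).isUnit.map θ).ne_zero
      apply mul_left_cancel₀ hne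
      rw [mul_zero, ← hf θ hθ, Finset.mul_sum]
      refine Fintype.sum_equiv (Equiv.mulLeft₀ k0 hk0) _ _ fun x => ?_
      rw [Equiv.mulLeft₀_apply, map_mul, mul_assoc]) x hx
  exact sub_eq_zero.1 this

/-- indicator of trace via averaging -/
lemma psi_avg [DecidableEq F] (ψ : AddChar F ℂ) (hψ : ∃ a, ψ a ≠ 1) (t c : F) :
    ∑ b : F, ψ (b * t) * ψ (- (b * c)) = if t = c then (Fintype.card F : ℂ) else 0 := by
  have hp : ψ.IsPrimitive := AddChar.IsPrimitive.of_ne_one (by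
    obtain ⟨a, ha⟩ := hψ
    intro h; rw [h] at ha; exact ha rfl)
  have := AddChar.sum_mulShift (t - c) hp
  simp_rw [sub_eq_zero] at this
  push_cast at this
  rw [← this]
  refine Finset.sum_congr rfl fun b _ => ?_
  rw [← AddChar.map_add_eq_mul]; congr 1; ring

lemma trace_k0 (hn : 2 ≤ Module.finrank F E) (k0 : E) (hk1 : k0 ≠ 1)
    (hk : ∀ d ∈ (Module.finrank F E).properDivisors, ∃ y : Eˣ, k0 = (y : E) ^ (Fintype.card F ^ d - 1))
    (htr : ∀ P : F[X], Algebra.trace F E (Polynomial.aeval k0 P) = 0) : False := by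
  classical
  let K := IntermediateField.adjoin F {k0}
  haveI : Fintype K := Fintype.ofFinite _
  have h1 : ∀ e : K, Algebra.trace F E (e : E) = 0 := by
    intro e
    have he : (e : E) ∈ Algebra.adjoin F {k0} := by
      rw [← IntermediateField.adjoin_simple_toSubalgebra_of_isAlgebraic (Algebra.IsAlgebraic.isAlgebraic k0)]
      exact e.2
    rw [Algebra.adjoin_singleton_eq_range_aeval] at he
    obtain ⟨P, hP⟩ := he
    rw [← hP]
    exact htr P
  have h2 : (Module.finrank K E : F) = 0 := by
    obtain ⟨e, he⟩ := Algebra.trace_surjective F K 1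
    have h3 := h1 e
    rw [← Algebra.trace_trace (S := K)] at h3
    have h4 : Algebra.trace K E (e : E) = Module.finrank K E • e := Algebra.trace_algebraMap e
    rw [h4, map_nsmul, he, nsmul_eq_mul, mul_one] at h3
    exact h3
  obtain ⟨p, hchar⟩ := CharP.exists F
  haveI := hchar
  haveI hpp : Fact p.Prime := ⟨CharP.char_is_prime F p⟩
  haveI : CharP E p := charP_of_injective_algebraMap (algebraMap F E).injective p
  rw [CharP.cast_eq_zero_iff F p] at h2
  obtain ⟨m, hm⟩ := h2
  have htow := Module.finrank_mul_finrank F K E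
  set dK := Module.finrank F K with hdK
  have hn0 : 0 < Module.finrank F E := by omega
  have hp2 : 2 ≤ p := hpp.out.two_le
  rw [hm] at htow
  have hpos : 0 < dK * m := by
    rcases Nat.eq_zero_or_pos (dK * m) with h | h
    · have : dK * (p * m) = p * (dK * m) := by ring
      rw [this, h, mul_zero] at htow; omega
    · exact h
  obtain ⟨y, hy⟩ := hk (dK * m) (by
    rw [Nat.mem_properDivisors]
    refine ⟨⟨p, by rw [← htow]; ring⟩, ?_⟩
    rw [← htow]; nlinarith)
  set R := Fintype.card F ^ (dK * m) with hR
  have hR1 : 1 ≤ R := Nat.one_le_pow _ _ Fintype.card_pos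
  have hkR : k0 ^ R = k0 := by
    have hkK : k0 ∈ K := IntermediateField.mem_adjoin_simple_self F k0
    have h5 := FiniteField.pow_card_pow m (⟨k0, hkK⟩ : K)
    rw [Module.card_eq_pow_finrank (K := F) (V := K), ← pow_mul] at h5
    have := congrArg (fun x : K => (x : E)) h5
    simpa using this
  have hkRj : ∀ j, k0 ^ (R ^ j) = k0 := by
    intro j
    induction j with
    | zero => simp
    | succ j ih => rw [pow_succ, pow_mul, ih, hkR]
  have h6 : k0 ^ p = 1 := by
    have h7 : k0 ^ (∑ j ∈ Finset.range p, R ^ j) = 1 := by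
      rw [hy, ← pow_mul]
      have h8 : (R - 1) * ∑ j ∈ Finset.range p, R ^ j = Fintype.card E - 1 := by
        rw [Module.card_eq_pow_finrank (K := F) (V := E), ← htow, show dK * (p * m) = (dK * m) * p by ring, pow_mul, ← hR]
        rw [mul_comm, geom_sum_mul_of_one_le hR1]
      rw [h8]
      exact FiniteField.pow_card_sub_one_eq_one _ y.ne_zero
    rw [← Finset.prod_pow_eq_pow_sum] at h7
    simp_rw [hkRj] at h7
    simpa using h7
  apply hk1
  have h9 : (k0 - 1) ^ p = 0 := by rw [sub_pow_char, h6, one_pow, sub_self]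
  exact sub_eq_zero.1 (pow_eq_zero_iff (by omega) |>.1 h9)
end
end KL

open scoped BigOperators Polynomial

namespace KL
section
variable {F : Type*} [Field F] [Fintype F]
variable {V : Type*} [AddCommGroup V] [Module F V] [FiniteDimensional F V] [Finite V]
variable {E : Type*} [Field E] [Algebra F E] [Fintype E] [FiniteDimensional F E]

lemma claimC_big [Fintype (Module.End F V)] (hV : Module.finrank F V = Module.finrank F E) (hn : 2 ≤ Module.finrank F V)
    (ψ : AddChar F ℂ) (hψ : ∃ a, ψ a ≠ 1) (h : E → ℂ) : ClaimC F V ψ h := by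
  classical
  suffices hL : LL F V E ψ = ⊤ by
    have : h ∈ LL F V E ψ := by rw [hL]; trivial
    exact this
  by_contra hne
  obtain ⟨f, hf0, hf⟩ := Submodule.exists_le_ker_of_lt_top _ (lt_top_iff_ne_top.2 hne)
  have hnE : 2 ≤ Module.finrank F E := hV ▸ hn
  obtain ⟨k0, hk0, hk1, hk⟩ := exists_k0 (F := F) (E := E) hnE
  let D : E → ℂ := fun x => f (Pi.single x 1)
  have hfD : ∀ h : E → ℂ, f h = ∑ x, h x * D x := by
    intro h
    conv_lhs => rw [pi_eq_sum_univ' h]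
    rw [map_sum]
    refine Finset.sum_congr rfl fun x _ => ?_
    rw [map_smul, smul_eq_mul]
  have h1 : ∀ θ : MulChar E ℂ, θ k0 ≠ 1 → ∀ a b : F, ∑ x, θ x * (ψ (b * Algebra.trace F E (x + algebraMap F E a)) * D (x + algebraMap F E a)) = 0 := by
    intro θ hθ a b
    have hB := claimB hV hn θ (by
      rintro rfl
      exact hθ (MulChar.one_apply (Units.mk0 k0 hk0).isUnit)) (reg_of_k0 k0 hk θ hθ) ψ
    have h2 := claimC_twist hV ψ _ (claimC_shift hV ψ _ hB a) b
    have h3 := hf h2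
    rw [LinearMap.mem_ker, hfD] at h3
    rw [← h3]
    refine Fintype.sum_equiv (Equiv.addRight (algebraMap F E a)) _ _ fun x => ?_
    rw [Equiv.coe_addRight, add_sub_cancel_right]
    ring
  have h2 : ∀ a c : F, ∀ x : E, x ≠ 0 → (if Algebra.trace F E (k0 * x + algebraMap F E a) = c then D (k0 * x + algebraMap F E a) else 0)
      = (if Algebra.trace F E (x + algebraMap F E a) = c then D (x + algebraMap F E a) else 0) := by
    intro a c
    apply inv_of_orth k0 hk0 (fun x => if Algebra.trace F E (x + algebraMap F E a) = c then D (x + algebraMap F E a) else 0)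
    intro θ hθ
    have h3 : ∑ b : F, ψ (-(b * c)) * ∑ x, θ x * (ψ (b * Algebra.trace F E (x + algebraMap F E a)) * D (x + algebraMap F E a)) = 0 := by
      exact Finset.sum_eq_zero fun b _ => by rw [h1 θ hθ, mul_zero]
    simp_rw [Finset.mul_sum] at h3
    rw [Finset.sum_comm] at h3
    have hq : (Fintype.card F : ℂ) ≠ 0 := by exact_mod_cast Fintype.card_ne_zero
    apply mul_left_cancel₀ hq
    refine Eq.trans ?_ (mul_zero _).symm
    refine Eq.trans ?_ h3
    rw [Finset.mul_sum]
    refine Finset.sum_congr rfl fun x _ => ?_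
    have h4 := psi_avg ψ hψ (Algebra.trace F E (x + algebraMap F E a)) c
    have h5 : ∑ b : F, ψ (-(b * c)) * (θ x * (ψ (b * Algebra.trace F E (x + algebraMap F E a)) * D (x + algebraMap F E a))) =
        (∑ b : F, ψ (b * Algebra.trace F E (x + algebraMap F E a)) * ψ (-(b * c))) * (θ x * D (x + algebraMap F E a)) := by
      rw [Finset.sum_mul]
      refine Finset.sum_congr rfl fun b _ => ?_
      ring
    rw [h5, h4]
    split_ifs <;> ring
  have hD : ∃ y0, D y0 ≠ 0 := by
    by_contra hcon
    push Not at hcon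
    apply hf0
    apply LinearMap.ext
    intro h
    rw [hfD]
    simp [hcon]
  obtain ⟨y0, hy0⟩ := hD
  have h3 : ∀ a : F, y0 - algebraMap F E a ≠ 0 → ∀ P : F[X], Algebra.trace F E (Polynomial.aeval k0 P * (y0 - algebraMap F E a)) = 0 := by
    intro a ha
    set x0 := y0 - algebraMap F E a with hx0
    have hya : x0 + algebraMap F E a = y0 := by rw [hx0]; ring
    have h4 : ∀ i : ℕ, (if Algebra.trace F E (k0 ^ i * x0 + algebraMap F E a) = Algebra.trace F E y0 then D (k0 ^ i * x0 + algebraMap F E a) else 0) = D y0 := by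
      intro i
      induction i with
      | zero => rw [pow_zero, one_mul, hya, if_pos rfl]
      | succ i ih =>
        rw [pow_succ', mul_assoc, h2 a _ _ (mul_ne_zero (pow_ne_zero _ hk0) ha), ih]
    have h5 : ∀ i : ℕ, Algebra.trace F E (k0 ^ i * x0) = Algebra.trace F E x0 := by
      intro i
      have h6 := h4 i
      have h7 : Algebra.trace F E (k0 ^ i * x0 + algebraMap F E a) = Algebra.trace F E y0 := by
        by_contra hh
        rw [if_neg hh] at h6
        exact hy0 h6.symm
      rw [← hya, map_add, map_add] at h7
      exact add_right_cancel h7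
    have h6 : ∀ P : F[X], Algebra.trace F E (Polynomial.aeval k0 P * x0) = P.eval 1 * Algebra.trace F E x0 := by
      intro P
      rw [Polynomial.aeval_eq_sum_range, Finset.sum_mul, map_sum, Polynomial.eval_eq_sum_range, Finset.sum_mul]
      refine Finset.sum_congr rfl fun i _ => ?_
      rw [smul_mul_assoc, map_smul, h5, smul_eq_mul, one_pow, mul_one]
    have h7 := h6 (minpoly F k0)
    rw [minpoly.aeval, zero_mul, map_zero] at h7
    have h8 : (minpoly F k0).eval 1 ≠ 0 := by
      intro h0
      have := minpoly.root (Algebra.IsIntegral.isIntegral k0) h0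
      apply hk1
      rw [← this, map_one]
    have h9 := (mul_eq_zero.1 h7.symm).resolve_left h8
    intro P
    rw [h6, h9, mul_zero]
  refine trace_k0 hnE k0 hk1 hk fun P => ?_
  by_cases hyF : ∃ c : F, y0 = algebraMap F E c
  · obtain ⟨c, hc⟩ := hyF
    have h4 : y0 - algebraMap F E (c - 1) = 1 := by rw [hc]; simp
    have := h3 (c-1) (by rw [h4]; exact one_ne_zero) P
    rwa [h4, mul_one] at this
  · push Not at hyF
    have h4 := h3 0 (sub_ne_zero.2 (hyF 0)) P
    have h5 := h3 1 (sub_ne_zero.2 (hyF 1)) P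
    rw [map_zero, sub_zero] at h4
    rw [map_one, mul_sub, map_sub, h4, mul_one, zero_sub, neg_eq_zero] at h5
    exact h5
end
end KL

open scoped BigOperators Polynomial

namespace KL
section
variable {F : Type*} [Field F] [Fintype F]
variable {V : Type*} [AddCommGroup V] [Module F V] [FiniteDimensional F V] [Finite V]
variable {E : Type*} [Field E] [Algebra F E] [Fintype E] [FiniteDimensional F E]

lemma cc_scalar (hV : Module.finrank F V = Module.finrank F E) (h : E → ℂ) (c : F) :
    cc (F := F) h (algebraMap F (Module.End F V) c) = h (algebraMap F E c) * (kap (Fintype.card F : ℤ) (Module.finrank F V) : ℂ) := by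
  have h1 := cc_one hV (fun x => h (x + algebraMap F E (c - 1)))
  simp only [map_sub, map_one, add_sub_cancel] at h1
  rw [← h1, cc, cc]
  symm
  refine Fintype.sum_equiv (Equiv.addRight (algebraMap F E (c-1))) _ _ fun ξ => ?_
  rw [Equiv.coe_addRight]
  have := kk_add (1 : Module.End F V) ξ (c - 1)
  rw [← this]
  simp

lemma bij_one [Fintype (Module.End F V)] (h1 : Module.finrank F V = 1) : Function.Bijective (algebraMap F (Module.End F V)) := by
  haveI : Nontrivial V := Module.nontrivial_of_finrank_pos (R := F) (by omega)
  rw [Fintype.bijective_iff_injective_and_card]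
  refine ⟨(algebraMap F (Module.End F V)).injective, ?_⟩
  rw [Module.card_eq_pow_finrank (K := F) (V := Module.End F V), Module.finrank_linearMap, h1]
  simp

lemma bij_oneE (h1 : Module.finrank F E = 1) : Function.Bijective (algebraMap F E) := by
  rw [Fintype.bijective_iff_injective_and_card]
  refine ⟨(algebraMap F E).injective, ?_⟩
  rw [Module.card_eq_pow_finrank (K := F) (V := E), h1]
  simp

lemma TT_one [Fintype (Module.End F V)] (h1 : Module.finrank F V = 1) : TT F V = 1 := by
  classical
  have hVF : Module.finrank F V = Module.finrank F F := by rw [h1, Module.finrank_self]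
  rw [← TT_eq (V := V) hVF (1 : F)]
  have h2 : ∀ g : Module.End F V, (kk g (minpoly F (1 : F)) : ℂ) = cc (F := F) (fun x : F => if x = 1 then 1 else 0) g := by
    intro g
    rw [cc]; simp
  simp_rw [h2]
  rw [← (Equiv.ofBijective _ (bij_one h1)).sum_comp]
  simp only [Equiv.ofBijective_apply]
  simp_rw [cc_scalar hVF, h1, kap_one]
  simp

lemma claimC_one [Fintype (Module.End F V)] (hV : Module.finrank F V = Module.finrank F E) (hn : Module.finrank F V = 1)
    (ψ : AddChar F ℂ) (h : E → ℂ) : ClaimC F V ψ h := by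
  intro y
  have hE1 : Module.finrank F E = 1 := hV ▸ hn
  obtain ⟨d, rfl⟩ := (bij_one hn).2 y
  rw [CC, TT_one hn, cc_scalar hV, hn, kap_one, hat, ← (Equiv.ofBijective _ (bij_one hn)).sum_comp, ← (Equiv.ofBijective _ (bij_oneE hE1)).sum_comp]
  simp only [Equiv.ofBijective_apply]
  simp_rw [cc_scalar hV, ← map_mul, hn, kap_one, Algebra.trace_algebraMap, hE1]
  have : ∀ x : F, LinearMap.trace F V (algebraMap F (Module.End F V) x) = x := by
    intro x
    rw [Algebra.algebraMap_eq_smul_one, map_smul, LinearMap.trace_one, hn]; simp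
  simp [mul_comm]
  refine Finset.sum_congr rfl fun x _ => ?_
  rw [← map_mul, this]

lemma claimC [Fintype (Module.End F V)] (hV : Module.finrank F V = Module.finrank F E)
    (ψ : AddChar F ℂ) (hψ : ∃ a, ψ a ≠ 1) (h : E → ℂ) : ClaimC F V ψ h := by
  have hpos : 0 < Module.finrank F V := by rw [hV]; exact Module.finrank_pos
  rcases Nat.lt_or_ge 1 (Module.finrank F V) with h1 | h1
  · exact claimC_big hV h1 ψ hψ h
  · exact claimC_one hV (by omega) ψ h
end
end KL

open scoped BigOperators Polynomial

namespace KL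
section
variable {G : Type*} [Group G] [Fintype G] [DecidableEq G]

/-- iterated convolution on a finite group -/
def GK {k : ℕ} (φ : Fin k → G → ℂ) (x : G) : ℂ :=
  ∑ g : Fin k → G, if (List.ofFn g).prod = x then ∏ i, φ i (g i) else 0

lemma GK_zero (φ : Fin 0 → G → ℂ) (x : G) : GK φ x = if x = 1 then 1 else 0 := by
  simp [GK, eq_comm]

lemma GK_succ {k : ℕ} (φ : Fin (k+1) → G → ℂ) (x : G) :
    GK φ x = ∑ g : G, φ 0 g * GK (fun i => φ i.succ) (g⁻¹ * x) := by
  rw [GK, ← (Fin.consEquiv (fun _ => G)).sum_comp, Fintype.sum_prod_type]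
  refine Finset.sum_congr rfl fun g _ => ?_
  rw [GK, Finset.mul_sum]
  refine Finset.sum_congr rfl fun t _ => ?_
  simp only [Fin.consEquiv, Equiv.coe_fn_mk, List.ofFn_succ, Fin.cons_zero, Fin.cons_succ, List.prod_cons, Fin.prod_univ_succ]
  rw [mul_ite, mul_zero]
  congr 1
  rw [eq_inv_mul_iff_mul_eq]

lemma GK_succ' {k : ℕ} (φ : Fin (k+1) → G → ℂ) (x : G) :
    GK φ x = ∑ w : G, φ 0 (x * w⁻¹) * GK (fun i => φ i.succ) w := by
  rw [GK_succ]
  refine Fintype.sum_equiv ((Equiv.inv G).trans (Equiv.mulRight x)) _ _ fun g => ?_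
  simp

lemma GK_equiv {H : Type*} [Group H] [Fintype H] [DecidableEq H] {k : ℕ} (e : G ≃* H) (φ : Fin k → H → ℂ) (x : G) :
    GK (fun i g => φ i (e g)) x = GK φ (e x) := by
  rw [GK, GK]
  refine Fintype.sum_equiv (Equiv.piCongrRight fun _ => e.toEquiv) _ _ fun g => ?_
  have : (List.ofFn (Equiv.piCongrRight (fun _ => e.toEquiv) g)).prod = e (List.ofFn g).prod := by
    rw [map_list_prod, List.map_ofFn]
    rfl
  rw [this]
  simp only [EmbeddingLike.apply_eq_iff_eq]
  rfl

lemma GK_conj {k : ℕ} (φ : Fin k → G → ℂ) (hφ : ∀ i c g, φ i (c * g * c⁻¹) = φ i g) (c x : G) :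
    GK φ (c * x * c⁻¹) = GK φ x := by
  have := GK_equiv (MulAut.conj c) φ x
  rw [MulAut.conj_apply] at this
  rw [← this]
  congr 1
  funext i g
  rw [MulAut.conj_apply, hφ]
end

section
variable {F : Type*} [Field F] [Fintype F]
variable {V : Type*} [AddCommGroup V] [Module F V] [FiniteDimensional F V] [Finite V]
variable {E : Type*} [Field E] [Algebra F E] [Fintype E] [FiniteDimensional F E]

/-- weight on endomorphisms -/
noncomputable def pV (a : Fˣ →* ℂˣ) (ψ : AddChar F ℂ) (g : (Module.End F V)ˣ) : ℂ :=
  (a (Units.map LinearMap.det g) : ℂ) * ψ (LinearMap.trace F V g)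

/-- weight on field elements -/
noncomputable def pE (a : Fˣ →* ℂˣ) (ψ : AddChar F ℂ) (t : Eˣ) : ℂ :=
  (a (Units.map (Algebra.norm F : E →* F) t) : ℂ) * ψ (Algebra.trace F E t)

/-- a norm character extended by zero -/
noncomputable def aN (E : Type*) [Field E] [Algebra F E] (a : Fˣ →* ℂˣ) (ξ : E) : ℂ := by
  classical exact if h : ξ = 0 then 0 else (a (Units.map (Algebra.norm F : E →* F) (Units.mk0 ξ h)) : ℂ)

lemma aN_unit (a : Fˣ →* ℂˣ) (ξ : Eˣ) : aN E a (ξ : E) = (a (Units.map (Algebra.norm F : E →* F) ξ) : ℂ) := by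
  rw [aN, dif_neg ξ.ne_zero]
  simp

lemma aN_zero (a : Fˣ →* ℂˣ) : aN E a (0 : E) = 0 := by rw [aN, dif_pos rfl]

variable [DecidableEq E]

lemma sum_E (f : E → ℂ) (h0 : f 0 = 0) : ∑ ξ, f ξ = ∑ ξ : Eˣ, f ξ := by
  symm
  apply sum_units
  intro x hx
  rw [isUnit_iff_ne_zero, not_not] at hx
  rw [hx, h0]

lemma cc_aN (hV : Module.finrank F V = Module.finrank F E) (a : Fˣ →* ℂˣ) (h : E → ℂ) (u : (Module.End F V)ˣ) :
    cc (F := F) (fun ξ => h ξ * aN E a ξ) (u : Module.End F V) = (a (Units.map LinearMap.det u) : ℂ) * cc (F := F) h (u : Module.End F V) := by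
  rw [cc, cc, Finset.mul_sum]
  refine Finset.sum_congr rfl fun ξ _ => ?_
  by_cases h0 : kk (u : Module.End F V) (minpoly F ξ) = 0
  · simp [h0]
  · have hd := kk_det hV u ξ (kk_ne_zero h0)
    have hu : (Algebra.norm F ξ) ≠ 0 := by
      rw [← hd]
      exact ((u.isUnit).map LinearMap.det).ne_zero
    have hξ : ξ ≠ 0 := by rintro rfl; exact hu (by simp)
    have : aN E a ξ = (a (Units.map LinearMap.det u) : ℂ) := by
      rw [aN, dif_neg hξ]
      congr 2
      apply Units.ext
      simp [hd]
    rw [this]; ring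

lemma cc_non (hV : Module.finrank F V = Module.finrank F E) (h : E → ℂ) (h0 : h 0 = 0) (g : Module.End F V) (hg : ¬ IsUnit g) : cc (F := F) h g = 0 := by
  rw [cc]
  refine Finset.sum_eq_zero fun ξ _ => ?_
  by_cases hξ : ξ = 0
  · rw [hξ, h0, zero_mul]
  · by_cases hk : kk g (minpoly F ξ) = 0
    · simp [hk]
    · exact absurd (kk_unit hV g ξ hξ hk) hg

lemma cc_units (hV : Module.finrank F V = Module.finrank F E) (h : E → ℂ) (u : (Module.End F V)ˣ) :
    cc (F := F) h (u : Module.End F V) = ∑ ξ : Eˣ, h ξ * (kk (u : Module.End F V) (minpoly F (ξ : E)) : ℂ) := by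
  rw [cc, sum_E]
  by_cases h0 : kk (u : Module.End F V) (minpoly F (0:E)) = 0
  · rw [h0]; simp
  · have hd := kk_det hV (u : Module.End F V) (0:E) (kk_ne_zero h0)
    exfalso
    have : LinearMap.det (u : Module.End F V) ≠ 0 := ((u.isUnit).map LinearMap.det).ne_zero
    apply this
    rw [hd]; simp

/-- the one step transform -/
noncomputable def h1 (a : Fˣ →* ℂˣ) (ψ : AddChar F ℂ) (h : E → ℂ) (ξ : E) : ℂ := ∑ t : Eˣ, pE a ψ t * h (t * ξ)

lemma step_key [Fintype (Module.End F V)] [Fintype (Module.End F V)ˣ] (hV : Module.finrank F V = Module.finrank F E)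
    (ψ : AddChar F ℂ) (hψ : ∃ a, ψ a ≠ 1) (a : Fˣ →* ℂˣ) (h : E → ℂ) (x : (Module.End F V)ˣ) :
    ∑ g : (Module.End F V)ˣ, pV a ψ g * cc (F := F) h ((g * x : (Module.End F V)ˣ) : Module.End F V)
      = CC F V * cc (F := F) (h1 a ψ h) (x : Module.End F V) := by
  have hC := claimC hV ψ hψ (fun ξ => h ξ * aN E a ξ) ((x⁻¹ : (Module.End F V)ˣ) : Module.End F V)
  rw [← sum_units] at hC
  swap
  · intro g hg
    rw [cc_non hV _ (by simp [aN_zero]) g hg, zero_mul]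
  have e1 : ∑ g : (Module.End F V)ˣ, pV a ψ g * cc (F := F) h ((g * x : (Module.End F V)ˣ) : Module.End F V) =
      ∑ u : (Module.End F V)ˣ, pV a ψ (u * x⁻¹) * cc (F := F) h (u : Module.End F V) := by
    refine Fintype.sum_equiv (Equiv.mulRight x) _ _ fun g => ?_
    simp
  have e2 : ∀ u : (Module.End F V)ˣ, pV a ψ (u * x⁻¹) * cc (F := F) h (u : Module.End F V) =
      (a (Units.map LinearMap.det x⁻¹) : ℂ) * (cc (F := F) (fun ξ => h ξ * aN E a ξ) (u : Module.End F V) * ψ (LinearMap.trace F V (((x⁻¹ : (Module.End F V)ˣ) : Module.End F V) * u))) := by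
    intro u
    rw [cc_aN hV, pV, map_mul, map_mul, Units.val_mul, Units.val_mul, LinearMap.trace_mul_comm]
    ring
  rw [e1, Finset.sum_congr rfl fun u _ => e2 u, ← Finset.mul_sum, hC, cc_units hV, cc_units hV]
  rw [← mul_assoc, mul_comm _ (CC F V), mul_assoc]
  congr 1
  rw [Finset.mul_sum]
  refine Fintype.sum_equiv (Equiv.inv Eˣ) _ _ fun η => ?_
  rw [Equiv.inv_apply]
  have hk := kk_inv x⁻¹ η
  rw [inv_inv] at hk
  rw [hk, ← mul_assoc]
  by_cases hz : kk ((x⁻¹ : (Module.End F V)ˣ) : Module.End F V) (minpoly F (η : E)) = 0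
  · simp [hz]
  congr 1
  have hd := kk_det hV _ (η : E) (kk_ne_zero hz)
  have : Units.map LinearMap.det x⁻¹ = Units.map (Algebra.norm F : E →* F) η := Units.ext hd
  rw [this, h1, hat, sum_E, Finset.mul_sum]
  · refine Fintype.sum_equiv (Equiv.mulRight η) _ _ fun t => ?_
    rw [Equiv.coe_mulRight, pE, aN_unit, map_mul (Units.map (Algebra.norm F : E →* F)), map_mul a]
    simp
    ring
  · simp [aN_zero]

lemma pV_conj (a : Fˣ →* ℂˣ) (ψ : AddChar F ℂ) (c g : (Module.End F V)ˣ) : pV a ψ (c * g * c⁻¹) = pV a ψ g := by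
  rw [pV, pV]
  congr 1
  · simp [mul_comm]
  · rw [Units.val_mul, LinearMap.trace_mul_comm, ← Units.val_mul, ← mul_assoc, inv_mul_cancel, one_mul]

lemma claimD [Fintype (Module.End F V)] [Fintype (Module.End F V)ˣ] [DecidableEq (Module.End F V)ˣ] (hV : Module.finrank F V = Module.finrank F E)
    (ψ : AddChar F ℂ) (hψ : ∃ a, ψ a ≠ 1) {k : ℕ} (α : Fin k → Fˣ →* ℂˣ) (h : E → ℂ) :
    ∑ x : (Module.End F V)ˣ, GK (fun i => pV (α i) ψ) x * cc (F := F) h (x : Module.End F V) =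
    CC F V ^ k * (kap (Fintype.card F : ℤ) (Module.finrank F V) : ℂ) * ∑ ξ : Eˣ, GK (fun i => pE (α i) ψ) ξ * h ξ := by
  induction k generalizing h with
  | zero =>
    simp_rw [GK_zero]
    simp [cc_one hV, mul_comm]
  | succ k ih =>
    have l1 : ∑ x : (Module.End F V)ˣ, GK (fun i => pV (α i) ψ) x * cc (F := F) h (x : Module.End F V) =
        ∑ x : (Module.End F V)ˣ, GK (fun i : Fin k => pV (α i.succ) ψ) x * ∑ g : (Module.End F V)ˣ, pV (α 0) ψ g * cc (F := F) h ((g * x : (Module.End F V)ˣ) : Module.End F V) := by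
      simp_rw [GK_succ, Finset.sum_mul, Finset.mul_sum]
      rw [Finset.sum_comm]
      conv_rhs => rw [Finset.sum_comm]
      refine Finset.sum_congr rfl fun g _ => ?_
      refine Fintype.sum_equiv (Equiv.mulLeft g⁻¹) _ _ fun x => ?_
      simp only [Equiv.coe_mulLeft, mul_inv_cancel_left]
      ring
    have l2 : ∑ ξ : Eˣ, GK (fun i => pE (α i) ψ) ξ * h ξ = ∑ ξ : Eˣ, GK (fun i : Fin k => pE (α i.succ) ψ) ξ * h1 (α 0) ψ h ξ := by
      simp_rw [h1, GK_succ, Finset.sum_mul, Finset.mul_sum]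
      rw [Finset.sum_comm]
      conv_rhs => rw [Finset.sum_comm]
      refine Finset.sum_congr rfl fun g _ => ?_
      refine Fintype.sum_equiv (Equiv.mulLeft g⁻¹) _ _ fun x => ?_
      simp only [Equiv.coe_mulLeft, ← Units.val_mul, mul_inv_cancel_left]
      ring
    rw [l1, l2]
    simp_rw [step_key hV ψ hψ]
    have := ih (fun i => α i.succ) (h1 (α 0) ψ h)
    simp_rw [← mul_assoc, mul_comm _ (CC F V), mul_assoc]
    rw [← Finset.mul_sum, this]
    ring
end
end KL

open scoped BigOperators Polynomial

namespace KL
section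
variable {F : Type*} [Field F] [Fintype F]

lemma gl_prod (q : ℂ) (m : ℕ) : ∏ i ∈ Finset.range (m+1), (q ^ (m+1) - q ^ i) =
    (q ^ (m+1) - 1) * ((-1) ^ m * q ^ ((m+1) * m / 2) * ∏ i ∈ Finset.range m, (1 - q ^ (i+1))) := by
  have h1 : ∀ i ∈ Finset.range (m+1), (q ^ (m+1) - q ^ i) = q ^ i * (q ^ (m + 1 - i) - 1) := by
    intro i hi
    have := Finset.mem_range.1 hi
    rw [mul_sub, ← pow_add, mul_one]
    congr 2; omega
  rw [Finset.prod_congr rfl h1, Finset.prod_mul_distrib, Finset.prod_pow_eq_pow_sum, Finset.sum_range_id]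
  have h2 : ∏ i ∈ Finset.range (m+1), (q ^ (m + 1 - i) - 1) = ∏ i ∈ Finset.range (m+1), (q ^ (i + 1) - 1) := by
    rw [← Finset.prod_range_reflect]
    refine Finset.prod_congr rfl fun i hi => ?_
    have := Finset.mem_range.1 hi
    congr 2; omega
  have h3 : ∏ i ∈ Finset.range m, (q ^ (i+1) - 1) = (-1) ^ m * ∏ i ∈ Finset.range m, (1 - q ^ (i+1)) := by
    have : (-1 : ℂ) ^ m = ∏ i ∈ Finset.range m, (-1 : ℂ) := by simp
    rw [this, ← Finset.prod_mul_distrib]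
    refine Finset.prod_congr rfl fun i _ => ?_
    ring
  rw [h2, Finset.prod_range_succ, h3]
  simp only [Nat.add_sub_cancel]
  ring

lemma CC_val (m : ℕ) : CC F (Fin (m+1) → F) = (-1) ^ m * (Fintype.card F : ℂ) ^ ((m+1) * m / 2) := by
  classical
  have hcard : (Nat.card ((Fin (m+1) → F) ≃ₗ[F] (Fin (m+1) → F)) : ℂ) = ∏ i ∈ Finset.range (m+1), ((Fintype.card F : ℂ) ^ (m+1) - (Fintype.card F : ℂ) ^ i) := by
    have e1 : Nat.card ((Fin (m+1) → F) ≃ₗ[F] (Fin (m+1) → F)) = Nat.card (GL (Fin (m+1)) F) := by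
      rw [← Nat.card_congr (LinearMap.GeneralLinearGroup.generalLinearEquiv F (Fin (m+1) → F)).toEquiv]
      exact (Nat.card_congr (Matrix.GeneralLinearGroup.toLin (n := Fin (m+1)) (R := F)).toEquiv).symm
    rw [e1, Matrix.card_GL_field, ← Fin.prod_univ_eq_prod_range (fun i => (Fintype.card F : ℂ) ^ (m+1) - (Fintype.card F : ℂ) ^ i), Nat.cast_prod]
    refine Finset.prod_congr rfl fun i _ => ?_
    rw [Nat.cast_sub (Nat.pow_le_pow_right Fintype.card_pos (by omega))]
    push_cast; rfl
  have hk : (kap (Fintype.card F : ℤ) (m+1) : ℂ) = ∏ i ∈ Finset.range m, (1 - (Fintype.card F : ℂ) ^ (i+1)) := by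
    rw [kap]; simp
  have hkn := kap_ne (F := F) (m+1)
  have hq := qn_ne (F := F) (m+1) (by omega)
  rw [CC, TT, hcard, gl_prod, Module.finrank_fin_fun, ← hk]
  field_simp

variable {V : Type*} [AddCommGroup V] [Module F V] [FiniteDimensional F V] [Finite V]
variable {E : Type*} [Field E] [Algebra F E] [Fintype E] [FiniteDimensional F E] [DecidableEq E]

lemma kk_irr (g : Module.End F V) (P : F[X]) (hP : P.Monic) (hI : Irreducible P) (hd : P.natDegree = Module.finrank F V) :
    (kk g P ≠ 0 → g.charpoly = P) ∧ (g.charpoly = P → kk g P = 1) := by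
  have hpos : 0 < P.natDegree := hI.natDegree_pos
  constructor
  · intro h
    have := charpoly_of_nilp g P hP hI (kk_ne_zero h)
    rwa [← hd, Nat.div_self hpos, pow_one] at this
  · intro h
    have h0 : Polynomial.aeval g P = 0 := by rw [← h, LinearMap.aeval_self_charpoly]
    rw [kk, h0, if_pos IsNilpotent.zero, LinearMap.ker_zero, finrank_top, hd, Nat.div_self (by omega), kap_one]

lemma conj_irr (P : F[X]) [hF : Fact (Irreducible P)] (hd : P.natDegree = Module.finrank F V)
    (g : Module.End F V) (hg : g.charpoly = P) : ∃ e : (Fin 1 → AdjoinRoot P) ≃ₗ[F] V, ∀ v, e (mx P 1 v) = g (e v) := by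
  have hI := hF.out
  haveI := fin_adj P
  have hpos : 0 < P.natDegree := hI.natDegree_pos
  have h0 : Polynomial.aeval g P = 0 := by rw [← hg, LinearMap.aeval_self_charpoly]
  have hc := count_emb P g 1
  rw [h0, LinearMap.ker_zero, finrank_top, hd, Nat.div_self (by omega)] at hc
  simp only [Finset.prod_range_one, pow_one, pow_zero] at hc
  have h1 : (1 : ℤ) < (Fintype.card F : ℤ) ^ Module.finrank F V := one_lt_pow₀ (by exact_mod_cast Fintype.one_lt_card) (by omega)
  have h2 : Nat.card {φ : (Fin 1 → AdjoinRoot P) →ₗ[F] V // (∀ v, φ (mx P 1 v) = g (φ v)) ∧ Function.Injective φ} ≠ 0 := by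
    intro h; rw [h] at hc; push_cast at hc; omega
  obtain ⟨⟨φ, hφ, hinj⟩⟩ := (Nat.card_ne_zero.1 h2).1
  refine ⟨LinearEquiv.ofInjectiveOfFinrankEq φ hinj (by rw [finrank_mx, one_mul, hd]), hφ⟩

lemma conj_units (P : F[X]) (hI : Irreducible P) (hd : P.natDegree = Module.finrank F V)
    (g g' : (Module.End F V)ˣ) (hg : (g : Module.End F V).charpoly = P) (hg' : (g' : Module.End F V).charpoly = P) :
    ∃ c : (Module.End F V)ˣ, g' = c * g * c⁻¹ := by
  haveI : Fact (Irreducible P) := ⟨hI⟩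
  obtain ⟨e, he⟩ := conj_irr P hd g hg
  obtain ⟨e', he'⟩ := conj_irr P hd g' hg'
  let c : (Module.End F V)ˣ := (LinearMap.GeneralLinearGroup.generalLinearEquiv F V).symm (e.symm.trans e')
  have hcv : ∀ v, (c : Module.End F V) v = e' (e.symm v) := fun v => rfl
  refine ⟨c, ?_⟩
  rw [eq_mul_inv_iff_mul_eq]
  apply Units.ext
  rw [Units.val_mul, Units.val_mul]
  apply LinearMap.ext
  intro v
  obtain ⟨w, rfl⟩ := e.surjective v
  rw [Module.End.mul_apply, Module.End.mul_apply, hcv, hcv, e.symm_apply_apply, ← he, e.symm_apply_apply, he']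

lemma single_block [Fintype (Module.End F V)] [Fintype (Module.End F V)ˣ] [DecidableEq (Module.End F V)ˣ] (hV : Module.finrank F V = Module.finrank F E)
    (ψ : AddChar F ℂ) (hψ : ∃ a, ψ a ≠ 1) {k : ℕ} (α : Fin (k+1) → Fˣ →* ℂˣ) (x : (Module.End F V)ˣ) (η : Eˣ)
    (hI : Irreducible (x : Module.End F V).charpoly) (hη : Polynomial.aeval (η : E) (x : Module.End F V).charpoly = 0) :
    GK (fun i => pV (α i) ψ) x = CC F V ^ k * GK (fun i => pE (α i) ψ) η := by
  have hpos : 0 < Module.finrank F V := by rw [hV]; exact Module.finrank_pos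
  have hD := claimD hV ψ hψ α (fun ξ : E => if ξ = η then 1 else 0)
  set P := (x : Module.End F V).charpoly with hP
  have hmon : P.Monic := LinearMap.charpoly_monic _
  have hdeg : P.natDegree = Module.finrank F V := LinearMap.charpoly_natDegree _
  have hmin : minpoly F (η : E) = P := (minpoly.eq_of_irreducible_of_monic hI hη hmon).symm
  have e1 : ∀ g : Module.End F V, cc (F := F) (fun ξ : E => if ξ = η then 1 else 0) g = (kk g P : ℂ) := by
    intro g
    rw [cc]; simp [hmin]
  have e2 : ∀ g : (Module.End F V)ˣ, GK (fun i => pV (α i) ψ) g * cc (F := F) (fun ξ : E => if ξ = η then 1 else 0) (g : Module.End F V) = GK (fun i => pV (α i) ψ) x * (kk (g : Module.End F V) P : ℂ) := by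
    intro g
    rw [e1]
    by_cases h0 : kk (g : Module.End F V) P = 0
    · simp [h0]
    · obtain ⟨c, hc⟩ := conj_units P hI hdeg x g rfl ((kk_irr _ P hmon hI hdeg).1 h0)
      congr 1
      rw [hc]
      exact GK_conj _ (fun i c g => pV_conj _ _ _ _) _ _
  rw [Finset.sum_congr rfl fun g _ => e2 g, ← Finset.mul_sum] at hD
  have e3 : ∑ g : (Module.End F V)ˣ, (kk (g : Module.End F V) P : ℂ) = TT F V := by
    rw [sum_units (fun g : Module.End F V => (kk g P : ℂ)), ← hmin, TT_eq hV]
    intro g hg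
    by_cases h0 : kk g P = 0
    · simp [h0]
    · exact absurd (kk_unit hV g (η : E) η.ne_zero (by rwa [hmin])) hg
  rw [e3] at hD
  have e4 : ∑ ξ : Eˣ, GK (fun i => pE (α i) ψ) ξ * (if (ξ : E) = (η : E) then (1:ℂ) else 0) = GK (fun i => pE (α i) ψ) η := by
    simp [Units.val_inj]
  rw [e4] at hD
  have hT : TT F V ≠ 0 := by
    rcases TT_ne (F := F) (V := V) with h | h
    · exact h
    · omega
  have hTC : TT F V = CC F V * (kap (Fintype.card F : ℤ) (Module.finrank F V) : ℂ) := by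
    rw [CC, div_mul_cancel₀ _ (kap_ne _)]
  apply mul_right_cancel₀ hT
  rw [hD, hTC]
  ring
end
end KL

open scoped BigOperators Polynomial

namespace KL
section
variable {F : Type} [Field F] [Fintype F] [DecidableEq F]
variable {ι : Type} [Fintype ι] [DecidableEq ι]

/-- weight on matrices -/
noncomputable def pM (a : Fˣ →* ℂˣ) (ψ : AddChar F ℂ) (g : (Matrix ι ι F)ˣ) : ℂ :=
  (a (Units.map Matrix.detMonoidHom g) : ℂ) * ψ (Matrix.trace (g : Matrix ι ι F))

lemma psi_sum {κ : Type*} (ψ : AddChar F ℂ) (s : Finset κ) (f : κ → F) : ψ (∑ i ∈ s, f i) = ∏ i ∈ s, ψ (f i) := by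
  classical
  induction s using Finset.induction_on with
  | empty => simp
  | insert a s ha ih => rw [Finset.sum_insert ha, Finset.prod_insert ha, AddChar.map_add_eq_mul, ih]

lemma mk_eq {k : ℕ} (α : Fin k → Fˣ →* ℂˣ) (ψ : AddChar F ℂ) (x : (Matrix ι ι F)ˣ) :
    matrixKloosterman α ψ (x : Matrix ι ι F) = GK (fun i => pM (α i) ψ) x := by
  rw [matrixKloosterman, GK]
  refine Finset.sum_congr rfl fun g _ => ?_
  simp only [Units.val_inj]
  refine if_congr Iff.rfl ?_ rfl
  simp only [pM]
  rw [Finset.prod_mul_distrib, Matrix.trace_sum, psi_sum]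

lemma fk_eq {E : Type} [Field E] [Fintype E] [DecidableEq E] [Algebra F E] {k : ℕ} (α : Fin k → Fˣ →* ℂˣ) (ψ : AddChar F ℂ) (η : Eˣ) :
    fieldKloosterman α ψ E (η : E) = GK (fun i => pE (α i) ψ) η := by
  rw [fieldKloosterman, GK]
  refine Finset.sum_congr rfl fun g _ => ?_
  simp only [Units.val_inj, List.prod_ofFn]
  refine if_congr Iff.rfl ?_ rfl
  simp only [pE]
  rw [Finset.prod_mul_distrib, map_sum, psi_sum]

lemma pM_conj (a : Fˣ →* ℂˣ) (ψ : AddChar F ℂ) (c g : (Matrix ι ι F)ˣ) : pM a ψ (c * g * c⁻¹) = pM a ψ g := by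
  rw [pM, pM]
  congr 2
  · simp [mul_comm]
  · rw [Units.val_mul, Matrix.trace_mul_comm]
    simp [← mul_assoc]

/-- endomorphism units -/
noncomputable def eM (F : Type) [Field F] (ι : Type) [Fintype ι] [DecidableEq ι] : (Matrix ι ι F)ˣ ≃* (Module.End F (ι → F))ˣ :=
  Units.mapEquiv (Matrix.toLinAlgEquiv' (R := F) (n := ι)).toMulEquiv

lemma eM_val (g : (Matrix ι ι F)ˣ) : (eM F ι g : Module.End F (ι → F)) = Matrix.toLin' (g : Matrix ι ι F) := rfl

lemma pM_eM (a : Fˣ →* ℂˣ) (ψ : AddChar F ℂ) (g : (Matrix ι ι F)ˣ) : pV a ψ (eM F ι g) = pM a ψ g := by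
  rw [pM, pV]
  congr 2
  · have : Units.map LinearMap.det (eM F ι g) = Units.map Matrix.detMonoidHom g := by
      apply Units.ext
      rw [Units.coe_map, Units.coe_map, eM_val]
      simp
    rw [this]
  · rw [eM_val, Matrix.trace_toLin'_eq]

lemma single_mat {m : ℕ} (y : (Matrix (Fin m) (Fin m) F)ˣ) (ψ : AddChar F ℂ) (hψ : ∃ a, ψ a ≠ 1) {k : ℕ} (α : Fin (k+1) → Fˣ →* ℂˣ)
    (E : Type) [Field E] [Fintype E] [DecidableEq E] [Algebra F E] (hE : Module.finrank F E = m)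
    (hI : Irreducible (Matrix.charpoly (y : Matrix (Fin m) (Fin m) F))) (η : E)
    (hη : Polynomial.aeval η (Matrix.charpoly (y : Matrix (Fin m) (Fin m) F)) = 0) :
    matrixKloosterman α ψ (y : Matrix (Fin m) (Fin m) F) = (-1) ^ ((m + 1) * k) * (Fintype.card F : ℂ) ^ (k * (m * (m - 1) / 2)) *
      fieldKloosterman α ψ E η := by
  classical
  have : FiniteDimensional F E := Module.Finite.of_finite
  have hη0 : η ≠ 0 := by
    rintro rfl
    rw [Polynomial.aeval_def, Polynomial.eval₂_at_zero, map_eq_zero] at hη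
    have h1 := Matrix.det_eq_sign_charpoly_coeff (y : Matrix (Fin m) (Fin m) F)
    rw [hη, mul_zero] at h1
    exact ((y.isUnit).map Matrix.detMonoidHom).ne_zero h1
  obtain ⟨u, rfl⟩ : ∃ u : Eˣ, (u : E) = η := ⟨Units.mk0 η hη0, rfl⟩
  have hm : 0 < m := by rw [← hE]; exact Module.finrank_pos
  obtain ⟨r, rfl⟩ : ∃ r, m = r + 1 := ⟨m - 1, by omega⟩
  have hV : Module.finrank F (Fin (r+1) → F) = Module.finrank F E := by rw [hE]; simp
  haveI : Finite (Module.End F (Fin (r+1) → F)) := Finite.of_injective (fun f => (f : (Fin (r+1) → F) → (Fin (r+1) → F))) DFunLike.coe_injective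
  letI : Fintype (Module.End F (Fin (r+1) → F)) := Fintype.ofFinite _
  letI : Fintype (Module.End F (Fin (r+1) → F))ˣ := Fintype.ofFinite _
  have hs := single_block hV ψ hψ α (eM F _ y) u (by rw [eM_val, Matrix.charpoly_toLin']; exact hI)
    (by rw [eM_val, Matrix.charpoly_toLin']; exact hη)
  rw [mk_eq, fk_eq]
  rw [← GK_equiv] at hs
  simp only [pM_eM] at hs
  rw [hs, CC_val]
  congr 1
  rw [mul_pow, ← pow_mul, ← pow_mul, Nat.add_sub_cancel]
  congr 1
  · rw [show (r + 1 + 1) * k = r * k + 2 * k by ring, pow_add, pow_mul _ 2]; simp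
  · rw [mul_comm]
end
end KL

open scoped BigOperators Polynomial

namespace KL
section
variable {F : Type} [Field F] [Fintype F] [DecidableEq F]
variable {m n : Type} [Fintype m] [DecidableEq m] [Fintype n] [DecidableEq n]

/-- unipotent block unit -/
def uu (D : Matrix m n F) : (Matrix (m ⊕ n) (m ⊕ n) F)ˣ where
  val := Matrix.fromBlocks 1 D 0 1
  inv := Matrix.fromBlocks 1 (-D) 0 1
  val_inv := by simp [Matrix.fromBlocks_multiply]
  inv_val := by simp [Matrix.fromBlocks_multiply]

/-- block diagonal unit -/
def dd (A : (Matrix m m F)ˣ) (B : (Matrix n n F)ˣ) : (Matrix (m ⊕ n) (m ⊕ n) F)ˣ where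
  val := Matrix.fromBlocks A 0 0 B
  inv := Matrix.fromBlocks (A⁻¹ : (Matrix m m F)ˣ) 0 0 (B⁻¹ : (Matrix n n F)ˣ)
  val_inv := by simp [Matrix.fromBlocks_multiply]
  inv_val := by simp [Matrix.fromBlocks_multiply]

lemma uu_val (D : Matrix m n F) : (uu D : Matrix (m ⊕ n) (m ⊕ n) F) = Matrix.fromBlocks 1 D 0 1 := rfl
lemma dd_val (A : (Matrix m m F)ˣ) (B : (Matrix n n F)ˣ) : (dd A B : Matrix (m ⊕ n) (m ⊕ n) F) = Matrix.fromBlocks A 0 0 B := rfl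

lemma uu_add (D D' : Matrix m n F) : uu D * uu D' = uu (D + D') := by
  apply Units.ext
  simp [uu_val, Matrix.fromBlocks_multiply, add_comm]

lemma uu_inv (D : Matrix m n F) : (uu D)⁻¹ = uu (-D) := by
  apply Units.ext; rfl

lemma dd_inv (A : (Matrix m m F)ˣ) (B : (Matrix n n F)ˣ) : (dd A B)⁻¹ = dd A⁻¹ B⁻¹ := by
  apply Units.ext; rfl

lemma dd_mul (A A' : (Matrix m m F)ˣ) (B B' : (Matrix n n F)ˣ) : dd A B * dd A' B' = dd (A * A') (B * B') := by
  apply Units.ext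
  simp [dd_val, Matrix.fromBlocks_multiply]

lemma uu_dd (A : (Matrix m m F)ˣ) (B : (Matrix n n F)ˣ) (D : Matrix m n F) :
    uu D * dd A B = dd A B * uu (((A⁻¹ : (Matrix m m F)ˣ) : Matrix m m F) * D * (B : Matrix n n F)) := by
  apply Units.ext
  simp [dd_val, uu_val, Matrix.fromBlocks_multiply, ← mul_assoc, ← Matrix.mul_assoc]

lemma tr_fb (A : Matrix m m F) (B : Matrix m n F) (C : Matrix n m F) (D : Matrix n n F) :
    Matrix.trace (Matrix.fromBlocks A B C D) = Matrix.trace A + Matrix.trace D := by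
  simp [Matrix.trace, Fintype.sum_sum_type]

lemma pM_dd (a : Fˣ →* ℂˣ) (ψ : AddChar F ℂ) (A : (Matrix m m F)ˣ) (B : (Matrix n n F)ˣ) :
    pM a ψ (dd A B) = pM a ψ A * pM a ψ B := by
  have h : Units.map Matrix.detMonoidHom (dd A B) = Units.map Matrix.detMonoidHom A * Units.map Matrix.detMonoidHom B := by
    apply Units.ext
    simp [dd_val]
  rw [pM, pM, pM, h, dd_val, tr_fb, AddChar.map_add_eq_mul, map_mul, Units.val_mul]
  ring

lemma pM_uu (a : Fˣ →* ℂˣ) (ψ : AddChar F ℂ) (g : (Matrix (m ⊕ n) (m ⊕ n) F)ˣ) (D : Matrix m n F) :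
    pM a ψ (g * uu D) = pM a ψ g * ψ (Matrix.trace ((g : Matrix (m ⊕ n) (m ⊕ n) F).toBlocks₂₁ * D)) := by
  have h : Units.map Matrix.detMonoidHom (g * uu D) = Units.map Matrix.detMonoidHom g := by
    apply Units.ext
    simp [uu_val]
  have h2 : Matrix.trace ((g * uu D : (Matrix (m ⊕ n) (m ⊕ n) F)ˣ) : Matrix (m ⊕ n) (m ⊕ n) F) =
      Matrix.trace (g : Matrix (m ⊕ n) (m ⊕ n) F) + Matrix.trace ((g : Matrix (m ⊕ n) (m ⊕ n) F).toBlocks₂₁ * D) := by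
    rw [Units.val_mul, uu_val]
    generalize (g : Matrix (m ⊕ n) (m ⊕ n) F) = X
    rw [← Matrix.fromBlocks_toBlocks X, Matrix.fromBlocks_multiply, tr_fb, tr_fb]
    simp
    ring
  rw [pM, pM, h, h2, AddChar.map_add_eq_mul]
  ring

lemma card_mat : Fintype.card (Matrix m n F) = Fintype.card F ^ (Fintype.card m * Fintype.card n) := by
  rw [← Nat.card_eq_fintype_card]
  have : Nat.card (Matrix m n F) = Nat.card (m → n → F) := rfl
  rw [this, Nat.card_eq_fintype_card]
  simp [← pow_mul, mul_comm]

lemma sum_psi_tr (ψ : AddChar F ℂ) (hψ : ∃ a, ψ a ≠ 1) (C : Matrix n m F) :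
    ∑ D : Matrix m n F, ψ (Matrix.trace (C * D)) = if C = 0 then (Fintype.card F : ℂ) ^ (Fintype.card m * Fintype.card n) else 0 := by
  split_ifs with hC
  · subst hC
    simp [card_mat]
  · obtain ⟨a, ha⟩ := hψ
    obtain ⟨i, j, hij⟩ : ∃ i j, C i j ≠ 0 := by
      by_contra h
      push Not at h
      exact hC (by ext i j; exact h i j)
    let D0 : Matrix m n F := Matrix.single j i ((C i j)⁻¹ * a)
    have h0 : Matrix.trace (C * D0) = a := by
      rw [Matrix.trace_mul_comm]
      simp only [D0, Matrix.trace_single_mul]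
      simp only [smul_eq_mul]
      field_simp
    have h1 : ∑ D : Matrix m n F, ψ (Matrix.trace (C * D)) = ψ a * ∑ D : Matrix m n F, ψ (Matrix.trace (C * D)) := by
      rw [Finset.mul_sum, ← Equiv.sum_comp (Equiv.addLeft D0)]
      refine Finset.sum_congr rfl fun D _ => ?_
      rw [Equiv.coe_addLeft, Matrix.mul_add, Matrix.trace_add, h0, AddChar.map_add_eq_mul]
    have h2 : (1 - ψ a) * ∑ D : Matrix m n F, ψ (Matrix.trace (C * D)) = 0 := by
      rw [sub_mul, one_mul, ← h1, sub_self]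
    rcases mul_eq_zero.1 h2 with h | h
    · exact absurd (sub_eq_zero.1 h).symm ha
    · exact h

lemma sum_psi_tr' (ψ : AddChar F ℂ) (hψ : ∃ a, ψ a ≠ 1) (C : Matrix n m F) :
    ∑ D : Matrix m n F, ψ (Matrix.trace (C * (-D))) = if C = 0 then (Fintype.card F : ℂ) ^ (Fintype.card m * Fintype.card n) else 0 := by
  rw [← sum_psi_tr ψ hψ]
  exact Fintype.sum_equiv (Equiv.neg (Matrix m n F)) _ _ fun _ => rfl

lemma sum_param (g : (Matrix (m ⊕ n) (m ⊕ n) F)ˣ → ℂ)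
    (hg : ∀ w : (Matrix (m ⊕ n) (m ⊕ n) F)ˣ, (w : Matrix (m ⊕ n) (m ⊕ n) F).toBlocks₂₁ ≠ 0 → g w = 0) :
    ∑ w, g w = ∑ A : (Matrix m m F)ˣ, ∑ B : (Matrix n n F)ˣ, ∑ D : Matrix m n F, g (uu D * dd A B) := by
  have : ∀ A : (Matrix m m F)ˣ, ∑ B : (Matrix n n F)ˣ, ∑ D : Matrix m n F, g (uu D * dd A B) =
      ∑ p : (Matrix n n F)ˣ × Matrix m n F, g (uu p.2 * dd A p.1) := fun A => (Fintype.sum_prod_type (f := fun p : (Matrix n n F)ˣ × Matrix m n F => g (uu p.2 * dd A p.1))).symm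
  simp only [this]
  rw [← Fintype.sum_prod_type (f := fun p : (Matrix m m F)ˣ × (Matrix n n F)ˣ × Matrix m n F => g (uu p.2.2 * dd p.1 p.2.1))]
  symm
  refine Fintype.sum_of_injective (fun p : (Matrix m m F)ˣ × (Matrix n n F)ˣ × Matrix m n F => uu p.2.2 * dd p.1 p.2.1) ?_ _ _ ?_ (fun _ => rfl)
  · rintro ⟨A, B, D⟩ ⟨A', B', D'⟩ h
    have h' := congrArg (fun u : (Matrix (m ⊕ n) (m ⊕ n) F)ˣ => (u : Matrix (m ⊕ n) (m ⊕ n) F)) h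
    simp only [Units.val_mul, uu_val, dd_val, Matrix.fromBlocks_multiply] at h'
    rw [Matrix.fromBlocks_inj] at h'
    simp only [Matrix.one_mul, Matrix.mul_zero, add_zero, Matrix.zero_mul, zero_add, Units.val_inj] at h'
    obtain ⟨rfl, h2, -, rfl⟩ := h'
    have : D = D' := by
      have := congrArg (fun X => X * ((B⁻¹ : (Matrix n n F)ˣ) : Matrix n n F)) h2
      simpa [Matrix.mul_assoc] using this
    rw [this]
  · intro w hw
    by_contra h
    have h21 : (w : Matrix (m ⊕ n) (m ⊕ n) F).toBlocks₂₁ = 0 := by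
      by_contra h'
      exact h (hg w h')
    apply hw
    have hb := Matrix.fromBlocks_toBlocks (w : Matrix (m ⊕ n) (m ⊕ n) F)
    rw [h21] at hb
    have hdet : IsUnit (w : Matrix (m ⊕ n) (m ⊕ n) F).det := (w.isUnit).map Matrix.detMonoidHom
    rw [← hb, Matrix.det_fromBlocks_zero₂₁, IsUnit.mul_iff] at hdet
    obtain ⟨A, hA⟩ := (Matrix.isUnit_iff_isUnit_det _).2 hdet.1
    obtain ⟨B, hB⟩ := (Matrix.isUnit_iff_isUnit_det _).2 hdet.2
    refine ⟨(A, B, (w : Matrix (m ⊕ n) (m ⊕ n) F).toBlocks₁₂ * ((B⁻¹ : (Matrix n n F)ˣ) : Matrix n n F)), ?_⟩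
    apply Units.ext
    rw [← hb, ← hA, ← hB]
    simp [uu_val, dd_val, Matrix.fromBlocks_multiply, Matrix.mul_assoc]

lemma dd_blk (X : (Matrix (m ⊕ n) (m ⊕ n) F)ˣ) (A : (Matrix m m F)ˣ) (B : (Matrix n n F)ˣ) :
    ((X * dd A B : (Matrix (m ⊕ n) (m ⊕ n) F)ˣ) : Matrix (m ⊕ n) (m ⊕ n) F).toBlocks₂₁ = (X : Matrix (m ⊕ n) (m ⊕ n) F).toBlocks₂₁ * (A : Matrix m m F) := by
  rw [Units.val_mul, dd_val]
  generalize (X : Matrix (m ⊕ n) (m ⊕ n) F) = Y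
  conv_lhs => rw [← Matrix.fromBlocks_toBlocks Y, Matrix.fromBlocks_multiply, Matrix.toBlocks_fromBlocks₂₁]
  simp

lemma uu_blk (X : (Matrix (m ⊕ n) (m ⊕ n) F)ˣ) (D : Matrix m n F) :
    ((X * uu D : (Matrix (m ⊕ n) (m ⊕ n) F)ˣ) : Matrix (m ⊕ n) (m ⊕ n) F).toBlocks₂₁ = (X : Matrix (m ⊕ n) (m ⊕ n) F).toBlocks₂₁ := by
  rw [Units.val_mul, uu_val]
  generalize (X : Matrix (m ⊕ n) (m ⊕ n) F) = Y
  conv_lhs => rw [← Matrix.fromBlocks_toBlocks Y, Matrix.fromBlocks_multiply, Matrix.toBlocks_fromBlocks₂₁]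
  simp

/-- the averaged sum -/
noncomputable def avg {k : ℕ} (α : Fin k → Fˣ →* ℂˣ) (ψ : AddChar F ℂ) (x : (Matrix (m ⊕ n) (m ⊕ n) F)ˣ) : ℂ :=
  ∑ D : Matrix m n F, GK (fun i => pM (α i) ψ) (x * uu D)

lemma avg_inv {k : ℕ} (α : Fin k → Fˣ →* ℂˣ) (ψ : AddChar F ℂ) (x : (Matrix (m ⊕ n) (m ⊕ n) F)ˣ) (D : Matrix m n F) :
    avg α ψ (x * uu D) = avg α ψ x := by
  rw [avg, avg]
  refine Fintype.sum_equiv (Equiv.addLeft D) _ _ fun D' => ?_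
  rw [Equiv.coe_addLeft, mul_assoc, uu_add]

lemma avg_succ {k : ℕ} (α : Fin (k+1) → Fˣ →* ℂˣ) (ψ : AddChar F ℂ) (x : (Matrix (m ⊕ n) (m ⊕ n) F)ˣ) :
    avg α ψ x = ∑ w, pM (α 0) ψ (x * w⁻¹) * avg (fun i => α i.succ) ψ w := by
  simp only [avg, GK_succ', Finset.mul_sum]
  rw [Finset.sum_comm (γ := Matrix m n F)]
  rw [Finset.sum_comm (s := Finset.univ) (t := Finset.univ)] 
  conv_rhs => rw [Finset.sum_comm]
  refine Finset.sum_congr rfl fun D _ => ?_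
  symm
  refine Fintype.sum_equiv (Equiv.mulRight (uu D)) _ _ fun w => ?_
  simp [mul_assoc]

lemma avg_val (ψ : AddChar F ℂ) (hψ : ∃ a, ψ a ≠ 1) {k : ℕ} (α : Fin k → Fˣ →* ℂˣ) :
    (∀ (A : (Matrix m m F)ˣ) (B : (Matrix n n F)ˣ), avg α ψ (dd A B) =
      (Fintype.card F : ℂ) ^ (k * (Fintype.card m * Fintype.card n)) * (GK (fun i => pM (α i) ψ) A * GK (fun i => pM (α i) ψ) B)) ∧
    (∀ x : (Matrix (m ⊕ n) (m ⊕ n) F)ˣ, (x : Matrix (m ⊕ n) (m ⊕ n) F).toBlocks₂₁ ≠ 0 → avg α ψ x = 0) := by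
  induction k with
  | zero =>
    constructor
    · intro A B
      simp only [avg, GK_zero]
      have : ∀ D : Matrix m n F, dd A B * uu D = 1 ↔ (A = 1 ∧ B = 1 ∧ D = 0) := by
        intro D
        rw [Units.ext_iff, Units.val_mul, uu_val, dd_val, Units.val_one, Matrix.fromBlocks_multiply, ← Matrix.fromBlocks_one, Matrix.fromBlocks_inj]
        simp only [Matrix.mul_one, Matrix.mul_zero, Matrix.zero_mul, add_zero, zero_add, true_and]
        constructor
        · rintro ⟨h1, h2, h3⟩
          rw [h1, Matrix.one_mul] at h2
          exact ⟨Units.ext h1, Units.ext h3, h2⟩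
        · rintro ⟨rfl, rfl, rfl⟩
          simp
      simp only [this]
      by_cases hA : A = 1 <;> by_cases hB : B = 1 <;> simp [hA, hB]
    · intro x hx
      rw [avg]
      refine Finset.sum_eq_zero fun D _ => ?_
      rw [GK_zero, if_neg]
      intro h
      apply hx
      rw [← uu_blk x D, h, Units.val_one, ← Matrix.fromBlocks_one, Matrix.toBlocks_fromBlocks₂₁]
  | succ k ih =>
    obtain ⟨ih1, ih2⟩ := ih (fun i => α i.succ)
    have key : ∀ x : (Matrix (m ⊕ n) (m ⊕ n) F)ˣ, avg α ψ x = ∑ A : (Matrix m m F)ˣ, ∑ B : (Matrix n n F)ˣ,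
        (pM (α 0) ψ (x * dd A⁻¹ B⁻¹) * (if (x : Matrix (m ⊕ n) (m ⊕ n) F).toBlocks₂₁ = 0 then (Fintype.card F : ℂ) ^ (Fintype.card m * Fintype.card n) else 0)) *
          avg (fun i => α i.succ) ψ (dd A B) := by
      intro x
      rw [avg_succ, sum_param _ (fun w hw => by rw [ih2 w hw, mul_zero])]
      refine Finset.sum_congr rfl fun A _ => Finset.sum_congr rfl fun B _ => ?_
      have : ∀ D : Matrix m n F, pM (α 0) ψ (x * (uu D * dd A B)⁻¹) * avg (fun i => α i.succ) ψ (uu D * dd A B) =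
          (pM (α 0) ψ (x * dd A⁻¹ B⁻¹) * ψ (Matrix.trace (((x * dd A⁻¹ B⁻¹ : (Matrix (m ⊕ n) (m ⊕ n) F)ˣ) : Matrix (m ⊕ n) (m ⊕ n) F).toBlocks₂₁ * (-D)))) *
            avg (fun i => α i.succ) ψ (dd A B) := by
        intro D
        rw [← pM_uu, uu_dd, avg_inv, ← uu_dd, mul_inv_rev, uu_inv, dd_inv, mul_assoc]
      simp only [this]
      rw [← Finset.sum_mul, ← Finset.mul_sum, sum_psi_tr' ψ hψ, dd_blk]
      congr 3
      apply propext
      constructor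
      · intro h
        have := congrArg (fun X => X * (A : Matrix m m F)) h
        simpa [Matrix.mul_assoc] using this
      · intro h; rw [h, Matrix.zero_mul]
    constructor
    · intro A B
      rw [key, GK_succ', GK_succ', Finset.sum_mul_sum, Finset.mul_sum]
      refine Finset.sum_congr rfl fun A' _ => ?_
      rw [Finset.mul_sum]
      refine Finset.sum_congr rfl fun B' _ => ?_
      rw [if_pos (by rw [dd_val, Matrix.toBlocks_fromBlocks₂₁]), dd_mul, pM_dd, ih1, Nat.succ_mul, pow_add]
      ring
    · intro x hx
      rw [key]
      simp [hx]

lemma inter_poly (A : Matrix m m F) (B : Matrix n n F) (X : Matrix m n F) (h : X * B = A * X) (p : F[X]) :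
    X * Polynomial.aeval B p = Polynomial.aeval A p * X := by
  induction p using Polynomial.induction_on' with
  | add p q hp hq => rw [map_add, map_add, Matrix.mul_add, Matrix.add_mul, hp, hq]
  | monomial i a =>
    rw [Polynomial.aeval_monomial, Polynomial.aeval_monomial, Algebra.algebraMap_eq_smul_one, Algebra.algebraMap_eq_smul_one,
      smul_one_mul, smul_one_mul, Matrix.mul_smul, Matrix.smul_mul]
    congr 1
    induction i with
    | zero => simp
    | succ i ih => rw [pow_succ, pow_succ, ← Matrix.mul_assoc, ih, Matrix.mul_assoc, h, Matrix.mul_assoc]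

lemma sylv (A : Matrix m m F) (B : Matrix n n F) (h : IsCoprime A.charpoly B.charpoly) (D : Matrix m n F) :
    ∃ X : Matrix m n F, X * B - A * X = D := by
  let L : Matrix m n F →ₗ[F] Matrix m n F :=
    { toFun := fun X => X * B - A * X
      map_add' := fun X Y => by rw [Matrix.add_mul, Matrix.mul_add]; abel
      map_smul' := fun c X => by simp [smul_sub] }
  have hinj : Function.Injective L := by
    rw [injective_iff_map_eq_zero]
    intro X hX
    have hX' : X * B = A * X := sub_eq_zero.1 hX
    obtain ⟨r, t, hrt⟩ := h
    have h1 := inter_poly A B X hX' (r * A.charpoly)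
    have h2 := congrArg (Polynomial.aeval B) hrt
    rw [map_add, map_mul (Polynomial.aeval B) t, Matrix.aeval_self_charpoly, mul_zero, add_zero, map_one] at h2
    rw [h2, map_mul, Matrix.aeval_self_charpoly, mul_zero, Matrix.zero_mul, Matrix.mul_one] at h1
    exact h1
  exact LinearMap.surjective_of_injective hinj D

lemma two_block (ψ : AddChar F ℂ) (hψ : ∃ a, ψ a ≠ 1) {k : ℕ} (α : Fin (k+1) → Fˣ →* ℂˣ) (A : (Matrix m m F)ˣ) (B : (Matrix n n F)ˣ)
    (h : IsCoprime (A : Matrix m m F).charpoly (B : Matrix n n F).charpoly) :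
    GK (fun i => pM (α i) ψ) (dd A B) =
      (Fintype.card F : ℂ) ^ (k * (Fintype.card m * Fintype.card n)) * (GK (fun i => pM (α i) ψ) A * GK (fun i => pM (α i) ψ) B) := by
  have h1 := (avg_val ψ hψ α).1 A B
  have h2 : ∀ D : Matrix m n F, GK (fun i => pM (α i) ψ) (dd A B * uu D) = GK (fun i => pM (α i) ψ) (dd A B) := by
    intro D
    obtain ⟨X, hX⟩ := sylv _ _ h ((A : Matrix m m F) * D)
    have : dd A B * uu D = uu X * dd A B * (uu X)⁻¹ := by
      rw [uu_inv]
      apply Units.ext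
      simp only [Units.val_mul, uu_val, dd_val, Matrix.fromBlocks_multiply]
      rw [Matrix.fromBlocks_inj]
      simp [← hX, sub_eq_neg_add]
    rw [this, GK_conj _ (fun i c g => pM_conj _ _ _ _)]
  rw [avg, Finset.sum_congr rfl (fun D _ => h2 D), Finset.sum_const, Finset.card_univ, card_mat, nsmul_eq_mul, Nat.cast_pow, Nat.succ_mul, pow_add] at h1
  have hq : (Fintype.card F : ℂ) ^ (Fintype.card m * Fintype.card n) ≠ 0 := pow_ne_zero _ (Nat.cast_ne_zero.2 Fintype.card_ne_zero)
  apply mul_left_cancel₀ hq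
  rw [h1]; ring
end
end KL

open scoped BigOperators Polynomial

namespace KL
section
variable {F : Type} [Field F] [Fintype F] [DecidableEq F]
variable {ι κ : Type} [Fintype ι] [DecidableEq ι] [Fintype κ] [DecidableEq κ]

/-- reindexing of units -/
def rU (F : Type) [Field F] (e : ι ≃ κ) : (Matrix ι ι F)ˣ ≃* (Matrix κ κ F)ˣ :=
  Units.mapEquiv (Matrix.reindexAlgEquiv F F e).toMulEquiv

lemma rU_val (e : ι ≃ κ) (x : (Matrix ι ι F)ˣ) : (rU F e x : Matrix κ κ F) = Matrix.reindex e e (x : Matrix ι ι F) := rfl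

lemma GK_reindex (e : ι ≃ κ) (ψ : AddChar F ℂ) {k : ℕ} (α : Fin k → Fˣ →* ℂˣ) (x : (Matrix ι ι F)ˣ) :
    GK (fun i => pM (α i) ψ) (rU F e x) = GK (fun i => pM (α i) ψ) x := by
  rw [← GK_equiv]
  congr 1
  funext i g
  have h : Units.map Matrix.detMonoidHom (rU F e g) = Units.map Matrix.detMonoidHom g := by
    apply Units.ext
    simp [rU_val]
  have h2 : Matrix.trace (Matrix.reindex e e (g : Matrix ι ι F)) = Matrix.trace (g : Matrix ι ι F) := by
    simp only [Matrix.trace, Matrix.reindex_apply, Matrix.diag_apply, Matrix.submatrix_apply]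
    exact Equiv.sum_comp e.symm (fun i => (g : Matrix ι ι F) i i)
  rw [pM, pM, h, rU_val, h2]

/-- splitting off the first block -/
noncomputable def spl {s : ℕ} (d : Fin (s+1) → ℕ) : (Fin (d 0) ⊕ Σ j : Fin s, Fin (d j.succ)) ≃ Σ j : Fin (s+1), Fin (d j) :=
  Equiv.ofBijective (Sum.elim (fun i => ⟨0, i⟩) (fun p => ⟨p.1.succ, p.2⟩)) (by
    constructor
    · rintro (i | ⟨j, i⟩) (i' | ⟨j', i'⟩) h
      · simpa using h
      · simp only [Sum.elim_inl, Sum.elim_inr, Sigma.mk.injEq] at h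
        exact absurd h.1.symm (Fin.succ_ne_zero _)
      · simp only [Sum.elim_inl, Sum.elim_inr, Sigma.mk.injEq] at h
        exact absurd h.1 (Fin.succ_ne_zero _)
      · simp only [Sum.elim_inr, Sigma.mk.injEq, Fin.succ_inj] at h
        obtain ⟨rfl, h⟩ := h
        rw [eq_of_heq h]
    · rintro ⟨j, i⟩
      induction j using Fin.cases with
      | zero => exact ⟨Sum.inl i, rfl⟩
      | succ j => exact ⟨Sum.inr ⟨j, i⟩, rfl⟩)

lemma spl_inl {s : ℕ} (d : Fin (s+1) → ℕ) (i : Fin (d 0)) : spl d (Sum.inl i) = ⟨0, i⟩ := rfl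
lemma spl_inr {s : ℕ} (d : Fin (s+1) → ℕ) (p : Σ j : Fin s, Fin (d j.succ)) : spl d (Sum.inr p) = ⟨p.1.succ, p.2⟩ := rfl

lemma bd_split {s : ℕ} (d : Fin (s+1) → ℕ) (y : ∀ j, Matrix (Fin (d j)) (Fin (d j)) F) :
    Matrix.reindex (spl d) (spl d) (Matrix.fromBlocks (y 0) 0 0 (Matrix.blockDiagonal' fun j : Fin s => y j.succ)) = Matrix.blockDiagonal' y := by
  rw [← Equiv.eq_symm_apply, Matrix.reindex_symm, Matrix.reindex_apply]
  ext a b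
  rw [Matrix.submatrix_apply, Equiv.symm_symm]
  rcases a with i | ⟨j, i⟩ <;> rcases b with i' | ⟨j', i'⟩
  · simp [spl_inl]
  · simp only [spl_inl, spl_inr, Matrix.fromBlocks_apply₁₂, Matrix.zero_apply]
    rw [Matrix.blockDiagonal'_apply_ne _ _ _ (Fin.succ_ne_zero _).symm]
  · simp only [spl_inl, spl_inr, Matrix.fromBlocks_apply₂₁, Matrix.zero_apply]
    rw [Matrix.blockDiagonal'_apply_ne _ _ _ (Fin.succ_ne_zero _)]
  · simp only [spl_inr, Matrix.fromBlocks_apply₂₂]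
    by_cases h : j = j'
    · subst h
      rw [Matrix.blockDiagonal'_apply_eq, Matrix.blockDiagonal'_apply_eq]
    · rw [Matrix.blockDiagonal'_apply_ne _ _ _ h, Matrix.blockDiagonal'_apply_ne _ _ _ (fun h' => h (Fin.succ_injective _ h'))]

lemma tri_add (a b : ℕ) : (a + b) * (a + b - 1) / 2 = a * (a - 1) / 2 + b * (b - 1) / 2 + a * b := by
  rw [← Nat.choose_two_right, ← Nat.choose_two_right, ← Nat.choose_two_right]
  induction b with
  | zero => simp
  | succ b ih =>
    rw [← add_assoc, Nat.choose_succ_succ' (a+b) 1, Nat.choose_succ_succ' b 1, ih]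
    simp
    ring

lemma multi (ψ : AddChar F ℂ) (hψ : ∃ a, ψ a ≠ 1) {k : ℕ} (α : Fin (k+1) → Fˣ →* ℂˣ) (s : ℕ) :
    ∀ (d : Fin s → ℕ) (y : ∀ j, (Matrix (Fin (d j)) (Fin (d j)) F)ˣ)
      (_ : ∀ j₁ j₂, j₁ ≠ j₂ → IsCoprime (Matrix.charpoly (y j₁ : Matrix (Fin (d j₁)) (Fin (d j₁)) F))
        (Matrix.charpoly (y j₂ : Matrix (Fin (d j₂)) (Fin (d j₂)) F)))
      (c : Fin s → ℂ)
      (_ : ∀ j, GK (fun i => pM (α i) ψ) (y j) = (-1) ^ ((d j + 1) * k) * (Fintype.card F : ℂ) ^ (k * (d j * (d j - 1) / 2)) * c j),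
      ∃ Y : (Matrix (Σ j, Fin (d j)) (Σ j, Fin (d j)) F)ˣ,
        (Y : Matrix (Σ j, Fin (d j)) (Σ j, Fin (d j)) F) = Matrix.blockDiagonal' (fun j => (y j : Matrix (Fin (d j)) (Fin (d j)) F)) ∧
        (Y : Matrix (Σ j, Fin (d j)) (Σ j, Fin (d j)) F).charpoly = ∏ j, (y j : Matrix (Fin (d j)) (Fin (d j)) F).charpoly ∧
        GK (fun i => pM (α i) ψ) Y = (-1) ^ ((∑ j, d j + s) * k) * (Fintype.card F : ℂ) ^ (k * ((∑ j, d j) * (∑ j, d j - 1) / 2)) * ∏ j, c j := by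
  induction s with
  | zero =>
    intro d y _ c _
    refine ⟨1, Subsingleton.elim _ _, ?_, ?_⟩
    · simp [Matrix.charpoly]
    · have h : ∀ a : Fˣ →* ℂˣ, ∀ g : (Matrix (Σ j, Fin (d j)) (Σ j, Fin (d j)) F)ˣ, pM a ψ g = 1 := by
        intro a g
        rw [Subsingleton.elim g 1]
        simp [pM]
      simp only [GK, h]
      simp [Subsingleton.elim _ (1 : (Matrix (Σ j, Fin (d j)) (Σ j, Fin (d j)) F)ˣ)]
  | succ s ih =>
    intro d y hc c hK
    obtain ⟨Y, hY, hch, hG⟩ := ih (fun j => d j.succ) (fun j => y j.succ)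
      (fun j₁ j₂ h => hc _ _ (fun h' => h (Fin.succ_injective _ h'))) (fun j => c j.succ) (fun j => hK j.succ)
    have hcop : IsCoprime (y 0 : Matrix (Fin (d 0)) (Fin (d 0)) F).charpoly (Y : Matrix (Σ j : Fin s, Fin (d j.succ)) (Σ j : Fin s, Fin (d j.succ)) F).charpoly := by
      rw [hch]
      exact IsCoprime.prod_right fun j _ => hc 0 j.succ (Fin.succ_ne_zero _).symm
    refine ⟨rU F (spl d) (dd (y 0) Y), ?_, ?_, ?_⟩
    · rw [rU_val, dd_val, hY]
      exact bd_split d (fun j => (y j : Matrix (Fin (d j)) (Fin (d j)) F))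
    · rw [rU_val, Matrix.charpoly_reindex, dd_val, Matrix.charpoly_fromBlocks_zero₁₂, hch, Fin.prod_univ_succ]
    · rw [GK_reindex, two_block ψ hψ α _ _ hcop, hG, hK 0, Fin.prod_univ_succ, Fin.sum_univ_succ, tri_add]
      simp only [Fintype.card_fin, Fintype.card_sigma]
      generalize ∑ j : Fin s, d j.succ = N
      rw [show (d 0 + N + (s+1)) * k = (d 0 + 1) * k + (N + s) * k by ring, Nat.mul_add k, Nat.mul_add k, pow_add, pow_add, pow_add]
      ring

end
end KL

/-- for regular elliptic `y₁ ∈ GL_{d₁}(F), …, y_s ∈ GL_{d_s}(F)` with pairwise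
coprime characteristic polynomials and roots `η_j ∈ E_j` in degree-`d_j` extensions,
`K(α,ψ,diag(y₁,…,y_s)) = (-1)^((n+s)(k-1)) q^((k-1)n(n-1)/2) ∏_j K_{E_j}(α,ψ,η_j)`. -/
theorem matrix_kloosterman_regular_semisimple
    {F : Type} [Field F] [Fintype F] [DecidableEq F]
    (ψ : AddChar F ℂ) (hψ : ∃ a : F, ψ a ≠ 1)
    {k : ℕ} (hk : 1 ≤ k) (α : Fin k → Fˣ →* ℂˣ)
    {s : ℕ} (d : Fin s → ℕ)
    (y : ∀ j, (Matrix (Fin (d j)) (Fin (d j)) F)ˣ)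
    (hirr : ∀ j, Irreducible (Matrix.charpoly (y j : Matrix (Fin (d j)) (Fin (d j)) F)))
    (hcop : ∀ j₁ j₂, j₁ ≠ j₂ →
      IsCoprime (Matrix.charpoly (y j₁ : Matrix (Fin (d j₁)) (Fin (d j₁)) F))
        (Matrix.charpoly (y j₂ : Matrix (Fin (d j₂)) (Fin (d j₂)) F)))
    {n : ℕ} (hn : n = ∑ j, d j)
    (E : Fin s → Type) [∀ j, Field (E j)] [∀ j, Fintype (E j)] [∀ j, DecidableEq (E j)]
    [∀ j, Algebra F (E j)] (hE : ∀ j, Module.finrank F (E j) = d j)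
    (η : ∀ j, E j)
    (hη : ∀ j, Polynomial.aeval (η j)
      (Matrix.charpoly (y j : Matrix (Fin (d j)) (Fin (d j)) F)) = 0) :
    matrixKloosterman α ψ
      (Matrix.blockDiagonal' (fun j => (y j : Matrix (Fin (d j)) (Fin (d j)) F)))
    = (-1 : ℂ) ^ ((n + s) * (k - 1)) *
        (Fintype.card F : ℂ) ^ ((k - 1) * (n * (n - 1) / 2)) *
        ∏ j, fieldKloosterman α ψ (E j) (η j) := by
  obtain ⟨r, rfl⟩ : ∃ r, k = r + 1 := ⟨k - 1, by omega⟩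
  obtain ⟨Y, hY, -, hG⟩ := KL.multi ψ hψ α s d y hcop (fun j => fieldKloosterman α ψ (E j) (η j)) (fun j => by
    rw [← KL.mk_eq]
    exact KL.single_mat (y j) ψ hψ α (E j) (hE j) (hirr j) (η j) (hη j))
  subst hn
  rw [← hY, KL.mk_eq, hG, Nat.add_sub_cancel]
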